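/- Let F be an algebraically closed field of characteristic zero and let n,m ≥ 2. Suppose M_{n,m}(F)^{(+)} = A + B for two proper nontrivial simple subsuperalgebras A and B. Then, possibly after interchanging A and B, one of the following holds: (1) m is even, A is isomorphic as a superalgebra to osp(n, m/2), and B is isomorphic as a superalgebra to M_{n−1,m}(F)^{(+)}; or (2) n is even, A is isomorphic as a superalgebra to osp(m, n/2), and B is isomorphic as a superalgebra to M_{m−1,n}(F)^{(+)}. -/

import Mathlib

open Matrix

namespace SJ

section SuperDefs

variable {F : Type*} [Field F] {J : Type*} [AddCommGroup J] [Module F J]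

/-- A graded subspace: `A = (A ∩ J₀) ⊕ (A ∩ J₁)`. -/
def IsGradedG (ev od : Submodule F J) (A : Submodule F J) : Prop :=
  A = (A ⊓ ev) ⊔ (A ⊓ od)

/-- A subsuperalgebra: a graded subspace closed under the product. -/
def IsSubalgG (mul : J → J → J) (ev od : Submodule F J) (A : Submodule F J) : Prop :=
  IsGradedG ev od A ∧ ∀ x ∈ A, ∀ y ∈ A, mul x y ∈ A

/-- Nontrivial: `A ∩ J₁ ≠ {0}`. -/
def NontrivG (od : Submodule F J) (A : Submodule F J) : Prop := A ⊓ od ≠ ⊥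

/-- Simple: `A∘A ≠ 0` and the only graded subspaces `I ⊆ A` with `A∘I ⊆ I` are `0` and `A`. -/
def IsSimpleG (mul : J → J → J) (ev od : Submodule F J) (A : Submodule F J) : Prop :=
  (∃ x ∈ A, ∃ y ∈ A, mul x y ≠ 0) ∧
  ∀ I : Submodule F J, I ≤ A → IsGradedG ev od I →
    (∀ x ∈ A, ∀ y ∈ I, mul x y ∈ I) → I = ⊥ ∨ I = A

/-- An isomorphism of superalgebras: an F-linear bijection mapping even part onto even
part, odd part onto odd part, and preserving the product. -/
def SuperIsoG {J₂ : Type*} [AddCommGroup J₂] [Module F J₂]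
    (mul₁ : J → J → J) (ev₁ od₁ : Submodule F J)
    (mul₂ : J₂ → J₂ → J₂) (ev₂ od₂ : Submodule F J₂)
    (A : Submodule F J) (B : Submodule F J₂) : Prop :=
  ∃ e : A ≃ₗ[F] B,
    (∀ x : A, (x : J) ∈ ev₁ ↔ (e x : J₂) ∈ ev₂) ∧
    (∀ x : A, (x : J) ∈ od₁ ↔ (e x : J₂) ∈ od₂) ∧
    ∀ x y z : A, mul₁ x y = (z : J) → mul₂ (e x) (e y) = (e z : J₂)

end SuperDefs

/-- The space of (n+m)×(n+m) matrices, indices split into even (`inl`) and odd (`inr`) ones. -/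
abbrev MJ (F : Type*) [Field F] (n m : ℕ) :=
  Matrix (Fin n ⊕ Fin m) (Fin n ⊕ Fin m) F

/-- Parity of an index. -/
def pty {n m : ℕ} : Fin n ⊕ Fin m → Bool := Sum.elim (fun _ => false) (fun _ => true)

variable (F : Type*) [Field F]

/-- The odd component of a matrix (block-antidiagonal part). -/
def oddPart {n m : ℕ} (X : MJ F n m) : MJ F n m :=
  Matrix.of fun i j => if pty i = pty j then 0 else X i j

/-- The even component of a matrix (block-diagonal part). -/
def evenPart {n m : ℕ} (X : MJ F n m) : MJ F n m :=
  Matrix.of fun i j => if pty i = pty j then X i j else 0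

variable {F}

/-- The super-Jordan product on `M_{n,m}(F)^{(+)}`:  `x∘y = (xy+yx)/2` when `x` or `y` is
even and `x∘y = (xy−yx)/2` when both are odd, extended bilinearly.  (For arbitrary
matrices this bilinear extension equals `(xy+yx)/2 − y₁x₁` where `x₁, y₁` are the odd
components.) -/
def jmul {n m : ℕ} (X Y : MJ F n m) : MJ F n m :=
  (2 : F)⁻¹ • (X * Y + Y * X) - oddPart F Y * oddPart F X

variable (F)

/-- The even part `J₀` of `M_{n,m}(F)^{(+)}`: block-diagonal matrices. -/
def evenSub (n m : ℕ) : Submodule F (MJ F n m) where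
  carrier := {X | ∀ i j, pty i ≠ pty j → X i j = 0}
  zero_mem' := by intro i j _; simp
  add_mem' := by
    intro a b ha hb i j h
    simp only [Matrix.add_apply, ha i j h, hb i j h, add_zero]
  smul_mem' := by
    intro c a ha i j h
    simp only [Matrix.smul_apply, ha i j h, smul_zero]

/-- The odd part `J₁` of `M_{n,m}(F)^{(+)}`: block-antidiagonal matrices. -/
def oddSub (n m : ℕ) : Submodule F (MJ F n m) where
  carrier := {X | ∀ i j, pty i = pty j → X i j = 0}
  zero_mem' := by intro i j _; simp
  add_mem' := by
    intro a b ha hb i j h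
    simp only [Matrix.add_apply, ha i j h, hb i j h, add_zero]
  smul_mem' := by
    intro c a ha i j h
    simp only [Matrix.smul_apply, ha i j h, smul_zero]

/-- Statements about `M_{n,m}(F)^{(+)}` specialized from the generic definitions. -/
abbrev IsGraded {n m : ℕ} (A : Submodule F (MJ F n m)) : Prop :=
  IsGradedG (evenSub F n m) (oddSub F n m) A

abbrev IsSubalg {n m : ℕ} (A : Submodule F (MJ F n m)) : Prop :=
  IsSubalgG jmul (evenSub F n m) (oddSub F n m) A

abbrev Nontriv {n m : ℕ} (A : Submodule F (MJ F n m)) : Prop :=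
  NontrivG (oddSub F n m) A

abbrev IsSimple {n m : ℕ} (A : Submodule F (MJ F n m)) : Prop :=
  IsSimpleG jmul (evenSub F n m) (oddSub F n m) A

abbrev SuperIso {n₁ m₁ n₂ m₂ : ℕ}
    (A : Submodule F (MJ F n₁ m₁)) (B : Submodule F (MJ F n₂ m₂)) : Prop :=
  SuperIsoG jmul (evenSub F n₁ m₁) (oddSub F n₁ m₁)
    jmul (evenSub F n₂ m₂) (oddSub F n₂ m₂) A B

/-- The standard symplectic matrix `S = [[0, I_q],[−I_q, 0]]` of size `2q`. -/
def SMat (q : ℕ) : Matrix (Fin (2 * q)) (Fin (2 * q)) F :=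
  Matrix.of fun i j =>
    if (j : ℕ) = (i : ℕ) + q then (1 : F) else if (i : ℕ) = (j : ℕ) + q then -1 else 0

/-- `osp(p,q)`: block matrices `[[A, C],[S⁻¹Cᵀ, D]]` inside `M_{p,2q}(F)^{(+)}` with
`A` symmetric, `C` arbitrary and `Dᵀ S = S D`.  The condition on the lower-left block is
recorded in the equivalent form `S · C₂₁ = C₁₂ᵀ`. -/
def ospSub (p q : ℕ) : Submodule F (MJ F p (2 * q)) where
  carrier := {X | (X.toBlocks₁₁)ᵀ = X.toBlocks₁₁ ∧
    SMat F q * X.toBlocks₂₁ = (X.toBlocks₁₂)ᵀ ∧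
    (X.toBlocks₂₂)ᵀ * SMat F q = SMat F q * X.toBlocks₂₂}
  zero_mem' := by
    refine ⟨?_, ?_, ?_⟩ <;> ext i j <;>
      simp [Matrix.toBlocks₁₁, Matrix.toBlocks₁₂, Matrix.toBlocks₂₁, Matrix.toBlocks₂₂,
        Matrix.mul_apply]
  add_mem' := by
    rintro a b ⟨ha1, ha2, ha3⟩ ⟨hb1, hb2, hb3⟩
    have e11 : (a + b).toBlocks₁₁ = a.toBlocks₁₁ + b.toBlocks₁₁ := rfl
    have e12 : (a + b).toBlocks₁₂ = a.toBlocks₁₂ + b.toBlocks₁₂ := rfl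
    have e21 : (a + b).toBlocks₂₁ = a.toBlocks₂₁ + b.toBlocks₂₁ := rfl
    have e22 : (a + b).toBlocks₂₂ = a.toBlocks₂₂ + b.toBlocks₂₂ := rfl
    refine ⟨?_, ?_, ?_⟩
    · rw [e11, Matrix.transpose_add, ha1, hb1]
    · rw [e21, e12, Matrix.mul_add, Matrix.transpose_add, ha2, hb2]
    · rw [e22, Matrix.transpose_add, Matrix.add_mul, Matrix.mul_add, ha3, hb3]
  smul_mem' := by
    rintro c a ⟨ha1, ha2, ha3⟩
    have e11 : (c • a).toBlocks₁₁ = c • a.toBlocks₁₁ := rfl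
    have e12 : (c • a).toBlocks₁₂ = c • a.toBlocks₁₂ := rfl
    have e21 : (c • a).toBlocks₂₁ = c • a.toBlocks₂₁ := rfl
    have e22 : (c • a).toBlocks₂₂ = c • a.toBlocks₂₂ := rfl
    refine ⟨?_, ?_, ?_⟩
    · rw [e11, Matrix.transpose_smul, ha1]
    · rw [e21, e12, Matrix.mul_smul, Matrix.transpose_smul, ha2]
    · rw [e22, Matrix.transpose_smul, Matrix.smul_mul, Matrix.mul_smul, ha3]

/-- `Q(n)`: matrices `[[A, B],[B, A]]` inside `M_{n,n}(F)^{(+)}`. -/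
def QSub (n : ℕ) : Submodule F (MJ F n n) where
  carrier := {X | (∀ i j, X (Sum.inr i) (Sum.inr j) = X (Sum.inl i) (Sum.inl j)) ∧
    (∀ i j, X (Sum.inr i) (Sum.inl j) = X (Sum.inl i) (Sum.inr j))}
  zero_mem' := by constructor <;> intro i j <;> simp
  add_mem' := by
    rintro a b ⟨ha1, ha2⟩ ⟨hb1, hb2⟩
    constructor <;> intro i j <;>
      simp only [Matrix.add_apply, ha1 i j, ha2 i j, hb1 i j, hb2 i j]
  smul_mem' := by
    rintro c a ⟨ha1, ha2⟩
    constructor <;> intro i j <;>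
      simp only [Matrix.smul_apply, ha1 i j, ha2 i j]

/-- `P(n)`: matrices `[[A, B],[C, Aᵀ]]` with `B` symmetric and `C` skew-symmetric,
inside `M_{n,n}(F)^{(+)}`. -/
def PSub (n : ℕ) : Submodule F (MJ F n n) where
  carrier := {X | (∀ i j, X (Sum.inr i) (Sum.inr j) = X (Sum.inl j) (Sum.inl i)) ∧
    (∀ i j, X (Sum.inl i) (Sum.inr j) = X (Sum.inl j) (Sum.inr i)) ∧
    (∀ i j, X (Sum.inr i) (Sum.inl j) = - X (Sum.inr j) (Sum.inl i))}
  zero_mem' := by refine ⟨?_, ?_, ?_⟩ <;> intro i j <;> simp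
  add_mem' := by
    rintro a b ⟨ha1, ha2, ha3⟩ ⟨hb1, hb2, hb3⟩
    refine ⟨?_, ?_, ?_⟩ <;> intro i j <;>
      simp only [Matrix.add_apply, ha1 i j, ha2 i j, ha3 i j, hb1 i j, hb2 i j, hb3 i j] <;>
      ring
  smul_mem' := by
    rintro c a ⟨ha1, ha2, ha3⟩
    refine ⟨?_, ?_, ?_⟩ <;> intro i j <;>
      simp only [Matrix.smul_apply, ha1 i j, ha2 i j, ha3 i j, smul_neg]


end SJ

set_option linter.all false

namespace SJ
section Basic
variable {F : Type*} [Field F] {ι : Type*} [Fintype ι] [DecidableEq ι]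
def r1 (u φ : ι → F) : Matrix ι ι F := vecMulVec u φ

theorem r1_apply (u φ : ι → F) (i j : ι) : r1 u φ i j = u i * φ j := rfl

theorem mul_r1 (x : Matrix ι ι F) (u φ : ι → F) : x * r1 u φ = r1 (x *ᵥ u) φ := mul_vecMulVec x u φ

theorem r1_mul (x : Matrix ι ι F) (u φ : ι → F) : r1 u φ * x = r1 u (φ ᵥ* x) := vecMulVec_mul u φ x

theorem r1_mulVec (u φ v : ι → F) : r1 u φ *ᵥ v = (φ ⬝ᵥ v) • u := by
  ext i; simp [r1, vecMulVec_mulVec, mul_comm]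

theorem vecMul_r1 (u φ v : ι → F) : v ᵥ* r1 u φ = (v ⬝ᵥ u) • φ := by
  ext i; simp [r1, vecMul_vecMulVec]

theorem r1_add_left (u v φ : ι → F) : r1 (u + v) φ = r1 u φ + r1 v φ := add_vecMulVec _ _ _

theorem r1_add_right (u φ ψ : ι → F) : r1 u (φ + ψ) = r1 u φ + r1 u ψ := vecMulVec_add _ _ _

theorem r1_sub_left (u v φ : ι → F) : r1 (u - v) φ = r1 u φ - r1 v φ := sub_vecMulVec _ _ _

theorem r1_sub_right (u φ ψ : ι → F) : r1 u (φ - ψ) = r1 u φ - r1 u ψ := vecMulVec_sub _ _ _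

theorem r1_smul_left (c : F) (u φ : ι → F) : r1 (c • u) φ = c • r1 u φ := smul_vecMulVec _ _ _

theorem r1_smul_right (c : F) (u φ : ι → F) : r1 u (c • φ) = c • r1 u φ := vecMulVec_smul _ _ _

theorem r1_zero_left (φ : ι → F) : r1 (0 : ι → F) φ = 0 := by ext; simp [r1_apply]

theorem r1_zero_right (φ : ι → F) : r1 φ (0 : ι → F) = 0 := by ext; simp [r1_apply]

theorem r1_mul_r1 (u φ v ψ : ι → F) : r1 u φ * r1 v ψ = (φ ⬝ᵥ v) • r1 u ψ := by
  rw [mul_r1, r1_mulVec, r1_smul_left]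

theorem trace_r1 (u φ : ι → F) : trace (r1 u φ) = φ ⬝ᵥ u := by
  rw [r1, trace_vecMulVec, dotProduct_comm]

theorem trace_r1_mul (u φ : ι → F) (x : Matrix ι ι F) : trace (r1 u φ * x) = φ ⬝ᵥ x *ᵥ u := by
  rw [r1_mul, trace_r1, dotProduct_mulVec]

theorem r1_eq_zero {u φ : ι → F} (h : r1 u φ = 0) : u = 0 ∨ φ = 0 := by
  by_contra! hc
  obtain ⟨i, hi⟩ := Function.ne_iff.1 hc.1
  obtain ⟨j, hj⟩ := Function.ne_iff.1 hc.2
  have := congrFun (congrFun h i) j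
  rw [r1_apply] at this
  simp_all
def sg (F : Type*) [Field F] (a b : Bool) : F := if a && b then -1 else 1

@[simp] theorem sg_fl (b : Bool) : sg F false b = 1 := by simp [sg]
@[simp] theorem sg_fr (b : Bool) : sg F b false = 1 := by simp [sg]
@[simp] theorem sg_tt : sg F true true = -1 := by simp [sg]
def PM (F : Type*) [Field F] (par : ι → Bool) (a : Bool) : Submodule F (Matrix ι ι F) where
  carrier := {x | ∀ i j, xor (par i) (par j) ≠ a → x i j = 0}
  zero_mem' := by intro i j _; rfl
  add_mem' := by intro x y hx hy i j h; rw [Matrix.add_apply, hx i j h, hy i j h, add_zero]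
  smul_mem' := by intro c x hx i j h; rw [Matrix.smul_apply, hx i j h, smul_zero]
def PV (F : Type*) [Field F] (par : ι → Bool) (a : Bool) : Submodule F (ι → F) where
  carrier := {x | ∀ i, par i ≠ a → x i = 0}
  zero_mem' := by intro i _; rfl
  add_mem' := by intro x y hx hy i h; rw [Pi.add_apply, hx i h, hy i h, add_zero]
  smul_mem' := by intro c x hx i h; rw [Pi.smul_apply, hx i h, smul_zero]

theorem mem_PM {par : ι → Bool} {a : Bool} {x : Matrix ι ι F} :
    x ∈ PM F par a ↔ ∀ i j, xor (par i) (par j) ≠ a → x i j = 0 := Iff.rfl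

theorem PM_mul {par : ι → Bool} {a b : Bool} {x y : Matrix ι ι F} (hx : x ∈ PM F par a)
    (hy : y ∈ PM F par b) : x * y ∈ PM F par (xor a b) := by
  intro i j h
  rw [Matrix.mul_apply]
  apply Finset.sum_eq_zero
  intro k _
  by_cases h1 : xor (par i) (par k) = a
  · rw [hy k j, mul_zero]
    rintro rfl
    apply h
    rw [← h1]
    cases par i <;> cases par k <;> cases par j <;> rfl
  · rw [hx i k h1, zero_mul]

theorem PM_mulVec {par : ι → Bool} {a b : Bool} {x : Matrix ι ι F} {v : ι → F}
    (hx : x ∈ PM F par a) (hv : v ∈ PV F par b) : x *ᵥ v ∈ PV F par (xor a b) := by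
  intro i h
  rw [Matrix.mulVec, dotProduct]
  apply Finset.sum_eq_zero
  intro k _
  by_cases h1 : xor (par i) (par k) = a
  · rw [hv k, mul_zero]
    rintro rfl
    apply h
    rw [← h1]
    cases par i <;> cases par k <;> rfl
  · rw [hx i k h1, zero_mul]

theorem PM_transpose {par : ι → Bool} {a : Bool} {x : Matrix ι ι F}
    (hx : x ∈ PM F par a) : xᵀ ∈ PM F par a := by
  intro i j h
  exact hx j i (by rwa [Bool.xor_comm])

theorem PM_vecMul {par : ι → Bool} {a b : Bool} {x : Matrix ι ι F} {v : ι → F}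
    (hx : x ∈ PM F par a) (hv : v ∈ PV F par b) : v ᵥ* x ∈ PV F par (xor a b) := by
  rw [← mulVec_transpose]
  exact PM_mulVec (PM_transpose hx) hv

theorem PM_r1 {par : ι → Bool} {a b : Bool} {u v : ι → F}
    (hu : u ∈ PV F par a) (hv : v ∈ PV F par b) : r1 u v ∈ PM F par (xor a b) := by
  intro i j h
  rw [r1_apply]
  by_cases h1 : par i = a
  · rw [hv j, mul_zero]
    rintro rfl
    exact h (by rw [h1])
  · rw [hu i h1, zero_mul]

theorem PV_dot {par : ι → Bool} {a b : Bool} {u v : ι → F} (hu : u ∈ PV F par a)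
    (hv : v ∈ PV F par b) (hab : a ≠ b) : u ⬝ᵥ v = 0 := by
  rw [dotProduct]
  apply Finset.sum_eq_zero
  intro i _
  by_cases h1 : par i = a
  · rw [hv i (by rw [h1]; exact hab), mul_zero]
  · rw [hu i h1, zero_mul]

theorem PM_one {par : ι → Bool} : (1 : Matrix ι ι F) ∈ PM F par false := by
  intro i j h
  rw [Matrix.one_apply_ne]
  rintro rfl
  simp at h
def JC (S : Submodule F (Matrix ι ι F)) : Prop := ∀ x ∈ S, ∀ y ∈ S, x * y + y * x ∈ S
def ROI (S : Submodule F (Matrix ι ι F)) : Prop :=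
  ∃ p φ : ι → F, φ ⬝ᵥ p = 1 ∧ r1 p φ ∈ S
structure Alg (par : ι → Bool) (A : Bool → Submodule F (Matrix ι ι F)) : Prop where
  hom : ∀ a, A a ≤ PM F par a
  mul : ∀ {a b x y}, x ∈ A a → y ∈ A b → x * y + sg F a b • (y * x) ∈ A (xor a b)
structure Sim (par : ι → Bool) (A : Bool → Submodule F (Matrix ι ι F)) : Prop
    extends Alg par A where
  sim : ∀ I : Bool → Submodule F (Matrix ι ι F), (∀ a, I a ≤ A a) →
    (∀ a b x y, x ∈ A a → y ∈ I b → x * y + sg F a b • (y * x) ∈ I (xor a b)) →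
    (∀ a, I a = ⊥) ∨ (∀ a, I a = A a)
  nt : A true ≠ ⊥
  nz : ∃ a b x y, x ∈ A a ∧ y ∈ A b ∧ x * y + sg F a b • (y * x) ≠ 0

section Two
variable [CharZero F]

theorem half_mem {V : Type*} [AddCommGroup V] [Module F V] {S : Submodule F V} {x : V}
    (h : x + x ∈ S) : x ∈ S := by
  have := S.smul_mem (2⁻¹ : F) h
  rwa [← two_smul F x, smul_smul, inv_mul_cancel₀ two_ne_zero, one_smul] at this

theorem JC.sq {S : Submodule F (Matrix ι ι F)} (hS : JC S) {x} (hx : x ∈ S) : x * x ∈ S :=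
  half_mem (hS x hx x hx)

theorem JC.pow {S : Submodule F (Matrix ι ι F)} (hS : JC S) {x} (hx : x ∈ S) (k : ℕ) :
    x ^ (k + 1) ∈ S := by
  induction k with
  | zero => simpa using hx
  | succ k ih =>
    apply half_mem
    have := hS _ ih _ hx
    rwa [← pow_succ, ← pow_succ'] at this

theorem jc_tri {S T : Submodule F (Matrix ι ι F)} (hS : JC S)
    (hT : ∀ a ∈ S, ∀ x ∈ T, a * x + x * a ∈ T) {a x} (ha : a ∈ S) (hx : x ∈ T) :
    a * x * a ∈ T := by
  apply half_mem
  have h1 := hT a ha _ (hT a ha x hx)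
  have h2 := hT _ (hS.sq ha) x hx
  have := T.sub_mem h1 h2
  convert this using 1
  noncomm_ring

theorem jc_tri2 {S T : Submodule F (Matrix ι ι F)} (hS : JC S)
    (hT : ∀ a ∈ S, ∀ x ∈ T, a * x + x * a ∈ T) {a b x} (ha : a ∈ S) (hb : b ∈ S) (hx : x ∈ T) :
    a * x * b + b * x * a ∈ T := by
  have h := jc_tri hS hT (S.add_mem ha hb) hx
  have := T.sub_mem (T.sub_mem h (jc_tri hS hT ha hx)) (jc_tri hS hT hb hx)
  convert this using 1
  noncomm_ring

theorem jc_tri3 {S T : Submodule F (Matrix ι ι F)} (hS : JC S)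
    (hT : ∀ a ∈ S, ∀ x ∈ T, a * x + x * a ∈ T) {a b x} (ha : a ∈ S) (hb : b ∈ S) (hx : x ∈ T) :
    a * b * x + x * b * a ∈ T := by
  have h := hT a ha _ (hT b hb x hx)
  have := T.sub_mem h (jc_tri2 hS hT ha hb hx)
  convert this using 1
  noncomm_ring

theorem JC.tri {S : Submodule F (Matrix ι ι F)} (hS : JC S) {a x} (ha : a ∈ S) (hx : x ∈ S) :
    a * x * a ∈ S := jc_tri hS hS ha hx

namespace Alg
variable {par : ι → Bool} {A : Bool → Submodule F (Matrix ι ι F)} (hA : Alg par A)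
include hA

theorem m0 (c : Bool) {a x} (ha : a ∈ A false) (hx : x ∈ A c) : a * x + x * a ∈ A c := by
  have := hA.mul ha hx
  simpa using this

theorem m11 {x y} (hx : x ∈ A true) (hy : y ∈ A true) : x * y - y * x ∈ A false := by
  have := hA.mul hx hy
  simpa [sub_eq_add_neg] using this

theorem jc : JC (A false) := fun _ hx _ hy => hA.m0 false hx hy

theorem t {c : Bool} {a x} (ha : a ∈ A false) (hx : x ∈ A c) : a * x * a ∈ A c :=
  jc_tri hA.jc (fun _ h1 _ h2 => hA.m0 c h1 h2) ha hx

theorem t2 {c : Bool} {a b x} (ha : a ∈ A false) (hb : b ∈ A false) (hx : x ∈ A c) :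
    a * x * b + b * x * a ∈ A c :=
  jc_tri2 hA.jc (fun _ h1 _ h2 => hA.m0 c h1 h2) ha hb hx

theorem t3 {c : Bool} {a b x} (ha : a ∈ A false) (hb : b ∈ A false) (hx : x ∈ A c) :
    a * b * x + x * b * a ∈ A c :=
  jc_tri3 hA.jc (fun _ h1 _ h2 => hA.m0 c h1 h2) ha hb hx

theorem t11 {a x y} (ha : a ∈ A false) (hx : x ∈ A true) (hy : y ∈ A true) :
    x * a * y - y * a * x ∈ A false := by
  apply half_mem
  have h1 := hA.m11 (hA.m0 true ha hx) hy
  have h2 := hA.m11 hx (hA.m0 true ha hy)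
  have h3 := hA.m0 false ha (hA.m11 hx hy)
  have := Submodule.sub_mem _ (Submodule.add_mem _ h1 h2) h3
  convert this using 1
  noncomm_ring

end Alg
end Two

theorem ROI.par {par : ι → Bool} {p φ : ι → F} (h1 : φ ⬝ᵥ p = 1) (h : r1 p φ ∈ PM F par false) :
    ∃ α, p ∈ PV F par α ∧ φ ∈ PV F par α := by
  have : ∃ i, φ i * p i ≠ 0 := by
    by_contra! hc
    rw [dotProduct, Finset.sum_eq_zero (fun i _ => hc i)] at h1
    exact zero_ne_one h1
  obtain ⟨i, hi⟩ := this
  refine ⟨par i, fun j hj => ?_, fun j hj => ?_⟩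
  · have := h j i (by intro h; apply hj; revert h; cases par i <;> cases par j <;> simp)
    rw [r1_apply] at this
    exact (mul_eq_zero.1 this).resolve_right (left_ne_zero_of_mul hi)
  · have := h i j (by intro h; apply hj; revert h; cases par i <;> cases par j <;> simp)
    rw [r1_apply] at this
    exact (mul_eq_zero.1 this).resolve_left (right_ne_zero_of_mul hi)

theorem ROI.mk' {S : Submodule F (Matrix ι ι F)} {u ρ : ι → F} (h : r1 u ρ ∈ S)
    (h1 : ρ ⬝ᵥ u ≠ 0) : ROI S := by
  refine ⟨u, (ρ ⬝ᵥ u)⁻¹ • ρ, ?_, ?_⟩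
  · rw [smul_dotProduct, smul_eq_mul, inv_mul_cancel₀ h1]
  · rw [r1_smul_right]; exact S.smul_mem _ h

theorem roi1 [CharZero F] {S : Submodule F (Matrix ι ι F)} (hS : JC S) {u ρ : ι → F}
    (h : r1 u ρ ∈ S) {y} (hy : y ∈ S) (h1 : ρ ⬝ᵥ y *ᵥ u ≠ 0) : ROI S := by
  by_cases h2 : ρ ⬝ᵥ u = 0
  swap
  · exact ROI.mk' h h2
  by_cases h3 : ρ ⬝ᵥ y *ᵥ (y *ᵥ u) = 0
  swap
  · have := hS.tri hy h
    rw [mul_r1, r1_mul] at this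
    exact ROI.mk' this (by rwa [← dotProduct_mulVec])
  · have h4 := hS.tri hy h
    have h5 := S.add_mem (S.add_mem h (hS _ h _ hy)) h4
    have e : r1 u ρ + (r1 u ρ * y + y * r1 u ρ) + y * r1 u ρ * y
        = r1 (u + y *ᵥ u) (ρ + ρ ᵥ* y) := by
      simp only [mul_r1, r1_mul, r1_add_left, r1_add_right]; abel
    rw [e] at h5
    apply ROI.mk' h5
    simp only [add_dotProduct, dotProduct_add, ← dotProduct_mulVec, h2, h3]
    simpa using h1

end Basic
section Spec
variable {F : Type*} [Field F] {ι : Type*} [Fintype ι] [DecidableEq ι]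

open Polynomial in
theorem spec {S : Submodule F (Matrix ι ι F)} {a : Matrix ι ι F}
    (hS : ∀ k : ℕ, a ^ (k + 1) ∈ S) (ha : ¬ IsNilpotent a) :
    ∃ h ∈ S, h ≠ 0 ∧ h * h = h ∧ ∃ q : F[X], h = aeval a q := by
  have hX : ∀ q : F[X], aeval a (X * q) ∈ S := by
    intro q
    rw [map_mul, aeval_X, aeval_eq_sum_range, Finset.mul_sum]
    apply Submodule.sum_mem
    intro i _
    rw [mul_smul_comm, ← pow_succ']
    exact S.smul_mem _ (hS i)
  have hm : minpoly F a ≠ 0 := minpoly.ne_zero (Matrix.isIntegral a)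
  obtain ⟨g, hg, hg2⟩ := Polynomial.exists_eq_pow_rootMultiplicity_mul_and_not_dvd (minpoly F a) hm 0
  set k := rootMultiplicity 0 (minpoly F a) with hk
  rw [C_0, sub_zero] at hg hg2
  have hco : IsCoprime (X ^ (k+1) : F[X]) g :=
    IsCoprime.pow_left ((Polynomial.irreducible_X.coprime_iff_not_dvd).2 hg2)
  obtain ⟨r, s, hrs⟩ := hco
  have h0 : aeval a (X ^ k * g) = 0 := by rw [← hg, minpoly.aeval]
  refine ⟨aeval a (X * (X ^ k * r)), hX _, ?_, ?_, _, rfl⟩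
  · intro h
    apply ha
    refine ⟨k, ?_⟩
    have e : (X ^ k : F[X]) = X ^ k * (X * (X ^ k * r)) + s * (X ^ k * g) := by
      linear_combination (- X ^ k) * hrs
    have := congrArg (aeval a) e
    rw [map_add, map_mul _ (X ^ k), h, map_mul _ s, h0] at this
    simpa using this
  · rw [← map_mul]
    have e : (X * (X ^ k * r) * (X * (X ^ k * r)) : F[X]) =
      X * (X ^ k * r) - X * r * s * (X ^ k * g) := by
      linear_combination (X * (X ^ k * r)) * hrs
    rw [e, map_sub, map_mul _ (X * r * s), h0, mul_zero, sub_zero]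
theorem trace_idem {h : Matrix ι ι F} (hh : h * h = h) : trace h = (h.rank : F) := by
  have h1 : IsIdempotentElem (Matrix.toLin' h) := by
    rw [IsIdempotentElem, Module.End.mul_eq_comp, ← Matrix.toLin'_mul, hh]
  rw [← Matrix.trace_toLin'_eq, (LinearMap.IsIdempotentElem.isProj_range _ h1).trace]
  rfl

end Spec

section Flag
variable {F : Type*} [Field F] {ι : Type*} [Fintype ι] [DecidableEq ι]
open Module

theorem finrank_map_ker {V W : Type*} [AddCommGroup V] [Module F V] [AddCommGroup W] [Module F W]
    [FiniteDimensional F V] (f : V →ₗ[F] W) (S : Submodule F V) :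
    finrank F (S.map f) + finrank F (S ⊓ LinearMap.ker f : Submodule F V) = finrank F S := by
  have h := LinearMap.finrank_range_add_finrank_ker (f.domRestrict S)
  rw [LinearMap.range_domRestrict, LinearMap.ker_domRestrict] at h
  rw [← h]
  congr 1
  rw [← Submodule.finrank_map_subtype_eq S, Submodule.map_comap_subtype]

theorem finrank_map_inj {V W : Type*} [AddCommGroup V] [Module F V] [AddCommGroup W] [Module F W]
    [FiniteDimensional F V] (f : V →ₗ[F] W) (S : Submodule F V) (h : ∀ x ∈ S, f x = 0 → x = 0) :
    finrank F (S.map f) = finrank F S := by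
  have h1 := finrank_map_ker f S
  have : S ⊓ LinearMap.ker f = ⊥ := by
    rw [eq_bot_iff]; rintro x ⟨hx, hx2⟩; exact h x hx hx2
  rw [this, finrank_bot] at h1
  exact h1

theorem orth_dim {κ : Type*} [Fintype κ] [DecidableEq κ] (Φ Y : Submodule F (κ → F))
    (h : ∀ u ∈ Φ, ∀ v ∈ Y, u ⬝ᵥ v = 0) : finrank F Φ + finrank F Y ≤ Fintype.card κ := by
  have h1 := Subspace.finrank_add_finrank_dualAnnihilator_eq Y
  have h2 : finrank F Φ ≤ finrank F Y.dualAnnihilator := by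
    rw [← LinearEquiv.finrank_map_eq (dotProductEquiv F κ) Φ]
    apply Submodule.finrank_mono
    rintro _ ⟨u, hu, rfl⟩
    rw [Submodule.mem_dualAnnihilator]
    intro v hv
    exact h u hu v hv
  rw [Module.finrank_pi] at h1
  omega

theorem orth_dim_s (s : Finset ι) (Φ Y : Submodule F (ι → F))
    (hΦ : ∀ u ∈ Φ, ∀ j, j ∉ s → u j = 0) (hY : ∀ u ∈ Y, ∀ j, j ∉ s → u j = 0)
    (h : ∀ u ∈ Φ, ∀ v ∈ Y, u ⬝ᵥ v = 0) : finrank F Φ + finrank F Y ≤ s.card := by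
  let f : (ι → F) →ₗ[F] (s → F) := LinearMap.funLeft F F (fun j : s => (j : ι))
  have hf : ∀ (Φ : Submodule F (ι → F)), (∀ u ∈ Φ, ∀ j, j ∉ s → u j = 0) →
      finrank F (Φ.map f) = finrank F Φ := by
    intro Φ hΦ
    apply finrank_map_inj
    intro x hx h0
    ext j
    by_cases hj : j ∈ s
    · exact congrFun h0 ⟨j, hj⟩
    · exact hΦ x hx j hj
  rw [← hf Φ hΦ, ← hf Y hY, ← Fintype.card_coe]
  apply orth_dim
  rintro _ ⟨u, hu, rfl⟩ _ ⟨v, hv, rfl⟩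
  rw [← h u hu v hv, dotProduct, dotProduct]
  refine (Finset.sum_coe_sort s (fun i => u i * v i)).trans ?_
  apply Finset.sum_subset (Finset.subset_univ s)
  intro j _ hj
  rw [hΦ u hu j hj, zero_mul]

theorem orth_dim_eq (s : Finset ι) (Φ Y : Submodule F (ι → F))
    (hΦ : ∀ u ∈ Φ, ∀ j, j ∉ s → u j = 0) (hY : ∀ u ∈ Y, ∀ j, j ∉ s → u j = 0)
    (h : ∀ u ∈ Φ, ∀ v ∈ Y, u ⬝ᵥ v = 0) (heq : s.card ≤ finrank F Φ + finrank F Y)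
    (w : ι → F) (hw : ∀ j, j ∉ s → w j = 0) (hw2 : ∀ v ∈ Y, w ⬝ᵥ v = 0) : w ∈ Φ := by
  have h1 := orth_dim_s s (Φ ⊔ Submodule.span F {w}) Y ?_ hY ?_
  · have : Φ = Φ ⊔ Submodule.span F {w} :=
      Submodule.eq_of_le_of_finrank_le le_sup_left (by omega)
    rw [this]
    exact Submodule.mem_sup_right (Submodule.mem_span_singleton_self w)
  · intro u hu j hj
    obtain ⟨a, ha, b, hb, rfl⟩ := Submodule.mem_sup.1 hu
    obtain ⟨c, rfl⟩ := Submodule.mem_span_singleton.1 hb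
    simp [hΦ a ha j hj, hw j hj]
  · intro u hu v hv
    obtain ⟨a, ha, b, hb, rfl⟩ := Submodule.mem_sup.1 hu
    obtain ⟨c, rfl⟩ := Submodule.mem_span_singleton.1 hb
    simp [add_dotProduct, h a ha v hv, hw2 v hv]
def Tr {N : ℕ} (o : ι ≃ Fin N) (S : Submodule F (Matrix ι ι F)) (t : ℕ) :
    Submodule F (Matrix ι ι F) where
  carrier := {x | x ∈ S ∧ ∀ k, t ≤ (o k : ℕ) → x k = 0}
  zero_mem' := ⟨S.zero_mem, fun _ _ => rfl⟩
  add_mem' := by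
    rintro x y ⟨hx, hx2⟩ ⟨hy, hy2⟩
    refine ⟨S.add_mem hx hy, fun k hk => ?_⟩
    change x k + y k = 0
    rw [hx2 k hk, hy2 k hk, add_zero]
  smul_mem' := by
    rintro c x ⟨hx, hx2⟩
    refine ⟨S.smul_mem c hx, fun k hk => ?_⟩
    change c • x k = 0
    rw [hx2 k hk, smul_zero]
def rowL (F : Type*) [Field F] (i : ι) : Matrix ι ι F →ₗ[F] (ι → F) where
  toFun x := x i
  map_add' _ _ := rfl
  map_smul' _ _ := rfl

theorem Tr_dim {N : ℕ} (o : ι ≃ Fin N) (S : Submodule F (Matrix ι ι F)) :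
    finrank F S = ∑ i, finrank F ((Tr o S (o i + 1)).map (rowL F i)) := by
  have h0 : Tr o S 0 = ⊥ := by
    rw [eq_bot_iff]; rintro x ⟨hx, hx2⟩
    ext i j; rw [hx2 i (Nat.zero_le _)]; rfl
  have hN : Tr o S N = S := by
    apply le_antisymm
    · rintro x ⟨hx, hx2⟩; exact hx
    · intro x hx
      exact ⟨hx, fun k hk => absurd (o k).2 (by omega)⟩
  have hs : ∀ t (ht : t < N), finrank F (Tr o S (t+1)) = finrank F (Tr o S t) +
      finrank F ((Tr o S (t + 1)).map (rowL F (o.symm ⟨t, ht⟩))) := by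
    intro t ht
    rw [← finrank_map_ker (rowL F (o.symm ⟨t, ht⟩)) (Tr o S (t+1)), add_comm]
    have : Tr o S (t+1) ⊓ LinearMap.ker (rowL F (o.symm ⟨t, ht⟩)) = Tr o S t := by
      ext x
      constructor
      · rintro ⟨⟨hx, hx2⟩, hx3⟩
        refine ⟨hx, fun k hk => ?_⟩
        by_cases h : t + 1 ≤ (o k : ℕ)
        · exact hx2 k h
        · have : k = o.symm ⟨t, ht⟩ := by
            rw [Equiv.eq_symm_apply]; ext; simp; omega
          rw [this]; exact hx3
      · rintro ⟨hx, hx2⟩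
        refine ⟨⟨hx, fun k hk => hx2 k (by omega)⟩, ?_⟩
        exact hx2 _ (by simp)
    rw [this]
  have key : ∀ t (ht : t ≤ N), finrank F (Tr o S t) =
      ∑ j : Fin t, finrank F ((Tr o S (j + 1)).map (rowL F (o.symm ⟨j, by omega⟩))) := by
    intro t
    induction t with
    | zero => intro _; rw [h0]; simp
    | succ t ih =>
      intro ht
      rw [hs t (by omega), ih (by omega), Fin.sum_univ_castSucc]
      rfl
  have := key N le_rfl
  rw [hN] at this
  rw [this, ← Equiv.sum_comp o]
  apply Finset.sum_congr rfl
  intro i _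
  have e : o.symm ⟨(o i : ℕ), (o i).2⟩ = i := o.symm_apply_apply i
  rw [e]
def Good {N : ℕ} (o : ι ≃ Fin N) (S : Submodule F (Matrix ι ι F)) : Prop :=
  ∃ i, ∃ x ∈ S, ∃ y ∈ S, (∀ k, o i < o k → x k = 0) ∧ (∀ k, o k < o i → ∀ j, y j k = 0) ∧
    x i ⬝ᵥ (fun j => y j i) ≠ 0

theorem flag_both {N : ℕ} (o : ι ≃ Fin N) (s : ι → Finset ι) (hs : ∀ i j, j ∈ s i → i ∈ s j)
    (S : Submodule F (Matrix ι ι F)) (hS : ∀ x ∈ S, ∀ i j, j ∉ s i → x i j = 0)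
    (hg : ¬ Good o S) :
    2 * finrank F S ≤ ∑ i, (s i).card ∧ (∑ i, (s i).card ≤ 2 * finrank F S → ∀ i, ∀ v : ι → F,
      (∀ j, j ∉ s i → v j = 0) →
      (∀ y ∈ S, (∀ k, o k < o i → ∀ j, y j k = 0) → v ⬝ᵥ (fun j => y j i) = 0) →
      ∃ x ∈ S, (∀ k, o i < o k → x k = 0) ∧ x i = v) := by
  set S' := S.map (Matrix.transposeLinearEquiv ι ι F F : Matrix ι ι F →ₗ[F] Matrix ι ι F) with hS'
  have hS'm : ∀ y, y ∈ S' ↔ yᵀ ∈ S := by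
    intro y
    constructor
    · rintro ⟨x, hx, rfl⟩; exact hx
    · intro h; exact ⟨yᵀ, h, rfl⟩
  set o' : ι ≃ Fin N := o.trans Fin.revPerm with ho'
  have d1 := Tr_dim o S
  have d2 := Tr_dim o' S'
  have d3 : finrank F S' = finrank F S := LinearEquiv.finrank_map_eq _ _
  have m1 : ∀ i v, v ∈ (Tr o S (o i + 1)).map (rowL F i) ↔
      ∃ x ∈ S, (∀ k, o i < o k → x k = 0) ∧ x i = v := by
    intro i v
    constructor
    · rintro ⟨x, ⟨hx, hx2⟩, rfl⟩
      exact ⟨x, hx, fun k hk => hx2 k hk, rfl⟩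
    · rintro ⟨x, hx, hx2, rfl⟩
      exact ⟨x, ⟨hx, fun k hk => hx2 k hk⟩, rfl⟩
  have m2 : ∀ i v, v ∈ (Tr o' S' (o' i + 1)).map (rowL F i) ↔
      ∃ y ∈ S, (∀ k, o k < o i → ∀ j, y j k = 0) ∧ (fun j => y j i) = v := by
    intro i v
    constructor
    · rintro ⟨x, ⟨hx, hx2⟩, rfl⟩
      refine ⟨xᵀ, (hS'm x).1 hx, fun k hk j => ?_, rfl⟩
      have := hx2 k (by
        simp only [ho', Equiv.trans_apply, Fin.revPerm_apply, Fin.val_rev]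
        have := (o i).2; have : (o k : ℕ) < o i := hk; omega)
      exact congrFun this j
    · rintro ⟨y, hy, hy2, rfl⟩
      refine ⟨yᵀ, ⟨(hS'm _).2 (by simpa using hy), fun k hk => ?_⟩, rfl⟩
      ext j
      apply hy2 k
      simp only [ho', Equiv.trans_apply, Fin.revPerm_apply, Fin.val_rev] at hk
      have := (o i).2; have := (o k).2
      rw [Fin.lt_def]; omega
  have c1 : ∀ i, ∀ u ∈ (Tr o S (o i + 1)).map (rowL F i), ∀ j, j ∉ s i → u j = 0 := by
    intro i u hu j hj
    obtain ⟨x, hx, _, rfl⟩ := (m1 i u).1 hu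
    exact hS x hx i j hj
  have c2 : ∀ i, ∀ u ∈ (Tr o' S' (o' i + 1)).map (rowL F i), ∀ j, j ∉ s i → u j = 0 := by
    intro i u hu j hj
    obtain ⟨x, hx, _, rfl⟩ := (m2 i u).1 hu
    exact hS x hx j i (fun h => hj (hs _ _ h))
  have c3 : ∀ i, ∀ u ∈ (Tr o S (o i + 1)).map (rowL F i),
      ∀ v ∈ (Tr o' S' (o' i + 1)).map (rowL F i), u ⬝ᵥ v = 0 := by
    intro i u hu v hv
    obtain ⟨x, hx, hx2, rfl⟩ := (m1 i u).1 hu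
    obtain ⟨y, hy, hy2, rfl⟩ := (m2 i v).1 hv
    by_contra hne
    exact hg ⟨i, x, hx, y, hy, hx2, hy2, hne⟩
  have c4 := fun i => orth_dim_s (s i) _ _ (c1 i) (c2 i) (c3 i)
  have c5 := Finset.sum_le_sum (fun i (_ : i ∈ Finset.univ) => c4 i)
  rw [Finset.sum_add_distrib, ← d1, ← d2, d3] at c5
  refine ⟨by omega, fun hle i v hv hv2 => ?_⟩
  have c6 : ∑ i, (finrank F ((Tr o S (o i + 1)).map (rowL F i)) +
      finrank F ((Tr o' S' (o' i + 1)).map (rowL F i))) = ∑ i, (s i).card := by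
    rw [Finset.sum_add_distrib, ← d1, ← d2, d3]; omega
  have c7 := (Finset.sum_eq_sum_iff_of_le (fun i _ => c4 i)).1 c6 i (Finset.mem_univ i)
  rw [← m1]
  apply orth_dim_eq (s i) _ _ (c1 i) (c2 i) (c3 i) c7.ge v hv
  intro w hw
  obtain ⟨y, hy, hy2, rfl⟩ := (m2 i w).1 hw
  exact hv2 y hy hy2

end Flag
section FlagUse
variable {F : Type*} [Field F] {ι : Type*} [Fintype ι] [DecidableEq ι]
open Module

theorem flag_Z {N : ℕ} (o : ι ≃ Fin N) {i : ι} {x y : Matrix ι ι F}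
    (hx : ∀ k, o i < o k → x k = 0) (hy : ∀ k, o k < o i → ∀ j, y j k = 0) :
    (x * y) * (x * y) = r1 (fun a => (x * y) a i) ((x * y) i) := by
  ext a b
  rw [Matrix.mul_apply, r1_apply, Finset.sum_eq_single i]
  · intro k _ hk
    rcases lt_or_gt_of_ne (fun h => hk (o.injective h)) with h | h
    · rw [Matrix.mul_apply (M := x) (N := y) (i := a) (k := k), Finset.sum_eq_zero, zero_mul]
      intro l _; rw [hy k h, mul_zero]
    · rw [Matrix.mul_apply (M := x) (N := y) (i := k) (k := b), Finset.sum_eq_zero, mul_zero]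
      intro l _; rw [hx k h]; simp
  · simp

theorem flag_Z3 {Z : Matrix ι ι F} {i : ι} (h : Z * Z = r1 (fun a => Z a i) (Z i)) :
    Z * Z * Z = Z i i • (Z * Z) := by
  have e1 : (Z i) ᵥ* Z = Z i i • Z i := by
    ext b
    have := congrFun (congrFun h i) b
    rw [r1_apply, Matrix.mul_apply] at this
    exact this
  rw [h, r1_mul, e1, r1_smul_right]

theorem good_even [CharZero F] {S : Submodule F (Matrix ι ι F)} (hS : JC S) {N : ℕ}
    {o : ι ≃ Fin N} (h : Good o S) : ROI S := by
  obtain ⟨i, x, hx, y, hy, h1, h2, h3⟩ := h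
  have hc : (x * y) i i ≠ 0 := h3
  have hZ := flag_Z o h1 h2
  have hZ3 := flag_Z3 hZ
  set Z := x * y with hZd
  have hg : r1 (fun a => Z a i) (Z i) * x ∈ S := by
    rw [← hZ]
    have := hS.tri hx (hS.tri hy hx)
    convert this using 1
    rw [hZd]; noncomm_ring
  rw [r1_mul] at hg
  apply roi1 hS hg hy
  rw [← dotProduct_mulVec, mulVec_mulVec, ← hZd]
  have : Z i ⬝ᵥ Z *ᵥ (fun a => Z a i) = (Z * Z * Z) i i := by
    rw [Matrix.mul_assoc]; rfl
  rw [this, hZ3, Matrix.smul_apply, hZ, r1_apply]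
  exact mul_ne_zero hc (mul_ne_zero hc hc)

theorem corner {par : ι → Bool} {x w : Matrix ι ι F} (hx : x ∈ PM F par true)
    (hx2 : ∀ i j, par i = false → x i j = 0) (hw : w ∈ PM F par false) : x * w * x = 0 := by
  ext i j
  rw [Matrix.mul_assoc, Matrix.mul_apply, Matrix.zero_apply]
  apply Finset.sum_eq_zero
  intro k _
  cases hi : par i
  · rw [hx2 i k hi, zero_mul]
  cases hk : par k
  swap
  · rw [hx i k (by simp [hi, hk]), zero_mul]
  rw [Matrix.mul_apply, Finset.sum_eq_zero, mul_zero]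
  intro l _
  cases hl : par l
  · rw [hx2 l j hl, mul_zero]
  · rw [hw k l (by simp [hk, hl]), zero_mul]

theorem good_odd [CharZero F] {par : ι → Bool} {A : Bool → Submodule F (Matrix ι ι F)}
    (hA : Alg par A) {S : Submodule F (Matrix ι ι F)} (hS : S ≤ A true) {N : ℕ}
    {o : ι ≃ Fin N} (ho : ∀ i j, par i = true → par j = false → o i < o j)
    (h : Good o S) : ROI (A false) := by
  obtain ⟨i, x, hx, y, hy, h1, h2, h3⟩ := h
  have hc : (x * y) i i ≠ 0 := h3
  have hZ := flag_Z o h1 h2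
  have hZ3 := flag_Z3 hZ
  have px := hA.hom true (hS hx)
  have py := hA.hom true (hS hy)
  have ha := hA.m11 (hS hx) (hS hy)
  have key : x * y * (y * x) = 0 ∧ y * x * (x * y) = 0 := by
    cases hi : par i
    · have hy' : ∀ a k, par a = false → y a k = 0 := by
        intro a k ha
        cases hk : par k
        · exact py a k (by simp [ha, hk])
        · exact h2 k (ho _ _ hk hi) a
      constructor
      · have := corner py hy' PM_one
        rw [Matrix.mul_one] at this
        rw [Matrix.mul_assoc, ← Matrix.mul_assoc y, this]; simp
      · have := corner py hy' (PM_mul px px)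
        rw [← this]; noncomm_ring
    · have hx' : ∀ a k, par a = false → x a k = 0 := by
        intro a k ha
        rw [h1 a (ho _ _ hi ha)]; rfl
      constructor
      · have := corner px hx' (PM_mul py py)
        rw [← this]; noncomm_ring
      · have := corner px hx' PM_one
        rw [Matrix.mul_one] at this
        rw [Matrix.mul_assoc, ← Matrix.mul_assoc x, this]; simp
  obtain ⟨k1, k2⟩ := key
  set c := (x * y) i i with hcd
  set Z := x * y with hZd
  set W := y * x with hWd
  have hW4 : W * W * W * W = c • (W * W * W) := by
    have : W * W * W * W = y * (Z * Z * Z) * x := by rw [hZd, hWd]; noncomm_ring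
    rw [this, hZ3]
    simp only [Matrix.mul_smul, Matrix.smul_mul]
    congr 1
    rw [hZd, hWd]; noncomm_ring
  have hZ4 : Z * Z * Z * Z = (c * c) • (Z * Z) := by
    rw [hZ3, Matrix.smul_mul, hZ3, smul_smul]
  have e2 : (Z - W) * (Z - W) = Z * Z + W * W := by
    have : (Z - W) * (Z - W) = Z * Z - Z * W - W * Z + W * W := by noncomm_ring
    rw [this, k1, k2]; simp
  have e3 : (Z - W) * (Z - W) * (Z - W) = Z * Z * Z - W * W * W := by
    rw [e2]
    have : (Z * Z + W * W) * (Z - W) = Z * Z * Z - W * W * W - Z * (Z * W) + W * (W * Z) := by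
      noncomm_ring
    rw [this, k1, k2]; simp
  have e4 : (Z - W) * (Z - W) * (Z - W) * (Z - W) = Z * Z * Z * Z + W * W * W * W := by
    rw [e3]
    have : (Z * Z * Z - W * W * W) * (Z - W) = Z * Z * Z * Z + W * W * W * W - Z * Z * (Z * W)
       - W * W * (W * Z) := by
      noncomm_ring
    rw [this, k1, k2]; simp
  have m3 := hA.jc.pow ha 2
  have m4 := hA.jc.pow ha 3
  have e3' : (Z - W) ^ (2 + 1) = (Z - W) * (Z - W) * (Z - W) := by noncomm_ring
  have e4' : (Z - W) ^ (3 + 1) = (Z - W) * (Z - W) * (Z - W) * (Z - W) := by noncomm_ring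
  rw [e3', e3, hZ3] at m3
  rw [e4', e4, hZ4, hW4] at m4
  have m5 := Submodule.add_mem _ (Submodule.smul_mem _ c m3) m4
  have e5 : c • (c • (Z * Z) - W * W * W) + ((c * c) • (Z * Z) + c • (W * W * W))
      = (c * c) • (Z * Z) + (c * c) • (Z * Z) := by
    rw [smul_sub, smul_smul]; abel
  rw [e5] at m5
  have m6 := half_mem m5
  rw [Submodule.smul_mem_iff _ (mul_ne_zero hc hc), hZ] at m6
  apply ROI.mk' m6
  have : Z i ⬝ᵥ (fun a => Z a i) = (Z * Z) i i := rfl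
  rw [this, hZ, r1_apply]
  exact mul_ne_zero hc hc
def sP (par : ι → Bool) (a : Bool) (i : ι) : Finset ι :=
  Finset.univ.filter (fun j => xor (par i) (par j) = a)

theorem mem_sP {par : ι → Bool} {a : Bool} {i j : ι} :
    j ∈ sP par a i ↔ xor (par i) (par j) = a := by simp [sP]

theorem finrank_supp (s : ι → Finset ι) (S : Submodule F (Matrix ι ι F))
    (hS : ∀ x, x ∈ S ↔ ∀ i j, j ∉ s i → x i j = 0) : finrank F S = ∑ i, (s i).card := by
  let κ := Σ i, s i
  let f : Matrix ι ι F →ₗ[F] (κ → F) :=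
    { toFun := fun x k => x k.1 k.2
      map_add' := fun _ _ => rfl
      map_smul' := fun _ _ => rfl }
  have h1 : finrank F (S.map f) = finrank F S := by
    apply finrank_map_inj
    intro x hx h0
    ext i j
    by_cases hj : j ∈ s i
    · exact congrFun h0 ⟨i, j, hj⟩
    · exact (hS x).1 hx i j hj
  have h2 : S.map f = ⊤ := by
    rw [eq_top_iff]
    intro g _
    refine ⟨fun i j => if h : j ∈ s i then g ⟨i, j, h⟩ else 0, (hS _).2 ?_, ?_⟩
    · intro i j hj; simp [hj]
    · ext ⟨i, j, hj⟩
      change (if h : j ∈ s i then g ⟨i, j, h⟩ else 0) = _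
      rw [dif_pos hj]
  rw [← h1, h2, finrank_top, Module.finrank_fintype_fun_eq_card]
  simp [κ]
def dP (par : ι → Bool) (a : Bool) : ℕ := ∑ i, (sP par a i).card

theorem finrank_PM (par : ι → Bool) (a : Bool) : finrank F (PM F par a) = dP par a := by
  apply finrank_supp
  intro x
  rw [mem_PM]
  simp only [mem_sP, ne_eq]

theorem E1 [CharZero F] {par : ι → Bool} {S : Submodule F (Matrix ι ι F)} (hS : JC S)
    (hp : S ≤ PM F par false) (hd : dP par false < 2 * finrank F S) : ROI S := by
  by_contra hr
  have hg : ¬ Good (Fintype.equivFin ι) S := fun h => hr (good_even hS h)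
  have := (flag_both (Fintype.equivFin ι) (sP par false) ?_ S ?_ hg).1
  · unfold dP at hd; omega
  · intro i j; simp only [mem_sP]; rw [Bool.xor_comm]; exact id
  · intro x hx i j hj
    exact hp hx i j (by simpa only [mem_sP] using hj)

theorem exists_ord (par : ι → Bool) :
    ∃ (N : ℕ) (o : ι ≃ Fin N), ∀ i j, par i = true → par j = false → o i < o j := by
  let e1 := (Equiv.sumCompl (fun i => par i = true)).symm
  let e2 := Equiv.sumCongr (Fintype.equivFin {i // par i = true}) (Fintype.equivFin {i // ¬ par i = true})
  refine ⟨_, (e1.trans e2).trans finSumFinEquiv, ?_⟩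
  intro i j hi hj
  have hi' : e1 i = Sum.inl ⟨i, hi⟩ := by
    rw [Equiv.symm_apply_eq]; rfl
  have hj' : e1 j = Sum.inr ⟨j, by simp [hj]⟩ := by
    rw [Equiv.symm_apply_eq]; rfl
  rw [Fin.lt_def]
  simp only [Equiv.trans_apply, hi', hj', e2, Equiv.sumCongr_apply, Sum.map_inl, Sum.map_inr,
    finSumFinEquiv_apply_left, finSumFinEquiv_apply_right, Fin.val_castAdd, Fin.val_natAdd]
  omega

theorem E1odd [CharZero F] {par : ι → Bool} {A : Bool → Submodule F (Matrix ι ι F)}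
    (hA : Alg par A) {S : Submodule F (Matrix ι ι F)} (hS : S ≤ A true)
    (s : ι → Finset ι) (hs : ∀ i j, j ∈ s i → i ∈ s j)
    (hs2 : ∀ x ∈ S, ∀ i j, j ∉ s i → x i j = 0)
    (hd : ∑ i, (s i).card < 2 * finrank F S) : ROI (A false) := by
  by_contra hr
  obtain ⟨N, o, ho⟩ := exists_ord par
  have hg : ¬ Good o S := fun h => hr (good_odd hA hS ho h)
  have := (flag_both o s hs S hs2 hg).1
  omega
def conjL (P Q : Matrix ι ι F) : Matrix ι ι F →ₗ[F] Matrix ι ι F where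
  toFun x := P * x * Q
  map_add' x y := by simp [Matrix.mul_add, Matrix.add_mul]
  map_smul' c x := by simp

theorem E2 [CharZero F] {par : ι → Bool} {S : Submodule F (Matrix ι ι F)} (hS : JC S)
    (hp : S ≤ PM F par false) (hd : dP par false ≤ 2 * finrank F S) (h1 : (1 : Matrix ι ι F) ∉ S) :
    ROI S := by
  have hJ : JC (S ⊔ Submodule.span F {(1 : Matrix ι ι F)}) := by
    intro x hx y hy
    obtain ⟨a, ha, b, hb, rfl⟩ := Submodule.mem_sup.1 hx
    obtain ⟨c, rfl⟩ := Submodule.mem_span_singleton.1 hb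
    obtain ⟨a2, ha2, b2, hb2, rfl⟩ := Submodule.mem_sup.1 hy
    obtain ⟨c2, rfl⟩ := Submodule.mem_span_singleton.1 hb2
    have e : (a + c • 1) * (a2 + c2 • 1) + (a2 + c2 • 1) * (a + c • 1) =
      (a * a2 + a2 * a + (c2 + c2) • a + (c + c) • a2) + (c * c2 + c2 * c) • (1 : Matrix ι ι F) := by
      simp only [Matrix.mul_add, Matrix.add_mul, Matrix.mul_smul, Matrix.smul_mul, Matrix.mul_one,
        Matrix.one_mul, smul_smul, add_smul, smul_add]
      abel
    rw [e]
    refine Submodule.add_mem_sup ?_ (Submodule.smul_mem _ _ (Submodule.mem_span_singleton_self _))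
    exact S.add_mem (S.add_mem (hS _ ha _ ha2) (S.smul_mem _ ha)) (S.smul_mem _ ha2)
  have hP : S ⊔ Submodule.span F {(1 : Matrix ι ι F)} ≤ PM F par false := by
    apply sup_le hp
    rw [Submodule.span_le]
    rintro _ rfl
    exact PM_one
  have hlt : S < S ⊔ Submodule.span F {(1 : Matrix ι ι F)} := by
    refine lt_of_le_of_ne le_sup_left (fun h => h1 ?_)
    rw [h]
    exact Submodule.mem_sup_right (Submodule.mem_span_singleton_self _)
  obtain ⟨p, φ, hpφ, hm⟩ := E1 hJ hP (by have := Submodule.finrank_lt_finrank_of_lt hlt; omega)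
  obtain ⟨a, ha, b, hb, hab⟩ := Submodule.mem_sup.1 hm
  obtain ⟨l, rfl⟩ := Submodule.mem_span_singleton.1 hb
  have ha' : a = r1 p φ - l • 1 := by rw [← hab]; simp
  have hsq : r1 p φ * r1 p φ = r1 p φ := by rw [r1_mul_r1, hpφ, one_smul]
  by_cases hl : l = 1
  swap
  · refine ⟨p, φ, hpφ, ?_⟩
    have := S.add_mem (hS.sq ha) (S.smul_mem l ha)
    have e : a * a + l • a = (1 - l) • r1 p φ := by
      rw [ha']
      simp only [Matrix.mul_sub, Matrix.sub_mul, Matrix.mul_smul, Matrix.smul_mul, Matrix.mul_one,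
        Matrix.one_mul, hsq, smul_sub, sub_smul, one_smul]
      abel
    rwa [e, Submodule.smul_mem_iff _ (sub_ne_zero.2 (Ne.symm hl))] at this
  subst hl
  have hg : 1 - r1 p φ ∈ S := by
    have := S.neg_mem ha
    rw [ha'] at this
    simpa using this
  have hx : ∀ x ∈ S, (φ ⬝ᵥ x *ᵥ p) • r1 p φ ∈ S := by
    intro x hx
    have := S.add_mem (S.sub_mem hx (hS _ hg _ hx)) (hS.tri hg hx)
    convert this using 1
    have e : x - ((1 - r1 p φ) * x + x * (1 - r1 p φ)) + (1 - r1 p φ) * x * (1 - r1 p φ) =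
      r1 p φ * x * r1 p φ := by noncomm_ring
    rw [e, r1_mul, r1_mul_r1, dotProduct_mulVec]
  by_cases h0 : ∃ x ∈ S, φ ⬝ᵥ x *ᵥ p ≠ 0
  · obtain ⟨x, hxS, h0⟩ := h0
    refine ⟨p, φ, hpφ, ?_⟩
    exact (Submodule.smul_mem_iff _ h0).1 (hx x hxS)
  push Not at h0
  obtain ⟨α, hpα, hφα⟩ := ROI.par hpφ (hP hm)
  have hex : ∃ i, p i ≠ 0 := by
    by_contra! hc
    have : p = 0 := funext hc
    rw [this] at hpφ; simp at hpφ
  obtain ⟨i, hi⟩ := hex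
  have hiα : par i = α := by by_contra h; exact hi (hpα i h)
  set e : ι → F := Pi.single i 1 with he
  set Q : Matrix ι ι F := 1 + r1 (p - e) e with hQ
  set P : Matrix ι ι F := 1 - (p i)⁻¹ • r1 (p - e) e with hPd
  have hee : e ⬝ᵥ (p - e) = p i - 1 := by simp [he]
  have hsq2 : r1 (p - e) e * r1 (p - e) e = (p i - 1) • r1 (p - e) e := by rw [r1_mul_r1, hee]
  have hPQ : P * Q = 1 := by
    rw [hPd, hQ]
    simp only [Matrix.mul_add, Matrix.sub_mul, Matrix.mul_one, Matrix.one_mul, Matrix.smul_mul, hsq2,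
      smul_smul]
    have : (p i)⁻¹ * (p i - 1) = 1 - (p i)⁻¹ := by field_simp
    rw [this, sub_smul, one_smul]; abel
  have hQP : Q * P = 1 := mul_eq_one_comm.1 hPQ
  have hQe : Q *ᵥ e = p := by
    rw [hQ, add_mulVec, r1_mulVec, one_mulVec]; simp [he]
  have heα : e ∈ PV F par α := by
    intro j hj
    rw [he, Pi.single_apply, if_neg]
    rintro rfl; exact hj hiα
  have hQ0 : Q ∈ PM F par false := by
    have := PM_r1 (Submodule.sub_mem _ hpα heα) heα
    rw [Bool.xor_self] at this
    exact Submodule.add_mem _ PM_one this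
  have hP0 : P ∈ PM F par false := by
    have := PM_r1 (Submodule.sub_mem _ hpα heα) heα
    rw [Bool.xor_self] at this
    exact Submodule.sub_mem _ PM_one (Submodule.smul_mem _ _ this)
  set S' := S.map (conjL P Q) with hS'
  have hback : ∀ x, x ∈ S' ↔ Q * x * P ∈ S := by
    intro x
    constructor
    · rintro ⟨y, hy, rfl⟩
      have : Q * (P * y * Q) * P = (Q * P) * y * (Q * P) := by noncomm_ring
      change Q * (P * y * Q) * P ∈ S
      rw [this, hQP]; simpa using hy
    · intro h
      refine ⟨_, h, ?_⟩
      change P * (Q * x * P) * Q = x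
      have : P * (Q * x * P) * Q = (P * Q) * x * (P * Q) := by noncomm_ring
      rw [this, hPQ]; simp
  have hJS' : JC S' := by
    intro x hx y hy
    rw [hback] at hx hy ⊢
    convert hS _ hx _ hy using 1
    have : Q * x * P * (Q * y * P) + Q * y * P * (Q * x * P) =
      Q * x * (P * Q) * y * P + Q * y * (P * Q) * x * P := by noncomm_ring
    rw [this, hPQ]; noncomm_ring
  have hd' : finrank F S' = finrank F S := by
    apply finrank_map_inj
    intro x hx h
    have h : P * x * Q = 0 := h
    have : x = Q * (P * x * Q) * P := by
      have : Q * (P * x * Q) * P = (Q * P) * x * (Q * P) := by noncomm_ring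
      rw [this, hQP]; simp
    rw [this, h]; simp
  have hp' : S' ≤ PM F par false := by
    rintro _ ⟨x, hx, rfl⟩
    have := PM_mul (PM_mul hP0 (hp hx)) hQ0
    exact this
  by_cases hr : ROI S'
  · obtain ⟨u, ψ, h2, h3⟩ := hr
    rw [hback, mul_r1, r1_mul] at h3
    refine ⟨_, _, ?_, h3⟩
    rw [← dotProduct_mulVec, mulVec_mulVec, hPQ, one_mulVec, h2]
  haveI : NeZero (Fintype.card ι) := ⟨(Fintype.card_pos_iff.2 ⟨i⟩).ne'⟩
  let o0 := Fintype.equivFin ι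
  let o : ι ≃ Fin (Fintype.card ι) := o0.trans (Equiv.swap (o0 i) 0)
  have hoi : o i = 0 := by simp [o]
  have hg : ¬ Good o S' := fun h => hr (good_even hJS' h)
  have := (flag_both o (sP par false) ?_ S' ?_ hg).2 (by unfold dP at hd; omega) i (φ ᵥ* Q) ?_ ?_
  · obtain ⟨x, hx, hx2, hx3⟩ := this
    refine ⟨p, φ, hpφ, ?_⟩
    have hxe : x = r1 e (φ ᵥ* Q) := by
      ext a b
      rw [r1_apply]
      by_cases hai : a = i
      · subst hai; rw [hx3]; simp [he]
      · rw [hx2 a, he, Pi.single_eq_of_ne hai]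
        · simp
        · rw [hoi]
          refine Fin.pos_iff_ne_zero.2 (fun h => hai (o.injective ?_))
          rw [h, hoi]
    rw [hback, hxe, mul_r1, r1_mul, vecMul_vecMul, hQP, vecMul_one, hQe] at hx
    exact hx
  · intro i j; simp only [mem_sP]; rw [Bool.xor_comm]; exact id
  · intro x hx i j hj
    exact hp' hx i j (by simpa only [mem_sP] using hj)
  · intro j hj
    rw [mem_sP] at hj
    have := PM_vecMul hQ0 hφα
    rw [Bool.false_xor] at this
    apply this
    rintro h; apply hj; rw [hiα, h]; simp
  · intro y hy _
    rw [hback] at hy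
    have h5 := h0 _ hy
    have e6 : (fun j => y j i) = y *ᵥ e := by ext j; simp [he]
    have hPp : P *ᵥ p = e := by rw [← hQe, mulVec_mulVec, hPQ, one_mulVec]
    rw [e6, ← dotProduct_mulVec, mulVec_mulVec]
    rwa [← mulVec_mulVec, hPp] at h5

theorem S1 [CharZero F] {par : ι → Bool} {A B : Submodule F (Matrix ι ι F)} (hA : JC A) (hB : JC B)
    (hAB : A ⊔ B = PM F par false) (hι : Nonempty ι) : ROI A ∨ ROI B := by
  by_contra! hc
  have hAp : A ≤ PM F par false := hAB ▸ le_sup_left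
  have hBp : B ≤ PM F par false := hAB ▸ le_sup_right
  have h1 := Submodule.finrank_sup_add_finrank_inf_eq A B
  rw [hAB, finrank_PM] at h1
  have h2 : ¬ (dP par false < 2 * finrank F A) := fun h => hc.1 (E1 hA hAp h)
  have h3 : ¬ (dP par false < 2 * finrank F B) := fun h => hc.2 (E1 hB hBp h)
  have h4 : finrank F (A ⊓ B : Submodule F (Matrix ι ι F)) = 0 := by omega
  rw [Submodule.finrank_eq_zero] at h4
  have h5 : (1 : Matrix ι ι F) ∈ A := by
    by_contra h; exact hc.1 (E2 hA hAp (by omega) h)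
  have h6 : (1 : Matrix ι ι F) ∈ B := by
    by_contra h; exact hc.2 (E2 hB hBp (by omega) h)
  have h7 : (1 : Matrix ι ι F) ∈ A ⊓ B := ⟨h5, h6⟩
  rw [h4, Submodule.mem_bot] at h7
  exact one_ne_zero h7

end FlagUse
section Engel
variable {F : Type*} [Field F] {ι : Type*} [Fintype ι] [DecidableEq ι]
open Module
def KS (S : Submodule F (Matrix ι ι F)) : ℕ → Submodule F (ι → F)
  | 0 => ⊥
  | i + 1 =>
    { carrier := {v | ∀ s ∈ S, s *ᵥ v ∈ KS S i}
      zero_mem' := by intro s _; rw [mulVec_zero]; exact Submodule.zero_mem _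
      add_mem' := by intro u v hu hv s hs; rw [mulVec_add]; exact Submodule.add_mem _ (hu s hs) (hv s hs)
      smul_mem' := by intro c v hv s hs; rw [mulVec_smul]; exact Submodule.smul_mem _ c (hv s hs) }

theorem KS_mono {S : Submodule F (Matrix ι ι F)} : Monotone (KS S) := by
  apply monotone_nat_of_le_succ
  intro i
  induction i with
  | zero => exact bot_le
  | succ i ih => intro v hv s hs; exact ih (hv s hs)

theorem engel (n : ℕ) : ∀ (R : Submodule F (Matrix ι ι F)), finrank F R ≤ n → JC R →
    (∀ r ∈ R, IsNilpotent r) → ∀ Z X : Submodule F (ι → F), Z < X →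
    (∀ r ∈ R, ∀ v ∈ Z, r *ᵥ v ∈ Z) → (∀ r ∈ R, ∀ v ∈ X, r *ᵥ v ∈ X) →
    ∃ v ∈ X, v ∉ Z ∧ ∀ r ∈ R, r *ᵥ v ∈ Z := by
  induction n with
  | zero =>
    intro R hR _ _ Z X hZX _ _
    rw [Nat.le_zero, Submodule.finrank_eq_zero] at hR
    subst hR
    obtain ⟨v, hv, hv2⟩ := SetLike.exists_of_lt hZX
    refine ⟨v, hv, hv2, fun r hr => ?_⟩
    rw [Submodule.mem_bot] at hr
    rw [hr, zero_mulVec]; exact Z.zero_mem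
  | succ n ih =>
    intro R hR hJ hnil Z X hZX hRZ hRX
    by_cases hR0 : R = ⊥
    · subst hR0
      obtain ⟨v, hv, hv2⟩ := SetLike.exists_of_lt hZX
      refine ⟨v, hv, hv2, fun r hr => ?_⟩
      rw [Submodule.mem_bot] at hr
      rw [hr, zero_mulVec]; exact Z.zero_mem
    obtain ⟨S, ⟨hSJ, hSR⟩, hmax⟩ := (wellFounded_gt (α := Submodule F (Matrix ι ι F))).has_min
      {S | JC S ∧ S < R} ⟨⊥, by
        intro x hx y hy
        rw [Submodule.mem_bot] at hx hy ⊢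
        rw [hx, hy]; simp, bot_lt_iff_ne_bot.2 hR0⟩
    have hdS : finrank F S ≤ n := by have := Submodule.finrank_lt_finrank_of_lt hSR; omega
    have ihS := ih S hdS hSJ (fun r hr => hnil r (hSR.le hr))
    have hgrow : ∀ i, KS S i ≠ ⊤ → KS S i < KS S (i+1) := by
      intro i hi
      have hst : ∀ r ∈ S, ∀ v ∈ KS S i, r *ᵥ v ∈ KS S i := by
        intro r hr v hv
        cases i with
        | zero =>
          have hv : v = 0 := hv
          rw [hv, mulVec_zero]; exact Submodule.zero_mem _
        | succ i => exact KS_mono (Nat.le_succ i) (hv r hr)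
      obtain ⟨v, _, hv2, hv3⟩ := ihS (KS S i) ⊤ (lt_top_iff_ne_top.2 hi) hst (fun _ _ _ _ => trivial)
      exact SetLike.lt_iff_le_and_exists.2 ⟨KS_mono (Nat.le_succ i), v, hv3, hv2⟩
    have hN : ∃ N, KS S N = ⊤ := by
      by_contra! hc
      have : ∀ i, i ≤ finrank F (KS S i) := by
        intro i
        induction i with
        | zero => omega
        | succ i ih2 =>
          have := Submodule.finrank_lt_finrank_of_lt (hgrow i (hc i)); omega
      have h1 := this (finrank F (ι → F) + 1)
      have h2 := Submodule.finrank_le (KS S (finrank F (ι → F) + 1))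
      omega
    obtain ⟨N, hN⟩ := hN
    let Q : ℕ → Matrix ι ι F → Prop := fun d m => ∀ i j, i + N ≤ j + d → ∀ v ∈ KS S i, m *ᵥ v ∈ KS S j
    have hQ0 : ∀ m, Q 0 m := by
      intro m i j hij v _
      have : KS S j = ⊤ := by
        rw [eq_top_iff, ← hN]; exact KS_mono (by omega)
      rw [this]; trivial
    have hQN : ∀ m, Q (2 * N) m → m = 0 := by
      intro m hm
      ext a b
      have : m *ᵥ (Pi.single b 1) = 0 := hm N 0 (by omega) _ (by rw [hN]; trivial)
      have := congrFun this a
      simpa using this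
    have hQs : ∀ d m s, Q d m → s ∈ S → Q (d+1) (m * s + s * m) := by
      intro d m s hm hs i j hij v hv
      rw [add_mulVec, ← mulVec_mulVec, ← mulVec_mulVec]
      cases i with
      | zero =>
        have hv : v = 0 := hv
        rw [hv]; simp
      | succ i =>
        refine Submodule.add_mem _ (hm i j (by omega) _ (hv s hs)) ?_
        exact hm (i+1) (j+1) (by omega) v hv s hs
    have hd : ∃ d, (∃ r ∈ R, r ∉ S ∧ Q d r) ∧ ¬ (∃ r ∈ R, r ∉ S ∧ Q (d+1) r) := by
      by_contra! hc
      have : ∀ d, ∃ r ∈ R, r ∉ S ∧ Q d r := by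
        intro d
        induction d with
        | zero =>
          obtain ⟨r, hr, hr2⟩ := SetLike.exists_of_lt hSR
          exact ⟨r, hr, hr2, hQ0 r⟩
        | succ d ih2 => exact hc d ih2
      obtain ⟨r, _, hr2, hr3⟩ := this (2 * N)
      exact hr2 (by rw [hQN r hr3]; exact S.zero_mem)
    obtain ⟨d, ⟨r, hrR, hrS, hrQ⟩, hd2⟩ := hd
    have hrs : ∀ s ∈ S, r * s + s * r ∈ S := by
      intro s hs
      by_contra h
      exact hd2 ⟨_, hJ _ hrR _ (hSR.le hs), h, hQs d r s hrQ hs⟩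
    obtain ⟨v, hvX, hvZ, hvS⟩ := ihS Z X hZX (fun s hs => hRZ s (hSR.le hs)) (fun s hs => hRX s (hSR.le hs))
    have hpow : ∀ k, (r ^ k *ᵥ v ∈ X ∧ ∀ s ∈ S, s *ᵥ (r ^ k *ᵥ v) ∈ Z) := by
      intro k
      induction k with
      | zero => simpa using ⟨hvX, hvS⟩
      | succ k ih2 =>
        rw [pow_succ', ← mulVec_mulVec]
        refine ⟨hRX r hrR _ ih2.1, fun s hs => ?_⟩
        have e : s *ᵥ (r *ᵥ (r ^ k *ᵥ v)) = (r * s + s * r) *ᵥ (r ^ k *ᵥ v) -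
            r *ᵥ (s *ᵥ (r ^ k *ᵥ v)) := by
          rw [add_mulVec, ← mulVec_mulVec, ← mulVec_mulVec]; abel
        rw [e]
        exact Z.sub_mem (ih2.2 _ (hrs s hs)) (hRZ r hrR _ (ih2.2 s hs))
    have hv0 : ∃ w ∈ X, w ∉ Z ∧ (∀ s ∈ S, s *ᵥ w ∈ Z) ∧ r *ᵥ w ∈ Z := by
      obtain ⟨k, hk⟩ := hnil r hrR
      have hex : ∃ k, r ^ k *ᵥ v ∈ Z := ⟨k, by rw [hk, zero_mulVec]; exact Z.zero_mem⟩
      classical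
      have h1 := Nat.find_spec hex
      set k0 := Nat.find hex with hk0
      cases hk0c : k0 with
      | zero => rw [hk0c] at h1; simp at h1; exact absurd h1 hvZ
      | succ k1 =>
        have h2 := Nat.find_min hex (m := k1) (by omega)
        refine ⟨r ^ k1 *ᵥ v, (hpow k1).1, h2, (hpow k1).2, ?_⟩
        rwa [mulVec_mulVec, ← pow_succ', ← hk0c]
    obtain ⟨w, hwX, hwZ, hwS, hwr⟩ := hv0
    refine ⟨w, hwX, hwZ, ?_⟩
    let C : Submodule F (Matrix ι ι F) :=
      { carrier := {c | c ∈ R ∧ c *ᵥ w ∈ Z}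
        zero_mem' := ⟨R.zero_mem, by rw [zero_mulVec]; exact Z.zero_mem⟩
        add_mem' := by
          rintro a b ⟨ha, ha2⟩ ⟨hb, hb2⟩
          exact ⟨R.add_mem ha hb, by rw [add_mulVec]; exact Z.add_mem ha2 hb2⟩
        smul_mem' := by
          rintro a b ⟨hb, hb2⟩
          exact ⟨R.smul_mem a hb, by rw [smul_mulVec]; exact Z.smul_mem a hb2⟩ }
    have hCJ : JC C := by
      rintro x ⟨hx, hx2⟩ y ⟨hy, hy2⟩
      refine ⟨hJ _ hx _ hy, ?_⟩
      rw [add_mulVec, ← mulVec_mulVec, ← mulVec_mulVec]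
      exact Z.add_mem (hRZ x hx _ hy2) (hRZ y hy _ hx2)
    have hrC : r ∈ C := And.intro hrR hwr
    have hSCle : S ≤ C := fun s hs => And.intro (hSR.le hs) (hwS s hs)
    have hSC : S < C := SetLike.lt_iff_le_and_exists.2 ⟨hSCle, r, hrC, hrS⟩
    have hCR : C = R := by
      by_contra h
      exact hmax C ⟨hCJ, lt_of_le_of_ne (fun c hc => hc.1) h⟩ hSC
    intro c hc
    rw [← hCR] at hc
    exact hc.2

end Engel
section SSsec
variable {F : Type*} [Field F] [CharZero F] {ι : Type*} [Fintype ι] [DecidableEq ι]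
open Module

theorem rank0 {h : Matrix ι ι F} (h2 : h.rank = 0) : h = 0 := by
  rw [Matrix.rank, Submodule.finrank_eq_zero, LinearMap.range_eq_bot] at h2
  ext i j
  have := congrFun (LinearMap.congr_fun h2 (Pi.single j 1)) i
  simpa using this
structure Stab (par : ι → Bool) (B : Bool → Submodule F (Matrix ι ι F))
    (Z : Bool → Submodule F (ι → F)) : Prop where
  le : ∀ c, Z c ≤ PV F par c
  st : ∀ {a c b v}, b ∈ B a → v ∈ Z c → b *ᵥ v ∈ Z (xor a c)
def Rad (S : Submodule F (Matrix ι ι F)) : Submodule F (Matrix ι ι F) where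
  carrier := {r | r ∈ S ∧ ∀ b ∈ S, trace (r * b) = 0}
  zero_mem' := ⟨S.zero_mem, by intro b _; simp⟩
  add_mem' := by
    rintro x y ⟨hx, hx2⟩ ⟨hy, hy2⟩
    exact ⟨S.add_mem hx hy, fun b hb => by rw [add_mul, trace_add, hx2 b hb, hy2 b hb, add_zero]⟩
  smul_mem' := by
    rintro c x ⟨hx, hx2⟩
    exact ⟨S.smul_mem c hx, fun b hb => by rw [smul_mul_assoc, trace_smul, hx2 b hb, smul_zero]⟩

theorem Rad.o {S : Submodule F (Matrix ι ι F)} (hS : JC S) {r b} (hr : r ∈ Rad S) (hb : b ∈ S) :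
    r * b + b * r ∈ Rad S := by
  refine ⟨hS _ hr.1 _ hb, fun c hc => ?_⟩
  have h1 := hr.2 _ (hS _ hb _ hc)
  rw [mul_add, trace_add] at h1
  rw [add_mul, trace_add, mul_assoc, trace_mul_cycle b r c, trace_mul_comm (c * b) r]
  exact h1

theorem Rad.nil [IsAlgClosed F] {S : Submodule F (Matrix ι ι F)} (hS : JC S) {r} (hr : r ∈ Rad S) : IsNilpotent r := by
  by_contra hn
  have hJ : JC (Rad S) := fun x hx y hy => Rad.o hS hx hy.1
  obtain ⟨h, hh, h0, hi, _⟩ := spec (S := Rad S) (fun k => hJ.pow hr k) hn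
  have h1 := hh.2 h hh.1
  rw [hi, trace_idem hi] at h1
  have h2 : h.rank = 0 := by exact_mod_cast h1
  exact h0 (rank0 h2)

variable {par : ι → Bool} {B : Bool → Submodule F (Matrix ι ι F)}

theorem Rad.br (hB : Alg par B) {x y r} (hx : x ∈ B true) (hy : y ∈ B true) (hr : r ∈ Rad (B false)) :
    (x * y + y * x) * r - r * (x * y + y * x) ∈ Rad (B false) := by
  have key : ∀ r ∈ B false, (x * y + y * x) * r - r * (x * y + y * x) ∈ B false := by
    intro r hr
    have h1 := hB.m11 hx (hB.m0 true hr hy)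
    have h2 := hB.m11 hy (hB.m0 true hr hx)
    have := Submodule.add_mem _ h1 h2
    convert this using 1
    noncomm_ring
  refine ⟨key r hr.1, fun c hc => ?_⟩
  have h1 := hr.2 _ (key c hc)
  rw [mul_sub, trace_sub] at h1
  rw [sub_mul, trace_sub]
  generalize x * y + y * x = D at *
  rw [trace_mul_cycle D r c, trace_mul_comm (c * D) r, mul_assoc r D c, ← neg_sub, h1, neg_zero]

theorem stab_LL [IsAlgClosed F] (hB : Alg par B) {Z : Bool → Submodule F (ι → F)} (hZ : Stab par B Z) (β : Bool)
    (W : Submodule F (ι → F)) (hZW : Z β < W)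
    (h0 : ∀ b ∈ B false, ∀ v ∈ W, b *ᵥ v ∈ W)
    (h1 : ∀ x ∈ B true, ∀ y ∈ B true, ∀ v ∈ W, x *ᵥ (y *ᵥ v) ∈ W) :
    ∃ L : Submodule F (ι → F), Z β < L ∧ L ≤ W ∧ (∀ r ∈ Rad (B false), ∀ v ∈ L, r *ᵥ v ∈ Z β) ∧
     (∀ b ∈ B false, ∀ v ∈ L, b *ᵥ v ∈ L) ∧
    (∀ x ∈ B true, ∀ y ∈ B true, ∀ v ∈ L, x *ᵥ (y *ᵥ v) ∈ L) := by
  let L : Submodule F (ι → F) :=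
    { carrier := {v | v ∈ W ∧ ∀ r ∈ Rad (B false), r *ᵥ v ∈ Z β}
      zero_mem' := ⟨W.zero_mem, by intro r _; rw [mulVec_zero]; exact Submodule.zero_mem _⟩
      add_mem' := by
        rintro u v ⟨hu, hu2⟩ ⟨hv, hv2⟩
        exact ⟨W.add_mem hu hv, fun r hr => by rw [mulVec_add]; exact Submodule.add_mem _ (hu2 r hr) (hv2 r hr)⟩
      smul_mem' := by
        rintro c v ⟨hv, hv2⟩
        exact ⟨W.smul_mem c hv, fun r hr => by rw [mulVec_smul]; exact Submodule.smul_mem _ c (hv2 r hr)⟩ }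
  have st0 : ∀ {b v}, b ∈ B false → v ∈ Z β → b *ᵥ v ∈ Z β := by
    intro b v hb hv; simpa using hZ.st hb hv
  have hJ : JC (Rad (B false)) := fun x hx y hy => Rad.o hB.jc hx hy.1
  have hb0 : ∀ b ∈ B false, ∀ v ∈ L, b *ᵥ v ∈ L := by
    rintro b hb v ⟨hv, hv2⟩
    refine ⟨h0 b hb v hv, fun r hr => ?_⟩
    have e : r *ᵥ (b *ᵥ v) = (r * b + b * r) *ᵥ v - b *ᵥ (r *ᵥ v) := by
      rw [add_mulVec, ← mulVec_mulVec, ← mulVec_mulVec]; abel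
    rw [e]
    exact Submodule.sub_mem _ (hv2 _ (Rad.o hB.jc hr hb)) (st0 hb (hv2 r hr))
  refine ⟨L, ?_, fun v hv => hv.1, fun r hr v hv => hv.2 r hr, hb0, ?_⟩
  · obtain ⟨v, hv, hv2, hv3⟩ := engel _ (Rad (B false)) le_rfl hJ (fun r hr => Rad.nil hB.jc hr) (Z β) W hZW
      (fun r hr v hv => st0 hr.1 hv) (fun r hr v hv => h0 r hr.1 v hv)
    have hvL : v ∈ L := And.intro hv hv3
    have hle : Z β ≤ L := fun z hz => And.intro (hZW.le hz) (fun r hr => st0 hr.1 hz)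
    exact SetLike.lt_iff_le_and_exists.2 ⟨hle, v, hvL, hv2⟩
  · intro x hx y hy v hv
    apply half_mem (F := F)
    have e : x *ᵥ (y *ᵥ v) + x *ᵥ (y *ᵥ v) = (x * y - y * x) *ᵥ v + (x * y + y * x) *ᵥ v := by
      simp only [add_mulVec, sub_mulVec, ← mulVec_mulVec]; abel
    rw [e]
    refine L.add_mem (hb0 _ (hB.m11 hx hy) v hv) ?_
    have hD : ∀ z ∈ Z β, (x * y + y * x) *ᵥ z ∈ Z β := by
      intro z hz
      rw [add_mulVec]
      have h2 := hZ.st hx (hZ.st hy hz)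
      have h3 := hZ.st hy (hZ.st hx hz)
      simp at h2 h3
      exact Submodule.add_mem _ h2 h3
    refine ⟨?_, fun r hr => ?_⟩
    · rw [add_mulVec, ← mulVec_mulVec, ← mulVec_mulVec]
      exact W.add_mem (h1 x hx y hy v hv.1) (h1 y hy x hx v hv.1)
    · have e : r *ᵥ ((x * y + y * x) *ᵥ v) = (x * y + y * x) *ᵥ (r *ᵥ v) -
          ((x * y + y * x) * r - r * (x * y + y * x)) *ᵥ v := by
        rw [sub_mulVec, ← mulVec_mulVec, ← mulVec_mulVec]; abel
      rw [e]
      exact Submodule.sub_mem _ (hD _ (hv.2 r hr)) (hv.2 _ (Rad.br hB hx hy hr))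

theorem stab_MS (hB : Alg par B) {Z : Bool → Submodule F (ι → F)} (hZ : Stab par B Z) (β : Bool)
    (W : Submodule F (ι → F)) (hZW : Z β ≤ W) (hW : W ≤ PV F par β)
    (h0 : ∀ b ∈ B false, ∀ v ∈ W, b *ᵥ v ∈ W)
    (h1 : ∀ x ∈ B true, ∀ y ∈ B true, ∀ v ∈ W, x *ᵥ (y *ᵥ v) ∈ W) :
    ∃ X : Bool → Submodule F (ι → F), Stab par B X ∧ X β = W ∧ 
      X (!β) = Z (!β) ⊔ Submodule.span F {u | ∃ x ∈ B true, ∃ v ∈ W, u = x *ᵥ v} := by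
  set N := Z (!β) ⊔ Submodule.span F {u | ∃ x ∈ B true, ∃ v ∈ W, u = x *ᵥ v} with hN
  have key : ∀ (T : Submodule F (ι → F)) (y : Matrix ι ι F), (∀ z ∈ Z (!β), y *ᵥ z ∈ T) →
      (∀ x ∈ B true, ∀ v ∈ W, y *ᵥ (x *ᵥ v) ∈ T) → ∀ u ∈ N, y *ᵥ u ∈ T := by
    intro T y k1 k2
    have : N ≤ T.comap (mulVecLin y) := by
      rw [hN]
      refine sup_le (fun z hz => k1 z hz) (Submodule.span_le.2 ?_)
      rintro u ⟨x, hx, v, hv, rfl⟩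
      exact k2 x hx v hv
    exact fun u hu => this hu
  have hxN : ∀ x ∈ B true, ∀ v ∈ W, x *ᵥ v ∈ N := fun x hx v hv =>
    Submodule.mem_sup_right (Submodule.subset_span ⟨x, hx, v, hv, rfl⟩)
  refine ⟨fun c => if c = β then W else N, ⟨?_, ?_⟩, by simp, by simp⟩
  · intro c
    by_cases hc : c = β
    · simp [hc, hW]
    · have : c = !β := by revert hc; cases c <;> cases β <;> simp
      simp only [hc, if_false]
      rw [hN]
      refine sup_le (this ▸ hZ.le _) (Submodule.span_le.2 ?_)
      rintro u ⟨x, hx, v, hv, rfl⟩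
      have := PM_mulVec (hB.hom _ hx) (hW hv)
      rw [‹c = !β›]
      simpa using this
  · intro a c b v hb hv
    by_cases hc : c = β
    · subst hc
      simp only [if_true] at hv
      cases a
      · simpa using h0 b hb v hv
      · simpa using hxN b hb v hv
    · have hc2 : c = !β := by revert hc; cases c <;> cases β <;> simp
      simp only [hc, if_false] at hv
      subst hc2
      cases a
      · simp
        refine key N b (fun z hz => ?_) (fun x hx w hw => ?_) v hv
        · exact Submodule.mem_sup_left (by simpa using hZ.st hb hz)
        · have e : b *ᵥ (x *ᵥ w) = (b * x + x * b) *ᵥ w - x *ᵥ (b *ᵥ w) := by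
            rw [add_mulVec, ← mulVec_mulVec, ← mulVec_mulVec]; abel
          rw [e]
          exact Submodule.sub_mem _ (hxN _ (hB.m0 true hb hx) w hw) (hxN x hx _ (h0 b hb w hw))
      · simp
        refine key W b (fun z hz => hZW ?_) (fun x hx w hw => h1 b hb x hx w hw) v hv
        simpa using hZ.st hb hz

theorem stab_grow [IsAlgClosed F] (hB : Alg par B) {Z : Bool → Submodule F (ι → F)} (hZ : Stab par B Z)
    (hne : ∃ β, Z β ≠ PV F par β) :
    ∃ X, Stab par B X ∧ (∀ c, Z c ≤ X c) ∧ (∃ c, Z c < X c) ∧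
      ∀ r ∈ Rad (B false), ∀ c, ∀ v ∈ X c, r *ᵥ v ∈ Z c := by
  obtain ⟨β, hβ⟩ := hne
  obtain ⟨L, hL1, hL2, hL3, hL4, hL5⟩ := stab_LL hB hZ β (PV F par β) (lt_of_le_of_ne (hZ.le β) hβ)
    (fun b hb v hv => by simpa using PM_mulVec (hB.hom _ hb) hv)
    (fun x hx y hy v hv => by simpa using PM_mulVec (hB.hom _ hx) (PM_mulVec (hB.hom _ hy) hv))
  obtain ⟨X, hX, hXβ, hXγ⟩ := stab_MS hB hZ β L hL1.le hL2 hL4 hL5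
  have bc : ∀ {P : Bool → Prop}, P β → P (!β) → ∀ c, P c := by
    intro P h1 h2 c; cases c <;> cases β <;> simp_all
  have hZX : ∀ c, Z c ≤ X c := bc (hXβ ▸ hL1.le) (hXγ ▸ le_sup_left)
  by_cases hc : X (!β) ≤ Z (!β)
  · refine ⟨X, hX, hZX, ⟨β, hXβ ▸ hL1⟩, fun r hr => bc ?_ ?_⟩
    · rw [hXβ]; exact hL3 r hr
    · intro v hv; simpa using hZ.st hr.1 (hc hv)
  · have st0 : ∀ c, ∀ b ∈ B false, ∀ v ∈ X c, b *ᵥ v ∈ X c := by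
      intro c b hb v hv; simpa using hX.st hb hv
    have st1 : ∀ c, ∀ x ∈ B true, ∀ y ∈ B true, ∀ v ∈ X c, x *ᵥ (y *ᵥ v) ∈ X c := by
      intro c x hx y hy v hv; simpa using hX.st hx (hX.st hy hv)
    obtain ⟨Y, hY1, hY2, hY3, hY4, hY5⟩ := stab_LL hB hZ (!β) (X (!β)) (lt_of_le_not_ge (hZX _) hc)
      (st0 _) (st1 _)
    obtain ⟨X', hX', hX'γ, hX'β⟩ := stab_MS hB hZ (!β) Y hY1.le (hY2.trans (hX.le _)) hY4 hY5
    rw [Bool.not_not] at hX'β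
    refine ⟨X', hX', bc (hX'β ▸ le_sup_left) (hX'γ ▸ hY1.le), ⟨!β, hX'γ ▸ hY1⟩, fun r hr => bc ?_ ?_⟩
    · intro v hv
      apply hL3 r hr
      rw [hX'β] at hv
      have : Z β ⊔ Submodule.span F {u | ∃ x ∈ B true, ∃ v ∈ Y, u = x *ᵥ v} ≤ L := by
        refine sup_le hL1.le (Submodule.span_le.2 ?_)
        rintro u ⟨x, hx, v, hv, rfl⟩
        have := hX.st hx (hY2 hv)
        simpa [hXβ] using this
      exact this hv
    · rw [hX'γ]; exact hY3 r hr

theorem SS [IsAlgClosed F] (hB : Sim par B) (hn : ∃ b ∈ B false, ¬ IsNilpotent b) :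
    ∀ r ∈ B false, (∀ b ∈ B false, trace (r * b) = 0) → r = 0 := by
  intro r0 hr0 hr02
  by_contra hne
  obtain ⟨b0, hb0, hbn⟩ := hn
  have main : ∀ k : ℕ, ∃ Z, Stab par B Z ∧ (∃ K, ∀ c, ∀ v ∈ Z c, b0 ^ K *ᵥ v = 0) ∧
      k ≤ finrank F (Z false) + finrank F (Z true) := by
    intro k
    induction k with
    | zero =>
      refine ⟨fun _ => ⊥, ⟨fun c => bot_le, ?_⟩, ⟨0, ?_⟩, by omega⟩
      · intro a c b v _ hv
        rw [Submodule.mem_bot] at hv ⊢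
        rw [hv, mulVec_zero]
      · intro c v hv
        rw [Submodule.mem_bot] at hv
        rw [hv, mulVec_zero]
    | succ k ih =>
      obtain ⟨Z, hZ, ⟨K, hK⟩, hk⟩ := ih
      by_cases hall : ∀ β, Z β = PV F par β
      · exfalso
        apply hbn
        refine ⟨K, ?_⟩
        ext i j
        have : (Pi.single j 1 : ι → F) ∈ Z (par j) := by
          rw [hall]
          intro l hl
          rw [Pi.single_apply, if_neg]
          rintro rfl; exact hl rfl
        have := congrFun (hK _ _ this) i
        simpa using this
      · push Not at hall
        obtain ⟨X, hX, hZX, ⟨c, hc⟩, hR⟩ := stab_grow hB.toAlg hZ hall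
        have hBX : ∀ b ∈ B false, ∀ c, ∀ v ∈ X c, b *ᵥ v ∈ Z c := by
          let I : Bool → Submodule F (Matrix ι ι F) := fun a =>
            { carrier := {b | b ∈ B a ∧ ∀ c, ∀ v ∈ X c, b *ᵥ v ∈ Z (xor a c)}
              zero_mem' := ⟨Submodule.zero_mem _, fun c v hv => by rw [zero_mulVec]; exact Submodule.zero_mem _⟩
              add_mem' := by
                rintro x y ⟨hx, hx2⟩ ⟨hy, hy2⟩
                exact ⟨Submodule.add_mem _ hx hy, fun c v hv => by
                  rw [add_mulVec]; exact Submodule.add_mem _ (hx2 c v hv) (hy2 c v hv)⟩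
              smul_mem' := by
                rintro t y ⟨hy, hy2⟩
                exact ⟨Submodule.smul_mem _ t hy, fun c v hv => by
                  rw [smul_mulVec]; exact Submodule.smul_mem _ t (hy2 c v hv)⟩ }
          have hI : ∀ a b x y, x ∈ B a → y ∈ I b → x * y + sg F a b • (y * x) ∈ I (xor a b) := by
            rintro a b x y hx ⟨hy, hy2⟩
            refine ⟨hB.mul hx hy, fun c v hv => ?_⟩
            rw [add_mulVec, smul_mulVec, ← mulVec_mulVec, ← mulVec_mulVec]
            refine Submodule.add_mem _ ?_ (Submodule.smul_mem _ _ ?_)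
            · have := hZ.st hx (hy2 c v hv)
              rwa [← Bool.xor_assoc] at this
            · have := hy2 _ _ (hX.st hx hv)
              rwa [← Bool.xor_assoc, Bool.xor_comm b a] at this
          rcases hB.sim I (fun a b hb => hb.1) hI with h | h
          · exfalso
            have : r0 ∈ I false := by
              refine ⟨hr0, fun c v hv => ?_⟩
              simpa using hR r0 ⟨hr0, hr02⟩ c v hv
            rw [h false, Submodule.mem_bot] at this
            exact hne this
          · intro b hb c v hv
            rw [← h false] at hb
            simpa using hb.2 c v hv
        refine ⟨X, hX, ⟨K + 1, fun c v hv => ?_⟩, ?_⟩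
        · rw [pow_succ, ← mulVec_mulVec]
          exact hK c _ (hBX b0 hb0 c v hv)
        · have h1 := Submodule.finrank_lt_finrank_of_lt hc
          have h2 := Submodule.finrank_mono (hZX false)
          have h3 := Submodule.finrank_mono (hZX true)
          cases c <;> omega
  obtain ⟨Z, _, _, hZ⟩ := main (2 * finrank F (ι → F) + 1)
  have h1 := Submodule.finrank_le (Z false)
  have h2 := Submodule.finrank_le (Z true)
  omega

end SSsec
section Ssec
variable {F : Type*} [Field F] [CharZero F] {ι : Type*} [Fintype ι] [DecidableEq ι]
open Module
variable {par : ι → Bool} {B : Bool → Submodule F (Matrix ι ι F)}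

theorem single_PV (j : ι) : (Pi.single j 1 : ι → F) ∈ PV F par (par j) := by
  intro l hl
  rw [Pi.single_apply, if_neg]
  rintro rfl; exact hl rfl

theorem mat_ext_single {x y : Matrix ι ι F} (h : ∀ j, x *ᵥ (Pi.single j 1) = y *ᵥ (Pi.single j 1)) : x = y := by
  ext i j
  simpa using congrFun (h j) i
theorem trace_rep {S : Submodule F (Matrix ι ι F)}
    (hS : ∀ r ∈ S, (∀ b ∈ S, trace (r * b) = 0) → r = 0) (f : Matrix ι ι F →ₗ[F] F) :
    ∃ b ∈ S, ∀ y ∈ S, trace (b * y) = f y := by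
  let T : S →ₗ[F] Dual F S :=
    LinearMap.mk₂ F (fun x y : S => trace ((x : Matrix ι ι F) * (y : Matrix ι ι F)))
      (by intro a b c; simp [add_mul]) (by intro a b c; simp)
      (by intro a b c; simp [mul_add]) (by intro a b c; simp)
  have hinj : Function.Injective T := by
    rw [← LinearMap.ker_eq_bot, LinearMap.ker_eq_bot']
    intro x hx
    have := hS x x.2 (fun b hb => LinearMap.congr_fun hx ⟨b, hb⟩)
    exact Subtype.ext this
  have hsurj : Function.Surjective T :=
    (LinearMap.injective_iff_surjective_of_finrank_eq_finrank
      (by rw [Subspace.dual_finrank_eq])).1 hinj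
  obtain ⟨b, hb⟩ := hsurj (f.comp S.subtype)
  exact ⟨b, b.2, fun y hy => LinearMap.congr_fun hb ⟨y, hy⟩⟩

theorem perp_perp {α : Bool} {p0 φ0 u : ι → F} (hp : p0 ∈ PV F par α) (hφ : φ0 ∈ PV F par α)
    (h1 : φ0 ⬝ᵥ p0 = 1) (hu : u ∈ PV F par α)
    (h : ∀ ψ ∈ PV F par α, ψ ⬝ᵥ p0 = 0 → ψ ⬝ᵥ u = 0) : u = (φ0 ⬝ᵥ u) • p0 := by
  ext i
  by_cases hi : par i = α
  · have := h (Pi.single i 1 - p0 i • φ0)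
      (Submodule.sub_mem _ (hi ▸ single_PV i) (Submodule.smul_mem _ _ hφ))
      (by simp [sub_dotProduct, h1])
    simp [sub_dotProduct] at this
    rw [Pi.smul_apply, smul_eq_mul, mul_comm]
    linear_combination this
  · rw [hu i hi, Pi.smul_apply, hp i hi, smul_zero]

theorem S3 [IsAlgClosed F] {A : Bool → Submodule F (Matrix ι ι F)} (hB : Sim par B)
    (hAB : ∀ a, A a ⊔ B a = PM F par a) {α : Bool} {p0 φ0 : ι → F}
    (hp : p0 ∈ PV F par α) (hφ : φ0 ∈ PV F par α) (h1 : φ0 ⬝ᵥ p0 = 1)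
    (hAp : ∀ a, ∀ x ∈ A a, x *ᵥ p0 = 0) (hAφ : ∀ a, ∀ x ∈ A a, φ0 ᵥ* x = 0) : ROI (B false) := by
  have tran : ∀ a, ∀ x ∈ PV F par (xor a α), ∀ ψ ∈ PV F par (xor a α), φ0 ⬝ᵥ x = ψ ⬝ᵥ p0 →
      ∃ b ∈ B a, b *ᵥ p0 = x ∧ φ0 ᵥ* b = ψ := by
    intro a x hx ψ hψ hxψ
    have hm : r1 x φ0 + r1 p0 ψ - (φ0 ⬝ᵥ x) • r1 p0 φ0 ∈ PM F par a := by
      refine Submodule.sub_mem _ (Submodule.add_mem _ ?_ ?_) ?_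
      · simpa using PM_r1 hx hφ
      · have := PM_r1 hp hψ
        rwa [Bool.xor_comm a α, ← Bool.xor_assoc, Bool.xor_self, Bool.false_xor] at this
      · cases a
        · exact Submodule.smul_mem _ _ (by simpa using PM_r1 hp hφ)
        · rw [PV_dot hφ hx (by simp), zero_smul]; exact Submodule.zero_mem _
    rw [← hAB, Submodule.mem_sup] at hm
    obtain ⟨a', ha', b, hb, e⟩ := hm
    refine ⟨b, hb, ?_, ?_⟩
    · have : (a' + b) *ᵥ p0 = x := by
        rw [e, sub_mulVec, add_mulVec, smul_mulVec, r1_mulVec, r1_mulVec, r1_mulVec, h1, hxψ]; simp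
      rwa [add_mulVec, hAp a a' ha', zero_add] at this
    · have : φ0 ᵥ* (a' + b) = ψ := by
        rw [e, vecMul_sub, vecMul_add, vecMul_smul, vecMul_r1, vecMul_r1, vecMul_r1, h1]; simp
      rwa [vecMul_add, hAφ a a' ha', zero_add] at this
  have tr0 : ∀ x ∈ PV F par α, ∀ ψ ∈ PV F par α, φ0 ⬝ᵥ x = ψ ⬝ᵥ p0 →
      ∃ b ∈ B false, b *ᵥ p0 = x ∧ φ0 ᵥ* b = ψ := by simpa using tran false
  have tr0' : ∀ x ∈ PV F par α, ∃ b ∈ B false, b *ᵥ p0 = x := by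
    intro x hx
    obtain ⟨b, hb, hb2, _⟩ := tr0 x hx ((φ0 ⬝ᵥ x) • φ0) (Submodule.smul_mem _ _ hφ) (by simp [h1])
    exact ⟨b, hb, hb2⟩
  have hp0 : p0 ≠ 0 := by rintro rfl; simp at h1
  have hnn : ∃ b ∈ B false, ¬ IsNilpotent b := by
    obtain ⟨b, hb, hb2⟩ := tr0' p0 hp
    refine ⟨b, hb, ?_⟩
    rintro ⟨k, hk⟩
    have : ∀ k, b ^ k *ᵥ p0 = p0 := by
      intro k
      induction k with
      | zero => simp
      | succ k ih => rw [pow_succ, ← mulVec_mulVec, hb2, ih]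
    have := this k
    rw [hk, zero_mulVec] at this
    exact hp0 this.symm
  have hR := SS hB hnn
  obtain ⟨b, hb, hbt⟩ := trace_rep hR
    { toFun := fun y => φ0 ⬝ᵥ y *ᵥ p0
      map_add' := by intro x y; rw [add_mulVec, dotProduct_add]
      map_smul' := by intro c x; rw [smul_mulVec, dotProduct_smul]; rfl }
  have hbt : ∀ y ∈ B false, trace (b * y) = φ0 ⬝ᵥ y *ᵥ p0 := hbt
  have bPM := hB.hom _ hb
  have hb0 : b ≠ 0 := by
    rintro rfl
    obtain ⟨c, hc, hc2⟩ := tr0' p0 hp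
    have := hbt c hc
    rw [hc2, h1] at this
    simp at this
  have hbγ : ∀ v ∈ PV F par (!α), b *ᵥ v = 0 := by
    intro v hv
    have hbv : b *ᵥ v ∈ PV F par (!α) := by simpa using PM_mulVec bPM hv
    ext i
    by_cases hi : par i = !α
    · obtain ⟨y, hy, hy2, hy3⟩ := tran true v (by simpa using hv) 0 (Submodule.zero_mem _)
        (by rw [PV_dot hφ hv (by simp), zero_dotProduct])
      obtain ⟨x, hx, hx2, hx3⟩ := tran true 0 (Submodule.zero_mem _) (Pi.single i 1)
        (by have := single_PV (F := F) (par := par) i; rw [hi] at this; simpa using this)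
        (by
          have := PV_dot (single_PV (F := F) (par := par) i) hp (by rw [hi]; simp)
          rw [this, dotProduct_zero])
      have hw := hbt _ (hB.t11 hb hx hy)
      have : trace (b * (x * b * y - y * b * x)) = 0 := by
        rw [mul_sub, trace_sub, sub_eq_zero]
        rw [show b * (x * b * y) = (b * x) * (b * y) by noncomm_ring, trace_mul_comm]
        congr 1; noncomm_ring
      rw [this, sub_mulVec, dotProduct_sub] at hw
      simp only [← mulVec_mulVec, hx2, hy2, mulVec_zero, dotProduct_zero, sub_zero] at hw
      rw [dotProduct_mulVec, hx3] at hw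
      simpa using hw.symm
    · exact hbv i hi
  have crit : ∀ c ∈ B false, c ≠ 0 → (∀ v ∈ PV F par (!α), c *ᵥ v = 0) →
      (∀ v ∈ PV F par α, ∀ ψ ∈ PV F par α, ψ ⬝ᵥ p0 = 0 → ψ ⬝ᵥ c *ᵥ v = 0) → ROI (B false) := by
    intro c hc hc0 k1 k2
    have e : c = r1 p0 (φ0 ᵥ* c) := by
      apply mat_ext_single
      intro j
      rw [r1_mulVec, ← dotProduct_mulVec]
      have hj := single_PV (F := F) (par := par) j
      by_cases h : par j = α
      · rw [h] at hj
        exact perp_perp hp hφ h1 (by simpa using PM_mulVec (hB.hom _ hc) hj) (k2 _ hj)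
      · have h : par j = !α := by revert h; cases par j <;> cases α <;> simp
        rw [h] at hj
        rw [k1 _ hj]; simp
    have hχ : φ0 ᵥ* c ∈ PV F par α := by simpa using PM_vecMul (hB.hom _ hc) hφ
    have hχ0 : φ0 ᵥ* c ≠ 0 := by
      intro h; rw [h, r1_zero_right] at e; exact hc0 e
    obtain ⟨i, hi⟩ := Function.ne_iff.1 hχ0
    have hiα : par i = α := by
      by_contra h; exact hi (hχ i h)
    obtain ⟨z, hz, hz2⟩ := tr0' (Pi.single i 1) (hiα ▸ single_PV i)
    rw [e] at hc
    refine roi1 hB.jc hc hz ?_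
    rw [hz2]; simpa using hi
  by_cases hcase : ∃ y ∈ B false, y *ᵥ p0 = 0 ∧ b * y * b ≠ 0
  · obtain ⟨y, hy, hy2, hy3⟩ := hcase
    refine crit _ (hB.t hb hy) hy3 (fun v hv => ?_) (fun v hv ψ hψ hψ2 => ?_)
    · rw [← mulVec_mulVec, hbγ v hv, mulVec_zero]
    · obtain ⟨x, hx, hx2⟩ := tr0' v hv
      obtain ⟨z, hz, hz2, hz3⟩ := tr0 0 (Submodule.zero_mem _) ψ hψ (by rw [hψ2, dotProduct_zero])
      have m1 := Submodule.sub_mem _ (hB.t2 hz hy (hB.t hb hx)) (hB.t2 hz hx (hB.t hb hy))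
      have hw := hbt _ m1
      have e1 : trace (b * (z * (b * x * b) * y + y * (b * x * b) * z - (z * (b * y * b) * x + x * (b * y * b) * z))) = 0 := by
        have e2 : b * (z * (b * x * b) * y + y * (b * x * b) * z - (z * (b * y * b) * x + x * (b * y * b) * z))
          = ((b * z) * (b * (x * b * y - y * b * x))) - (b * (x * b * y - y * b * x)) * (b * z) := by noncomm_ring
        rw [e2, trace_sub, trace_mul_comm, sub_self]
      rw [e1] at hw
      simp only [sub_mulVec, add_mulVec, ← mulVec_mulVec, hx2, hy2, hz2, mulVec_zero, dotProduct_zero,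
        sub_zero, add_zero, zero_add, zero_sub, dotProduct_neg] at hw
      rw [dotProduct_mulVec, hz3] at hw
      simp only [← mulVec_mulVec]
      simpa using hw
  · push Not at hcase
    refine crit b hb hb0 hbγ (fun v hv ψ hψ hψ2 => ?_)
    obtain ⟨z, hz, hz2⟩ := tr0' v hv
    obtain ⟨y, hy, hy2, hy3⟩ := tr0 0 (Submodule.zero_mem _) ψ hψ (by rw [hψ2, dotProduct_zero])
    have hw := hbt _ (hB.t2 hy hz hb)
    have e1 : trace (b * (y * b * z + z * b * y)) = 0 := by
      have e2 : b * (y * b * z + z * b * y) = (b * y * b) * z + (b * z) * (b * y) := by noncomm_ring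
      rw [e2, trace_add, trace_mul_comm (b * z), show b * y * (b * z) = (b * y * b) * z by noncomm_ring,
        hcase y hy hy2]
      simp
    rw [e1] at hw
    simp only [add_mulVec, ← mulVec_mulVec, hy2, hz2, mulVec_zero, add_zero] at hw
    rw [dotProduct_mulVec, hy3] at hw
    exact hw.symm

end Ssec
section Csec
variable {F : Type*} [Field F] [CharZero F] {ι : Type*} [Fintype ι] [DecidableEq ι]
open Module
variable {par : ι → Bool} {A : Bool → Submodule F (Matrix ι ι F)}

theorem Alg.tt (hA : Alg par A) {a b : Bool} {ε x y : Matrix ι ι F} (hε : ε ∈ A false)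
    (hx : x ∈ A a) (hy : y ∈ A b) : x * ε * y + sg F a b • (y * ε * x) ∈ A (xor a b) := by
  cases a <;> cases b
  · simpa using hA.t2 hx hy hε
  · simpa using hA.t3 hx hε hy
  · have := hA.t3 hy hε hx
    rw [add_comm] at this
    simpa using this
  · simpa [sub_eq_add_neg] using hA.t11 hε hx hy

theorem mul_r1_mul (x y : Matrix ι ι F) (p φ : ι → F) : x * r1 p φ * y = r1 (x *ᵥ p) (φ ᵥ* y) := by
  rw [mul_r1, r1_mul]

variable {α : Bool} {p φ : ι → F}

theorem genK (hA : Sim par A) (h1 : φ ⬝ᵥ p = 1) (hε : r1 p φ ∈ A false)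
    (hp : p ∈ PV F par α) (hφ : φ ∈ PV F par α) (c : Bool) (S : Submodule F (Matrix ι ι F))
    (hS : ∀ a b x y, x ∈ A a → y ∈ A b → xor a b = c →
      r1 (x *ᵥ p) (φ ᵥ* y) + sg F a b • r1 (y *ᵥ p) (φ ᵥ* x) ∈ S) : A c ≤ S := by
  set ε := r1 p φ with hεd
  have hee : ε * ε = ε := by rw [hεd, r1_mul_r1, h1, one_smul]
  let K : Bool → Submodule F (Matrix ι ι F) := fun c =>
    Submodule.span F {k | ∃ a b x y, x ∈ A a ∧ y ∈ A b ∧ xor a b = c ∧ k = x * ε * y + sg F a b • (y * ε * x)}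
  have hK : ∀ {a b x y}, x ∈ A a → y ∈ A b → x * ε * y + sg F a b • (y * ε * x) ∈ K (xor a b) :=
    fun {a b x y} hx hy => Submodule.subset_span ⟨a, b, x, y, hx, hy, rfl, rfl⟩
  have hKA : ∀ c, K c ≤ A c := by
    intro c
    refine Submodule.span_le.2 ?_
    rintro k ⟨a, b, x, y, hx, hy, rfl, rfl⟩
    exact hA.tt hε hx hy
  have f1 : ε ∈ K false := by
    have := hK hε hε
    simp only [hee, sg_fl, one_smul, Bool.xor_self] at this
    exact half_mem this
  have f2 : ∀ b w, w ∈ A b → w * ε + ε * w ∈ K b := by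
    intro b w hw
    have := hK hw hε
    simpa [mul_assoc, hee, ← mul_assoc ε ε w] using this
  have eee : ∀ w, ε * w * ε = (φ ⬝ᵥ w *ᵥ p) • ε := by
    intro w
    rw [hεd, mul_assoc, mul_r1, r1_mul_r1]
  have f3 : ∀ b w, w ∈ A b → (φ ⬝ᵥ w *ᵥ p) • ε ∈ K b := by
    intro b w hw
    cases b
    · exact Submodule.smul_mem _ _ f1
    · have : w *ᵥ p ∈ PV F par (!α) := by simpa using PM_mulVec (hA.hom _ hw) hp
      rw [PV_dot hφ this (by simp), zero_smul]; exact Submodule.zero_mem _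
  have f4 : ∀ a b z w, z ∈ A a → w ∈ A b →
      (z * ε + ε * z) * w + sg F a b • (w * (z * ε + ε * z)) ∈ K (xor a b) := by
    intro a b z w hz hw
    have h2 := hK hz hw
    have h3 : (z * ε + ε * z) * w + sg F a b • (w * (z * ε + ε * z)) ∈ A (xor a b) :=
      hA.mul (hKA _ (f2 a z hz)) hw
    have e : (z * ε + ε * z) * w + sg F a b • (w * (z * ε + ε * z)) =
      (z * ε * w + sg F a b • (w * ε * z)) + (ε * (z * w) + sg F a b • (w * z * ε)) := by
      simp only [add_mul, mul_add, smul_add, mul_assoc]; abel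
    have hq : ε * (z * w) + sg F a b • (w * z * ε) ∈ A (xor a b) := by
      have := Submodule.sub_mem _ h3 (hKA _ h2)
      rwa [e, add_sub_cancel_left] at this
    rw [e]
    refine Submodule.add_mem _ h2 ?_
    have h5 := Submodule.sub_mem _ (f2 _ _ hq) (f3 _ _ (hA.mul hz hw))
    convert h5 using 1
    rw [← eee]
    have e1 : ε * (ε * (z * w)) = ε * (z * w) := by rw [← mul_assoc, hee]
    have e2 : w * z * ε * ε = w * z * ε := by rw [mul_assoc, hee]
    simp only [add_mul, mul_add, smul_mul_assoc, mul_smul_comm, e1, e2]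
    simp only [mul_assoc]
    abel
  have hI : ∀ a b x y, x ∈ A a → y ∈ K b → x * y + sg F a b • (y * x) ∈ K (xor a b) := by
    intro a b z y hz hy
    set z' := z - (z * ε + ε * z) + (φ ⬝ᵥ z *ᵥ p) • ε with hz'
    have hz'A : z' ∈ A a := Submodule.add_mem _ (Submodule.sub_mem _ hz (hKA _ (f2 a z hz))) (hKA _ (f3 a z hz))
    have hz1 : z' * ε = 0 := by
      rw [hz', ← eee]
      simp only [add_mul, sub_mul, mul_assoc, hee]; abel
    have hz2 : ε * z' = 0 := by
      rw [hz', ← eee]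
      simp only [mul_add, mul_sub, ← mul_assoc, hee]; abel
    have hz1' : ∀ w, z' * (ε * w) = 0 := fun w => by rw [← mul_assoc, hz1, zero_mul]
    have hz2' : ∀ w, ε * (z' * w) = 0 := fun w => by rw [← mul_assoc, hz2, zero_mul]
    have key : z' * y + sg F a b • (y * z') ∈ K (xor a b) := by
      clear_value z'
      induction hy using Submodule.span_induction with
      | mem k hk =>
        obtain ⟨c, d, x, y, hx, hy, rfl, rfl⟩ := hk
        have k1 := hK (hA.mul hz'A hx) hy
        have k2 := hK hx (hA.mul hz'A hy)
        rw [show xor (xor a c) d = xor a (xor c d) from Bool.xor_assoc _ _ _] at k1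
        rw [show xor c (xor a d) = xor a (xor c d) by cases a <;> cases c <;> cases d <;> rfl] at k2
        have k3 := Submodule.add_mem _ k1 (Submodule.smul_mem _ (sg F a c) k2)
        convert k3 using 1
        simp only [mul_add, add_mul, mul_assoc, smul_add, smul_mul_assoc, mul_smul_comm, hz1', hz2', smul_zero,
          add_zero, zero_add]
        cases a <;> cases c <;> cases d <;> simp <;> abel
      | zero => simp
      | add u v _ _ hu hv =>
        have := Submodule.add_mem _ hu hv
        convert this using 1
        simp only [mul_add, add_mul, smul_add]; abel
      | smul t u _ hu =>
        have := Submodule.smul_mem _ t hu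
        convert this using 1
        rw [smul_add, mul_smul_comm, smul_mul_assoc, smul_comm]
    have k4 := f4 a b z y hz (hKA _ hy)
    have k5 : (φ ⬝ᵥ z *ᵥ p) • (y * ε + ε * y) ∈ K (xor a b) := by
      cases a
      · simpa using Submodule.smul_mem _ _ (f2 b y (hKA _ hy))
      · have : z *ᵥ p ∈ PV F par (!α) := by simpa using PM_mulVec (hA.hom _ hz) hp
        rw [PV_dot hφ this (by simp), zero_smul]; exact Submodule.zero_mem _
    have k5' : (φ ⬝ᵥ z *ᵥ p) • (ε * y + sg F a b • (y * ε)) = (φ ⬝ᵥ z *ᵥ p) • (y * ε + ε * y) := by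
      cases a
      · simp; abel
      · have : z *ᵥ p ∈ PV F par (!α) := by simpa using PM_mulVec (hA.hom _ hz) hp
        rw [PV_dot hφ this (by simp), zero_smul, zero_smul]
    have := Submodule.sub_mem _ (Submodule.add_mem _ key k4) k5
    rw [← k5'] at this
    convert this using 1
    rw [hz']
    generalize φ ⬝ᵥ z *ᵥ p = t
    simp only [sub_mul, mul_sub, mul_add, add_mul, smul_add, smul_sub, smul_mul_assoc, mul_smul_comm]
    rw [smul_comm t]
    abel
  rcases hA.sim K hKA hI with h | h
  · exfalso
    rw [h false, Submodule.mem_bot, hεd] at f1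
    rcases r1_eq_zero f1 with h2 | h2 <;> rw [h2] at h1 <;> simp at h1
  · rw [← h c]
    refine Submodule.span_le.2 ?_
    rintro k ⟨a, b, x, y, hx, hy, hc, rfl⟩
    rw [hεd, mul_r1_mul, mul_r1_mul]
    exact hS a b x y hx hy hc

theorem I0 (hA : Sim par A) (h1 : φ ⬝ᵥ p = 1) (hε : r1 p φ ∈ A false)
    (hp : p ∈ PV F par α) (hφ : φ ∈ PV F par α) {a x} (hx : x ∈ A a)
    (h : ∀ b c y z, y ∈ A b → z ∈ A c → φ ᵥ* y ⬝ᵥ x *ᵥ (z *ᵥ p) = 0) : x = 0 := by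
  let U : Submodule F (ι → F) := Submodule.span F {v | ∃ a, ∃ x ∈ A a, v = x *ᵥ p}
  let Ψ : Submodule F (ι → F) := Submodule.span F {v | ∃ a, ∃ x ∈ A a, v = φ ᵥ* x}
  have hU : ∀ a x, x ∈ A a → x *ᵥ p ∈ U := fun a x hx => Submodule.subset_span ⟨a, x, hx, rfl⟩
  have hΨ : ∀ a x, x ∈ A a → φ ᵥ* x ∈ Ψ := fun a x hx => Submodule.subset_span ⟨a, x, hx, rfl⟩
  have hAU : ∀ a z, z ∈ A a → ∀ u ∈ U, z *ᵥ u ∈ U := by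
    intro a z hz u hu
    have : A a ≤ U.comap ({ toFun := fun z => z *ᵥ u, map_add' := fun x y => add_mulVec _ _ _,
                            map_smul' := fun c x => smul_mulVec _ _ _ } : Matrix ι ι F →ₗ[F] (ι → F)) := by
      apply genK hA h1 hε hp hφ
      intro b c x y hx hy _
      show (r1 (x *ᵥ p) (φ ᵥ* y) + sg F b c • r1 (y *ᵥ p) (φ ᵥ* x)) *ᵥ u ∈ U
      rw [add_mulVec, smul_mulVec, r1_mulVec, r1_mulVec]
      exact U.add_mem (U.smul_mem _ (hU _ _ hx)) (U.smul_mem _ (U.smul_mem _ (hU _ _ hy)))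
    exact this hz
  have hAΨ : ∀ a z, z ∈ A a → ∀ u ∈ Ψ, u ᵥ* z ∈ Ψ := by
    intro a z hz u hu
    have : A a ≤ Ψ.comap ({ toFun := fun z => u ᵥ* z, map_add' := fun x y => vecMul_add _ _ _,
                            map_smul' := fun c x => vecMul_smul _ _ _ } : Matrix ι ι F →ₗ[F] (ι → F)) := by
      apply genK hA h1 hε hp hφ
      intro b c x y hx hy _
      show u ᵥ* (r1 (x *ᵥ p) (φ ᵥ* y) + sg F b c • r1 (y *ᵥ p) (φ ᵥ* x)) ∈ Ψ
      rw [vecMul_add, vecMul_smul, vecMul_r1, vecMul_r1]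
      exact Ψ.add_mem (Ψ.smul_mem _ (hΨ _ _ hy)) (Ψ.smul_mem _ (Ψ.smul_mem _ (hΨ _ _ hx)))
    exact this hz
  let I : Bool → Submodule F (Matrix ι ι F) := fun a =>
    { carrier := {x | x ∈ A a ∧ ∀ u ∈ U, ∀ ψ ∈ Ψ, ψ ⬝ᵥ x *ᵥ u = 0}
      zero_mem' := ⟨Submodule.zero_mem _, fun u _ ψ _ => by simp⟩
      add_mem' := by
        rintro x y ⟨hx, hx2⟩ ⟨hy, hy2⟩
        exact ⟨Submodule.add_mem _ hx hy, fun u hu ψ hψ => by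
          rw [add_mulVec, dotProduct_add, hx2 u hu ψ hψ, hy2 u hu ψ hψ, add_zero]⟩
      smul_mem' := by
        rintro t y ⟨hy, hy2⟩
        exact ⟨Submodule.smul_mem _ t hy, fun u hu ψ hψ => by
          rw [smul_mulVec, dotProduct_smul, hy2 u hu ψ hψ, smul_zero]⟩ }
  have hI : ∀ a b x y, x ∈ A a → y ∈ I b → x * y + sg F a b • (y * x) ∈ I (xor a b) := by
    rintro a b x y hx ⟨hy, hy2⟩
    refine ⟨hA.mul hx hy, fun u hu ψ hψ => ?_⟩
    rw [add_mulVec, smul_mulVec, dotProduct_add, dotProduct_smul, ← mulVec_mulVec, ← mulVec_mulVec,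
      hy2 _ (hAU a x hx u hu) ψ hψ, dotProduct_mulVec ψ x, hy2 u hu _ (hAΨ a x hx ψ hψ)]
    simp
  have hpU : p ∈ U := by
    have := hU _ _ hε
    rwa [r1_mulVec, h1, one_smul] at this
  have hφΨ : φ ∈ Ψ := by
    have := hΨ _ _ hε
    rwa [vecMul_r1, h1, one_smul] at this
  rcases hA.sim I (fun a x hx => hx.1) hI with h2 | h2
  · have hxI : x ∈ I a := by
      refine ⟨hx, fun u hu ψ hψ => ?_⟩
      induction hu using Submodule.span_induction with
      | mem u hu =>
        obtain ⟨c, z, hz, rfl⟩ := hu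
        induction hψ using Submodule.span_induction with
        | mem ψ hψ =>
          obtain ⟨b, y, hy, rfl⟩ := hψ
          exact h b c y z hy hz
        | zero => simp
        | add u v _ _ hu hv => rw [add_dotProduct, hu, hv, add_zero]
        | smul t u _ hu => rw [smul_dotProduct, hu, smul_zero]
      | zero => simp
      | add u v _ _ hu hv => rw [mulVec_add, dotProduct_add, hu, hv, add_zero]
      | smul t u _ hu => rw [mulVec_smul, dotProduct_smul, hu, smul_zero]
    rwa [h2 a, Submodule.mem_bot] at hxI
  · exfalso
    rw [← h2 false] at hε
    have := hε.2 p hpU φ hφΨ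
    rw [r1_mulVec, h1, one_smul, h1] at this
    exact one_ne_zero this
theorem dualB {U Ψ : Submodule F (ι → F)} (hU : ∀ u ∈ U, (∀ ψ ∈ Ψ, ψ ⬝ᵥ u = 0) → u = 0)
    (hΨ : ∀ ψ ∈ Ψ, (∀ u ∈ U, ψ ⬝ᵥ u = 0) → ψ = 0) :
    ∃ e : Matrix ι ι F, (∀ v, e *ᵥ v ∈ U) ∧ (∀ v, v ᵥ* e ∈ Ψ) ∧ (∀ u ∈ U, e *ᵥ u = u) ∧
      (∀ ψ ∈ Ψ, ψ ᵥ* e = ψ) := by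
  let T : Ψ →ₗ[F] Dual F U :=
    LinearMap.mk₂ F (fun (x : Ψ) (y : U) => (x : ι → F) ⬝ᵥ (y : ι → F))
      (by intro a b c; simp [add_dotProduct]) (by intro a b c; simp)
      (by intro a b c; simp [dotProduct_add]) (by intro a b c; simp)
  have hinj : Function.Injective T := by
    rw [← LinearMap.ker_eq_bot, LinearMap.ker_eq_bot']
    intro x hx
    exact Subtype.ext (hΨ x x.2 (fun b hb => LinearMap.congr_fun hx ⟨b, hb⟩))
  have hinj2 : Function.Injective T.flip := by
    rw [← LinearMap.ker_eq_bot, LinearMap.ker_eq_bot']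
    intro x hx
    exact Subtype.ext (hU x x.2 (fun b hb => LinearMap.congr_fun hx ⟨b, hb⟩))
  have d1 := LinearMap.finrank_le_finrank_of_injective hinj
  have d2 := LinearMap.finrank_le_finrank_of_injective hinj2
  rw [Subspace.dual_finrank_eq] at d1 d2
  have hsurj : Function.Surjective T :=
    (LinearMap.injective_iff_surjective_of_finrank_eq_finrank
      (by rw [Subspace.dual_finrank_eq]; omega)).1 hinj
  let b := Module.finBasis F U
  choose ψ hψ using fun i => hsurj (b.coord i)
  have hψ2 : ∀ i (u : U), (ψ i : ι → F) ⬝ᵥ (u : ι → F) = b.repr u i := by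
    intro i u
    exact LinearMap.congr_fun (hψ i) u
  refine ⟨∑ i, r1 (b i : ι → F) (ψ i), ?_, ?_, ?_, ?_⟩
  · intro v
    rw [sum_mulVec]
    exact Submodule.sum_mem _ (fun i _ => by rw [r1_mulVec]; exact U.smul_mem _ (b i).2)
  · intro v
    rw [vecMul_sum]
    exact Submodule.sum_mem _ (fun i _ => by rw [vecMul_r1]; exact Ψ.smul_mem _ (ψ i).2)
  · intro u hu
    rw [sum_mulVec]
    simp only [r1_mulVec]
    have := congrArg (Subtype.val) (b.sum_repr ⟨u, hu⟩)
    simp only [← hψ2] at this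
    simpa using this
  · intro χ hχ
    rw [vecMul_sum]
    simp only [vecMul_r1]
    have hm : ∑ i, (χ ⬝ᵥ (b i : ι → F)) • (ψ i : ι → F) ∈ Ψ :=
      Submodule.sum_mem _ (fun i _ => Ψ.smul_mem _ (ψ i).2)
    rw [← sub_eq_zero]
    apply hΨ _ (Ψ.sub_mem hm hχ)
    intro u hu
    have := congrArg (Subtype.val) (b.sum_repr ⟨u, hu⟩)
    simp only [← hψ2] at this
    rw [sub_dotProduct, sub_eq_zero, sum_dotProduct]
    conv_rhs => rw [← (show _ = u from this)]
    simp [dotProduct_sum, mul_comm]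

end Csec
section Csec
variable {F : Type*} [Field F] [CharZero F] {ι : Type*} [Fintype ι] [DecidableEq ι]
open Module
variable {par : ι → Bool} {A : Bool → Submodule F (Matrix ι ι F)}
structure RD (par : ι → Bool) (A : Bool → Submodule F (Matrix ι ι F)) (α : Bool) (p φ : ι → F) : Prop
    extends Sim par A where
  h1 : φ ⬝ᵥ p = 1
  hε : r1 p φ ∈ A false
  hp : p ∈ PV F par α
  hφ : φ ∈ PV F par α

variable {α : Bool} {p φ : ι → F}

theorem RD.pU (h : RD par A α p φ) {a x} (hx : x ∈ A a) : x *ᵥ p ∈ PV F par (xor a α) :=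
  PM_mulVec (h.hom _ hx) h.hp

theorem RD.pΨ (h : RD par A α p φ) {a x} (hx : x ∈ A a) : φ ᵥ* x ∈ PV F par (xor a α) :=
  PM_vecMul (h.hom _ hx) h.hφ

theorem RD.k (h : RD par A α p φ) {a b x y} (hx : x ∈ A a) (hy : y ∈ A b) :
    r1 (x *ᵥ p) (φ ᵥ* y) + sg F a b • r1 (y *ᵥ p) (φ ᵥ* x) ∈ A (xor a b) := by
  have := h.tt h.hε hx hy
  rwa [mul_r1_mul, mul_r1_mul] at this

theorem RD.hh (h : RD par A α p φ) {a x} (hx : x ∈ A a) :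
    r1 (x *ᵥ p) φ + r1 p (φ ᵥ* x) ∈ A a := by
  have := h.k hx h.hε
  simpa [vecMul_r1, r1_mulVec, h.h1] using this

theorem RD.p0 (h : RD par A α p φ) : p ≠ 0 := by
  intro h2; have := h.h1; rw [h2] at this; simp at this

theorem RD.φ0 (h : RD par A α p φ) : φ ≠ 0 := by
  intro h2; have := h.h1; rw [h2] at this; simp at this

theorem RD.dd (h : RD par A α p φ) {a b x y} (hx : x ∈ A a) (hy : y ∈ A b) (hab : a ≠ b) :
    φ ᵥ* x ⬝ᵥ y *ᵥ p = 0 :=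
  PV_dot (h.pΨ hx) (h.pU hy) (by revert hab; cases a <;> cases b <;> cases α <;> simp)

theorem RD.dφ (h : RD par A α p φ) {y} (hy : y ∈ A true) : φ ⬝ᵥ y *ᵥ p = 0 := by
  have := h.dd h.hε hy (by simp)
  rwa [vecMul_r1, h.h1, one_smul] at this
theorem RD.s (h : RD par A α p φ) {a x} (hx : x ∈ A a) :
    ∃ s ∈ A a, s *ᵥ p = x *ᵥ p - (φ ⬝ᵥ x *ᵥ p) • p ∧ φ ᵥ* s = φ ᵥ* x - (φ ⬝ᵥ x *ᵥ p) • φ ∧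
      s = r1 (s *ᵥ p) φ + r1 p (φ ᵥ* s) ∧ φ ⬝ᵥ s *ᵥ p = 0 ∧ φ ᵥ* s ⬝ᵥ p = 0 := by
  set c := φ ⬝ᵥ x *ᵥ p with hc
  have hce : c • r1 p φ ∈ A a := by
    cases a
    · exact Submodule.smul_mem _ _ h.hε
    · rw [hc, h.dφ hx, zero_smul]; exact Submodule.zero_mem _
  have hc2 : φ ᵥ* x ⬝ᵥ p = c := by rw [hc, dotProduct_mulVec]
  refine ⟨_, Submodule.sub_mem _ (Submodule.sub_mem _ (h.hh hx) hce) hce, ?_⟩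
  have e1 : (r1 (x *ᵥ p) φ + r1 p (φ ᵥ* x) - c • r1 p φ - c • r1 p φ) *ᵥ p = x *ᵥ p - c • p := by
    simp only [sub_mulVec, add_mulVec, smul_mulVec, r1_mulVec, h.h1, hc2, one_smul]; abel
  have e2 : φ ᵥ* (r1 (x *ᵥ p) φ + r1 p (φ ᵥ* x) - c • r1 p φ - c • r1 p φ) = φ ᵥ* x - c • φ := by
    simp only [vecMul_sub, vecMul_add, vecMul_smul, vecMul_r1, h.h1, ← hc, one_smul]; abel
  refine ⟨e1, e2, ?_, ?_, ?_⟩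
  · rw [e1, e2, r1_sub_left, r1_sub_right, r1_smul_left, r1_smul_right]; abel
  · rw [e1, dotProduct_sub, dotProduct_smul, h.h1, ← hc]; simp
  · rw [e2, sub_dotProduct, smul_dotProduct, h.h1, hc2]; simp

theorem RD.caseH (h : RD par A α p φ) {b u} (hu : r1 u φ ∈ A b) (hu0 : φ ⬝ᵥ u = 0)
    {x} (hx : x ∈ A b) (hxu : φ ᵥ* x ⬝ᵥ u ≠ 0) : ∀ a x, x ∈ A a → r1 (x *ᵥ p) φ ∈ A a := by
  obtain ⟨s, hs, es1, es2, es3, es4, es5⟩ := h.s hx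
  have ht : φ ᵥ* s ⬝ᵥ u ≠ 0 := by
    rw [es2, sub_dotProduct, smul_dotProduct, hu0]; simpa using hxu
  set u1 := s *ᵥ p
  set ψ1 := φ ᵥ* s
  have hk : r1 u ψ1 ∈ A false := by
    have := h.k hu hs
    rw [r1_mulVec, h.h1, one_smul, vecMul_r1, hu0, zero_smul, r1_zero_right, smul_zero, add_zero] at this
    simpa using this
  have hpψ : r1 p ψ1 ∈ A b := by
    have h2 := h.m0 b hk hs
    rw [es3] at h2
    simp only [mul_add, add_mul, r1_mul_r1, hu0, es5, zero_smul, zero_add, add_zero] at h2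
    have h3 := Submodule.sub_mem _ h2 (Submodule.smul_mem _ (ψ1 ⬝ᵥ u1) hu)
    rw [add_sub_cancel_left] at h3
    have := Submodule.smul_mem _ (ψ1 ⬝ᵥ u)⁻¹ h3
    rwa [smul_smul, inv_mul_cancel₀ ht, one_smul] at this
  intro c x3 hx3
  have h4 := h.k hx3 hpψ
  rw [r1_mulVec, es5, zero_smul, r1_zero_left, smul_zero, add_zero, vecMul_r1, h.h1, one_smul] at h4
  have h5 := h.mul h4 hu
  rw [Bool.xor_assoc, Bool.xor_self, Bool.xor_false, r1_mul_r1, r1_mul_r1] at h5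
  have h6 : sg F (xor c b) b • (φ ⬝ᵥ x3 *ᵥ p) • r1 u ψ1 ∈ A c := by
    cases c
    · exact Submodule.smul_mem _ _ (Submodule.smul_mem _ _ hk)
    · rw [h.dφ hx3]; simp
  have h7 := Submodule.sub_mem _ h5 h6
  rw [add_sub_cancel_right] at h7
  have := Submodule.smul_mem _ (ψ1 ⬝ᵥ u)⁻¹ h7
  rwa [smul_smul, inv_mul_cancel₀ ht, one_smul] at this
theorem RD.unit (h : RD par A α p φ)
    (hU : ∀ b x, x ∈ A b → (∀ y ∈ A b, φ ᵥ* y ⬝ᵥ x *ᵥ p = 0) → x *ᵥ p = 0)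
    (hΨ : ∀ b y, y ∈ A b → (∀ x ∈ A b, φ ᵥ* y ⬝ᵥ x *ᵥ p = 0) → φ ᵥ* y = 0) :
    ∃ e ∈ PM F par false, (∀ i, ∃ x ∈ A (xor (par i) α), e *ᵥ Pi.single i 1 = x *ᵥ p) ∧
      (∀ i, ∃ x ∈ A (xor (par i) α), Pi.single i 1 ᵥ* e = φ ᵥ* x) ∧
      (∀ a x, x ∈ A a → e *ᵥ (x *ᵥ p) = x *ᵥ p) ∧ (∀ a x, x ∈ A a → (φ ᵥ* x) ᵥ* e = φ ᵥ* x) ∧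
      e * e = e ∧ (∀ a x, x ∈ A a → e * x = x) ∧ (∀ a x, x ∈ A a → x * e = x) := by
  let U : Bool → Submodule F (ι → F) := fun a => (A a).map
    ({ toFun := fun z => z *ᵥ p, map_add' := fun x y => add_mulVec _ _ _,
       map_smul' := fun c x => smul_mulVec _ _ _ } : Matrix ι ι F →ₗ[F] (ι → F))
  let Ψ : Bool → Submodule F (ι → F) := fun a => (A a).map
    ({ toFun := fun z => φ ᵥ* z, map_add' := fun x y => vecMul_add _ _ _,
       map_smul' := fun c x => vecMul_smul _ _ _ } : Matrix ι ι F →ₗ[F] (ι → F))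
  have hUm : ∀ a x, x ∈ A a → x *ᵥ p ∈ U a := fun a x hx => ⟨x, hx, rfl⟩
  have hΨm : ∀ a x, x ∈ A a → φ ᵥ* x ∈ Ψ a := fun a x hx => ⟨x, hx, rfl⟩
  have hUP : ∀ a, U a ≤ PV F par (xor a α) := by rintro a _ ⟨x, hx, rfl⟩; exact h.pU hx
  have hΨP : ∀ a, Ψ a ≤ PV F par (xor a α) := by rintro a _ ⟨x, hx, rfl⟩; exact h.pΨ hx
  have hdb : ∀ a, ∃ e : Matrix ι ι F, (∀ v, e *ᵥ v ∈ U a) ∧ (∀ v, v ᵥ* e ∈ Ψ a) ∧ (∀ u ∈ U a, e *ᵥ u = u) ∧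
      (∀ ψ ∈ Ψ a, ψ ᵥ* e = ψ) := by
    intro a
    apply dualB
    · rintro _ ⟨x, hx, rfl⟩ h2
      exact hU a x hx (fun y hy => h2 _ (hΨm a y hy))
    · rintro _ ⟨x, hx, rfl⟩ h2
      exact hΨ a x hx (fun y hy => h2 _ (hUm a y hy))
  choose e e1 e2 e3 e4 using hdb
  have ePV : ∀ a b v, v ∈ PV F par (xor b α) → a ≠ b → e a *ᵥ v = 0 := by
    intro a b v hv hab
    ext j
    have : (Pi.single j 1 ᵥ* e a) ⬝ᵥ v = 0 := PV_dot (hΨP a (e2 a _)) hv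
      (by revert hab; cases a <;> cases b <;> cases α <;> simp)
    rw [← dotProduct_mulVec] at this
    simpa using this
  have ePV' : ∀ a b v, v ∈ PV F par (xor b α) → a ≠ b → v ᵥ* e a = 0 := by
    intro a b v hv hab
    ext j
    have : v ⬝ᵥ (e a *ᵥ Pi.single j 1) = 0 := PV_dot hv (hUP a (e1 a _))
      (by revert hab; cases a <;> cases b <;> cases α <;> simp)
    rw [dotProduct_mulVec] at this
    simpa using this
  have hs : ∀ i, (Pi.single i 1 : ι → F) ∈ PV F par (xor (xor (par i) α) α) := by
    intro i; simpa using single_PV (F := F) (par := par) i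
  have add1 : ∀ b v, v ∈ PV F par (xor b α) → (e false + e true) *ᵥ v = e b *ᵥ v := by
    intro b v hv
    rw [add_mulVec]
    cases b
    · rw [ePV true false v hv (by simp), add_zero]
    · rw [ePV false true v hv (by simp), zero_add]
  have add2 : ∀ b v, v ∈ PV F par (xor b α) → v ᵥ* (e false + e true) = v ᵥ* e b := by
    intro b v hv
    rw [vecMul_add]
    cases b
    · rw [ePV' true false v hv (by simp), add_zero]
    · rw [ePV' false true v hv (by simp), zero_add]
  have g1 : ∀ i, ∃ x ∈ A (xor (par i) α), (e false + e true) *ᵥ Pi.single i 1 = x *ᵥ p := by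
    intro i
    obtain ⟨x, hx, hx2⟩ := e1 (xor (par i) α) (Pi.single i 1)
    exact ⟨x, hx, by rw [add1 _ _ (hs i), ← hx2]; rfl⟩
  have g2 : ∀ i, ∃ x ∈ A (xor (par i) α), Pi.single i 1 ᵥ* (e false + e true) = φ ᵥ* x := by
    intro i
    obtain ⟨x, hx, hx2⟩ := e2 (xor (par i) α) (Pi.single i 1)
    exact ⟨x, hx, by rw [add2 _ _ (hs i), ← hx2]; rfl⟩
  have g3 : ∀ a x, x ∈ A a → (e false + e true) *ᵥ (x *ᵥ p) = x *ᵥ p := by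
    intro a x hx
    rw [add1 _ _ (h.pU hx), e3 a _ (hUm a x hx)]
  have g4 : ∀ a x, x ∈ A a → (φ ᵥ* x) ᵥ* (e false + e true) = φ ᵥ* x := by
    intro a x hx
    rw [add2 _ _ (h.pΨ hx), e4 a _ (hΨm a x hx)]
  refine ⟨e false + e true, ?_, g1, g2, g3, g4, ?_, ?_, ?_⟩
  · intro i j hij
    obtain ⟨x, hx, hx2⟩ := g1 j
    have := h.pU hx i (by revert hij; cases par i <;> cases par j <;> cases α <;> simp)
    rw [← hx2] at this
    simpa using this
  · apply mat_ext_single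
    intro j
    obtain ⟨x, hx, hx2⟩ := g1 j
    rw [← mulVec_mulVec, hx2, g3 _ _ hx]
  · intro a x hx
    have := genK h.toSim h.h1 h.hε h.hp h.hφ a (LinearMap.ker (LinearMap.mulLeft F (e false + e true) - LinearMap.id))
      (by
        intro b c x y hx hy _
        rw [LinearMap.mem_ker, LinearMap.sub_apply, LinearMap.mulLeft_apply, LinearMap.id_apply, mul_add,
          mul_smul_comm, mul_r1, mul_r1, g3 _ _ hx, g3 _ _ hy, sub_self])
    have := this hx
    rwa [LinearMap.mem_ker, LinearMap.sub_apply, LinearMap.mulLeft_apply, LinearMap.id_apply, sub_eq_zero] at this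
  · intro a x hx
    have := genK h.toSim h.h1 h.hε h.hp h.hφ a (LinearMap.ker (LinearMap.mulRight F (e false + e true) - LinearMap.id))
      (by
        intro b c x y hx hy _
        rw [LinearMap.mem_ker, LinearMap.sub_apply, LinearMap.mulRight_apply, LinearMap.id_apply, add_mul,
          smul_mul_assoc, r1_mul, r1_mul, g4 _ _ hx, g4 _ _ hy, sub_self])
    have := this hx
    rwa [LinearMap.mem_ker, LinearMap.sub_apply, LinearMap.mulRight_apply, LinearMap.id_apply, sub_eq_zero] at this
def TI (par : ι → Bool) (A : Bool → Submodule F (Matrix ι ι F)) (e : Matrix ι ι F) : Prop :=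
  e ∈ PM F par false ∧ e * e = e ∧ ∀ a x, x ∈ A a ↔ x ∈ PM F par a ∧ e * x = x ∧ x * e = x

theorem mat_sum (x : Matrix ι ι F) : x = ∑ i, ∑ j, x i j • r1 (Pi.single i 1) (Pi.single j 1) := by
  ext a b
  simp [Matrix.sum_apply, r1_apply, Pi.single_apply]

theorem RD.outI (h : RD par A α p φ) (hU : ∀ a x, x ∈ A a → r1 (x *ᵥ p) φ ∈ A a) : ∃ e, TI par A e := by
  have hΨ : ∀ a x, x ∈ A a → r1 p (φ ᵥ* x) ∈ A a := by
    intro a x hx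
    have := Submodule.sub_mem _ (h.hh hx) (hU a x hx)
    rwa [add_sub_cancel_left] at this
  have hUΨ : ∀ a b x y, x ∈ A a → y ∈ A b → r1 (x *ᵥ p) (φ ᵥ* y) ∈ A (xor a b) := by
    intro a b x y hx hy
    have h2 := h.k (hU a x hx) (hΨ b y hy)
    rw [r1_mulVec, vecMul_r1, r1_mulVec, vecMul_r1, h.h1, one_smul, one_smul] at h2
    have h3 : sg F a b • r1 ((φ ᵥ* y ⬝ᵥ p) • p) ((φ ⬝ᵥ x *ᵥ p) • φ) ∈ A (xor a b) := by
      refine Submodule.smul_mem _ _ ?_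
      cases a
      · cases b
        · rw [r1_smul_left, r1_smul_right]; exact Submodule.smul_mem _ _ (Submodule.smul_mem _ _ h.hε)
        · rw [← dotProduct_mulVec, h.dφ hy, zero_smul, r1_zero_left]; exact Submodule.zero_mem _
      · rw [h.dφ hx, zero_smul, r1_zero_right]; exact Submodule.zero_mem _
    have := Submodule.sub_mem _ h2 h3
    rwa [add_sub_cancel_right] at this
  obtain ⟨e, he, g1, g2, g3, g4, g5, g6, g7⟩ := h.unit
    (by
      intro b x hx h2
      have h3 := I0 h.toSim h.h1 h.hε h.hp h.hφ (hU b x hx) (by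
        intro c d y z hy hz
        rw [r1_mulVec, dotProduct_smul]
        by_cases hc : c = b
        · subst hc; rw [h2 y hy, smul_zero]
        · rw [h.dd hy hx hc, smul_zero])
      exact (r1_eq_zero h3).resolve_right h.φ0)
    (by
      intro b x hx h2
      have h3 := I0 h.toSim h.h1 h.hε h.hp h.hφ (hΨ b x hx) (by
        intro c d y z hy hz
        rw [r1_mulVec]
        by_cases hc : d = b
        · subst hc; rw [h2 z hz, zero_smul, dotProduct_zero]
        · rw [h.dd hx hz (Ne.symm hc), zero_smul, dotProduct_zero])
      exact (r1_eq_zero h3).resolve_left h.p0)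
  refine ⟨e, he, g5, fun a x => ⟨fun hx => ⟨h.hom _ hx, g6 a x hx, g7 a x hx⟩, ?_⟩⟩
  rintro ⟨hx, hx1, hx2⟩
  have : x = ∑ i, ∑ j, x i j • r1 (e *ᵥ Pi.single i 1) (Pi.single j 1 ᵥ* e) := by
    conv_lhs => rw [← hx1, ← hx2, mat_sum x]
    simp only [Finset.sum_mul, Finset.mul_sum, smul_mul_assoc, mul_smul_comm, r1_mul, mul_r1]
  rw [this]
  refine Submodule.sum_mem _ (fun i _ => Submodule.sum_mem _ (fun j _ => ?_))
  by_cases hij : xor (par i) (par j) = a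
  · refine Submodule.smul_mem _ _ ?_
    obtain ⟨y, hy, hy2⟩ := g1 i
    obtain ⟨z, hz, hz2⟩ := g2 j
    rw [hy2, hz2]
    have := hUΨ _ _ y z hy hz
    rwa [show xor (xor (par i) α) (xor (par j) α) = a by
      rw [← hij]; cases par i <;> cases par j <;> cases α <;> rfl] at this
  · rw [hx i j hij, zero_smul]; exact Submodule.zero_mem _

end Csec
section Csec
variable {F : Type*} [Field F] [CharZero F] {ι : Type*} [Fintype ι] [DecidableEq ι]
open Module
variable {par : ι → Bool} {A : Bool → Submodule F (Matrix ι ι F)}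
variable {α : Bool} {p φ : ι → F}
structure RN (par : ι → Bool) (A : Bool → Submodule F (Matrix ι ι F)) (α : Bool) (p φ : ι → F) : Prop
    extends RD par A α p φ where
  hN : ∀ b u, r1 u φ ∈ A b → φ ⬝ᵥ u = 0 → ∀ x ∈ A b, φ ᵥ* x ⬝ᵥ u = 0

theorem RN.N0 (h : RN par A α p φ) {b u} (hu : r1 u φ ∈ A b) (h0 : φ ⬝ᵥ u = 0) : u = 0 := by
  have hup : r1 u φ *ᵥ p = u := by rw [r1_mulVec, h.h1, one_smul]
  have h3 := I0 h.toSim h.h1 h.hε h.hp h.hφ hu (by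
    intro c d y z hy hz
    rw [r1_mulVec, dotProduct_smul]
    by_cases hc : c = b
    · subst hc; rw [h.hN c u hu h0 y hy, smul_zero]
    · have := h.dd hy hu hc
      rw [hup] at this
      rw [this, smul_zero])
  exact (r1_eq_zero h3).resolve_right h.φ0

theorem RN.inj1 (h : RN par A α p φ) {a x} (hx : x ∈ A a) (h0 : φ ᵥ* x = 0) : x *ᵥ p = 0 := by
  have := h.hh hx
  rw [h0, r1_zero_right, add_zero] at this
  exact h.N0 this (by rw [dotProduct_mulVec, h0, zero_dotProduct])

theorem RN.inj2 (h : RN par A α p φ) {a x} (hx : x ∈ A a) (h0 : x *ᵥ p = 0) : φ ᵥ* x = 0 := by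
  have hz := h.hh hx
  rw [h0, r1_zero_left, zero_add] at hz
  have hψp : φ ᵥ* x ⬝ᵥ p = 0 := by rw [← dotProduct_mulVec, h0, dotProduct_zero]
  generalize φ ᵥ* x = ψ at *
  have key : ∀ y ∈ A a, ψ ⬝ᵥ y *ᵥ p = 0 := by
    intro y hy
    obtain ⟨s, hs, es1, es2, es3, es4, es5⟩ := h.s hy
    by_contra ht
    have ht2 : ψ ⬝ᵥ s *ᵥ p ≠ 0 := by
      rw [es1, dotProduct_sub, dotProduct_smul, hψp, smul_zero, sub_zero]; exact ht
    set u1 := s *ᵥ p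
    set ψ1 := φ ᵥ* s
    have hk := h.k hs hz
    rw [vecMul_r1, h.h1, one_smul, r1_mulVec, hψp, zero_smul, r1_zero_left, smul_zero, add_zero,
      Bool.xor_self] at hk
    change r1 u1 ψ ∈ A false at hk
    have h2 := h.m0 a hk hs
    clear_value u1 ψ1
    rw [es3] at h2
    simp only [mul_add, add_mul, r1_mul_r1, hψp, es4, es5, zero_smul, zero_add, add_zero] at h2
    have h3 := Submodule.sub_mem _ h2 (Submodule.smul_mem _ (ψ1 ⬝ᵥ u1) hz)
    rw [add_sub_cancel_right] at h3
    have h4 := Submodule.smul_mem _ (ψ ⬝ᵥ u1)⁻¹ h3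
    rw [smul_smul, inv_mul_cancel₀ ht2, one_smul] at h4
    have := h.N0 h4 es4
    rw [this] at ht2; simp at ht2
  have h3 := I0 h.toSim h.h1 h.hε h.hp h.hφ hz (by
    intro c d y z hy hz2
    rw [r1_mulVec]
    by_cases hc : d = a
    · subst hc; rw [key z hz2, zero_smul, dotProduct_zero]
    · have := h.dd hz hz2 (Ne.symm hc)
      rw [vecMul_r1, h.h1, one_smul] at this
      rw [this, zero_smul, dotProduct_zero])
  exact (r1_eq_zero h3).resolve_left h.p0
def HT (p φ : ι → F) (s : Matrix ι ι F) : Prop :=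
  s = r1 (s *ᵥ p) φ + r1 p (φ ᵥ* s) ∧ φ ⬝ᵥ s *ᵥ p = 0 ∧ φ ᵥ* s ⬝ᵥ p = 0

theorem RN.star (h : RN par A α p φ) {a b c s1 s2 s3} (h1 : s1 ∈ A a) (h2 : s2 ∈ A b) (h3 : s3 ∈ A c)
    (t1 : HT p φ s1) (t2 : HT p φ s2) (t3 : HT p φ s3) :
    sg F (xor a b) c • ((φ ᵥ* s3 ⬝ᵥ s1 *ᵥ p) • (φ ᵥ* s2) + sg F a b • (φ ᵥ* s3 ⬝ᵥ s2 *ᵥ p) • (φ ᵥ* s1)) =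
    (φ ᵥ* s2 ⬝ᵥ s3 *ᵥ p) • (φ ᵥ* s1) + sg F a b • (φ ᵥ* s1 ⬝ᵥ s3 *ᵥ p) • (φ ᵥ* s2) := by
  have hk := h.k h1 h2
  have hz := h.mul hk h3
  have w1 : (φ ᵥ* s2 ⬝ᵥ s3 *ᵥ p) • s1 ∈ A (xor (xor a b) c) := by
    by_cases hbc : b = c
    · subst hbc; rw [Bool.xor_assoc, Bool.xor_self, Bool.xor_false]; exact Submodule.smul_mem _ _ h1
    · rw [h.dd h2 h3 hbc, zero_smul]; exact Submodule.zero_mem _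
  have w2 : (φ ᵥ* s1 ⬝ᵥ s3 *ᵥ p) • s2 ∈ A (xor (xor a b) c) := by
    by_cases hac : a = c
    · subst hac
      rw [show xor (xor a b) a = b by cases a <;> cases b <;> rfl]; exact Submodule.smul_mem _ _ h2
    · rw [h.dd h1 h3 hac, zero_smul]; exact Submodule.zero_mem _
  have hw := Submodule.sub_mem _ hz (Submodule.add_mem _ w1 (Submodule.smul_mem _ (sg F a b) w2))
  have kp : (r1 (s1 *ᵥ p) (φ ᵥ* s2) + sg F a b • r1 (s2 *ᵥ p) (φ ᵥ* s1)) *ᵥ p = 0 := by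
    rw [add_mulVec, smul_mulVec, r1_mulVec, r1_mulVec, t1.2.2, t2.2.2]; simp
  have kφ : φ ᵥ* (r1 (s1 *ᵥ p) (φ ᵥ* s2) + sg F a b • r1 (s2 *ᵥ p) (φ ᵥ* s1)) = 0 := by
    rw [vecMul_add, vecMul_smul, vecMul_r1, vecMul_r1, t1.2.1, t2.2.1]; simp
  have := h.inj2 hw (by
    rw [sub_mulVec, add_mulVec, smul_mulVec, ← mulVec_mulVec, ← mulVec_mulVec, kp, mulVec_zero, smul_zero, add_zero]
    simp only [add_mulVec, smul_mulVec, r1_mulVec]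
    rw [sub_self])
  rw [vecMul_sub, vecMul_add, vecMul_smul, ← vecMul_vecMul, ← vecMul_vecMul, kφ, zero_vecMul, zero_add, sub_eq_zero] at this
  simpa only [vecMul_add, vecMul_smul, vecMul_r1] using this

theorem RN.sy (h : RN par A α p φ) {b x y} (hx : x ∈ A b) (hy : y ∈ A b) :
    φ ᵥ* x ⬝ᵥ y *ᵥ p = sg F b b * (φ ᵥ* y ⬝ᵥ x *ᵥ p) := by
  have half : ∀ s t, s ∈ A b → t ∈ A b → HT p φ s → HT p φ t →
      φ ᵥ* s ⬝ᵥ t *ᵥ p = sg F b b * (φ ᵥ* t ⬝ᵥ s *ᵥ p) := by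
    cases b
    · intro s t hs ht t1 t2
      have := h.star hs hs ht t1 t1 t2
      simp only [Bool.xor_self, sg_fl, one_smul, ← two_smul F ((_ : F) • (φ ᵥ* s))] at this
      by_cases h0 : φ ᵥ* s = 0
      · rw [h0, h.inj1 hs h0]; simp
      · have h2 := smul_left_injective F h0 (smul_right_injective _ (two_ne_zero (α := F)) this)
        rw [sg_fl, one_mul]; exact h2.symm
    · intro s t hs ht t1 t2
      by_cases hE : ∃ s2 ∈ A false, HT p φ s2 ∧ φ ᵥ* s2 ≠ 0
      · obtain ⟨s2, hs2, t3, h0⟩ := hE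
        have := h.star hs hs2 ht t1 t3 t2
        simp only [Bool.xor_false, sg_fr, sg_tt, h.dd ht hs2 (by simp), h.dd hs2 ht (by simp), zero_smul, smul_zero,
          add_zero, zero_add, one_smul, smul_smul] at this
        have := smul_left_injective F h0 this
        rw [sg_tt]; linear_combination -this
      · push Not at hE
        by_contra hf
        have hA : ∀ y ∈ A true, ∃ c : F, y *ᵥ p = c • (s *ᵥ p) ∧ φ ᵥ* y = c • (φ ᵥ* s) := by
          intro y hy
          obtain ⟨y2, hy2, e1, e2, e3⟩ := h.s hy
          rw [h.dφ hy, zero_smul, sub_zero] at e1 e2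
          have := h.star hs hy2 ht t1 e3 t2
          simp only [Bool.xor_self, sg_fl, sg_tt, one_smul, neg_smul, e1, e2] at this
          set f := φ ᵥ* s ⬝ᵥ t *ᵥ p + φ ᵥ* t ⬝ᵥ s *ᵥ p with hfd
          have hf0 : f ≠ 0 := by
            intro hh; apply hf; rw [sg_tt]; linear_combination hh
          have h4 : φ ᵥ* y = (f⁻¹ * (φ ᵥ* t ⬝ᵥ y *ᵥ p + φ ᵥ* y ⬝ᵥ t *ᵥ p)) • (φ ᵥ* s) := by
            ext i
            have h7 := congrFun this i
            simp only [Pi.add_apply, Pi.neg_apply, Pi.smul_apply, smul_eq_mul] at h7 ⊢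
            rw [mul_assoc, eq_inv_mul_iff_mul_eq₀ hf0, hfd]
            linear_combination h7
          refine ⟨_, ?_, h4⟩
          have := h.inj1 (Submodule.sub_mem _ hy (Submodule.smul_mem _
            (f⁻¹ * (φ ᵥ* t ⬝ᵥ y *ᵥ p + φ ᵥ* y ⬝ᵥ t *ᵥ p)) hs)) (by
            rw [vecMul_sub, vecMul_smul, ← h4, sub_self])
          rwa [sub_mulVec, smul_mulVec, sub_eq_zero] at this
        have hev : ∀ x ∈ A false, ∃ c : F, x *ᵥ p = c • p ∧ φ ᵥ* x = c • φ := by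
          intro x hx
          obtain ⟨y2, hy2, e1, e2, e3⟩ := h.s hx
          have h5 := hE y2 hy2 e3
          have h6 := h.inj1 hy2 h5
          rw [e1, sub_eq_zero] at h6
          rw [e2, sub_eq_zero] at h5
          exact ⟨_, h6, h5⟩
        have hsp : A true ≤ Submodule.span F {s} := by
          refine genK h.toSim h.h1 h.hε h.hp h.hφ true _ ?_
          intro a b x y hx hy hab
          have key : ∀ x y, x ∈ A false → y ∈ A true →
              r1 (x *ᵥ p) (φ ᵥ* y) + r1 (y *ᵥ p) (φ ᵥ* x) ∈ Submodule.span F {s} := by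
            intro x y hx hy
            obtain ⟨c, c1, c2⟩ := hev x hx
            obtain ⟨d, d1, d2⟩ := hA y hy
            rw [Submodule.mem_span_singleton]
            refine ⟨c * d, ?_⟩
            conv_lhs => rw [t1.1]
            rw [c1, c2, d1, d2]
            simp only [r1_smul_left, r1_smul_right, smul_add, smul_smul]
            rw [add_comm, mul_comm d c]
          cases a <;> cases b
          · simp at hab
          · simpa using key x y hx hy
          · have := key y x hy hx
            rw [add_comm] at this
            simpa using this
          · simp at hab
        rcases h.sim (fun b => if b then A true else ⊥) (by intro a; cases a <;> simp) (by
          intro a b x y hx hy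
          cases b
          · simp only [Bool.false_eq_true, if_false, Submodule.mem_bot] at hy
            subst hy
            simp
          · simp only [if_true] at hy
            cases a
            · simpa using h.mul hx hy
            · obtain ⟨c, rfl⟩ := Submodule.mem_span_singleton.1 (hsp hx)
              obtain ⟨d, rfl⟩ := Submodule.mem_span_singleton.1 (hsp hy)
              simp [smul_smul, mul_comm]) with hI | hI
        · exact h.nt (by simpa using hI true)
        · have h9 := hI false
          simp only [Bool.false_eq_true, if_false] at h9
          have := h.hε
          rw [← h9, Submodule.mem_bot] at this
          rcases r1_eq_zero this with h8 | h8
          · exact h.p0 h8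
          · exact h.φ0 h8
  obtain ⟨s, hs, es1, es2, es3, es4, es5⟩ := h.s hx
  obtain ⟨t, ht, et1, et2, et3, et4, et5⟩ := h.s hy
  have h1 := half s t hs ht ⟨es3, es4, es5⟩ ⟨et3, et4, et5⟩
  set c := φ ⬝ᵥ x *ᵥ p with hc
  set d := φ ⬝ᵥ y *ᵥ p with hd
  have hcd : sg F b b * (c * d) = c * d := by
    cases b
    · simp
    · rw [hc, h.dφ hx]; simp
  have hcd2 : sg F b b * c = c := by
    cases b
    · simp
    · rw [hc, h.dφ hx]; simp
  rw [es1, es2, et1, et2] at h1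
  have hc2 : φ ᵥ* x ⬝ᵥ p = c := by rw [hc, dotProduct_mulVec]
  have hd2 : φ ᵥ* y ⬝ᵥ p = d := by rw [hd, dotProduct_mulVec]
  simp only [sub_dotProduct, dotProduct_sub, smul_dotProduct, dotProduct_smul, hc2, hd2, h.h1, ← hc, ← hd, smul_eq_mul] at h1
  linear_combination h1 + (-1 : F) * hcd
def SY (F : Type*) [Field F] (par : ι → Bool) (α : Bool) : Submodule F (Matrix ι ι F) where
  carrier := {X | ∀ i j, X j i = sg F (xor (par i) α) (xor (par j) α) * X i j}
  zero_mem' := by intro i j; simp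
  add_mem' := by intro x y hx hy i j; rw [Matrix.add_apply, hx i j, hy i j, Matrix.add_apply, mul_add]
  smul_mem' := by
    intro c x hx i j; rw [Matrix.smul_apply, hx i j, Matrix.smul_apply, smul_eq_mul, smul_eq_mul]; ring
structure TII (par : ι → Bool) (A : Bool → Submodule F (Matrix ι ι F)) (α : Bool) (e G : Matrix ι ι F) : Prop where
  he : e ∈ PM F par false
  hG : G ∈ PM F par false
  ee : e * e = e
  GS : G ∈ SY F par α
  Ge : G * e = G
  eG : eᵀ * G = G
  inj : ∀ v, v ᵥ* G = 0 → e *ᵥ v = 0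
  mem : ∀ a x, x ∈ A a ↔ ∃ X ∈ PM F par a, X ∈ SY F par α ∧ e * X = X ∧ x = X * G

theorem SY_mulT {e X : Matrix ι ι F} (he : e ∈ PM F par false) (hX : X ∈ SY F par α) (h : e * X = X) :
    X * eᵀ = X := by
  ext i j
  rw [hX j i]
  conv_rhs => rw [← h]
  rw [mul_apply, mul_apply, Finset.mul_sum]
  refine Finset.sum_congr rfl (fun k _ => ?_)
  rw [transpose_apply]
  by_cases hk : par j = par k
  · rw [hX k i, hk]; ring
  · rw [he j k (by revert hk; cases par j <;> cases par k <;> simp)]; ring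

theorem SY_r1 {a b : Bool} {u v : ι → F} (hu : u ∈ PV F par (xor a α)) (hv : v ∈ PV F par (xor b α)) :
    r1 u v + sg F a b • r1 v u ∈ SY F par α := by
  intro i j
  simp only [Matrix.add_apply, Matrix.smul_apply, r1_apply, smul_eq_mul]
  have u1 := hu i
  have u2 := hu j
  have v1 := hv i
  have v2 := hv j
  revert u1 u2 v1 v2
  cases a <;> cases b <;> cases par i <;> cases par j <;> cases α <;> simp <;> intros <;> (try simp [*]) <;> (try ring)

theorem RN.outII (h : RN par A α p φ) : ∃ e G, TII par A α e G := by
  have hU : ∀ b x, x ∈ A b → (∀ y ∈ A b, φ ᵥ* y ⬝ᵥ x *ᵥ p = 0) → x *ᵥ p = 0 := by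
    intro b x hx h2
    have h2' : ∀ y ∈ A b, φ ᵥ* x ⬝ᵥ y *ᵥ p = 0 := fun y hy => by rw [h.sy hx hy, h2 y hy, mul_zero]
    have h3 := I0 h.toSim h.h1 h.hε h.hp h.hφ (h.hh hx) (by
      intro c d y z hy hz
      rw [add_mulVec, r1_mulVec, r1_mulVec, dotProduct_add, dotProduct_smul, dotProduct_smul]
      have e1 : φ ᵥ* y ⬝ᵥ x *ᵥ p = 0 := by
        by_cases hc : c = b
        · subst hc; exact h2 y hy
        · exact h.dd hy hx hc
      have e2 : φ ᵥ* x ⬝ᵥ z *ᵥ p = 0 := by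
        by_cases hc : b = d
        · subst hc; exact h2' z hz
        · exact h.dd hx hz hc
      rw [e1, e2]; simp)
    have h4 : φ ⬝ᵥ x *ᵥ p = 0 := by
      cases b
      · have := h2 _ h.hε
        rwa [vecMul_r1, h.h1, one_smul] at this
      · exact h.dφ hx
    have h5 := congrArg (fun z => z *ᵥ p) h3
    simp only [add_mulVec, r1_mulVec, h.h1, ← dotProduct_mulVec, h4, one_smul, zero_smul, add_zero, zero_mulVec] at h5
    exact h5
  have hΨ : ∀ b y, y ∈ A b → (∀ x ∈ A b, φ ᵥ* y ⬝ᵥ x *ᵥ p = 0) → φ ᵥ* y = 0 := by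
    intro b y hy h2
    exact h.inj2 hy (hU b y hy (fun x hx => by rw [h.sy hx hy, h2 x hx, mul_zero]))
  obtain ⟨e, he, g1, g2, g3, g4, g5, g6, g7⟩ := h.unit hU hΨ
  choose x hx hxe using g1
  let G : Matrix ι ι F := Matrix.of fun i => φ ᵥ* x i
  have hGi : ∀ i, Pi.single i 1 ᵥ* G = φ ᵥ* x i := by
    intro i; ext j; simp [G]
  have hvG : ∀ v, v ᵥ* G = ∑ i, v i • (φ ᵥ* x i) := by
    intro v; ext j; simp [G, vecMul, dotProduct, Finset.sum_apply]
  have hve : ∀ v, e *ᵥ v = ∑ i, v i • (x i *ᵥ p) := by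
    intro v; ext j
    simp only [← hxe]
    simp [mulVec, dotProduct, Finset.sum_apply, mul_comm]
  have hsm : ∀ v : ι → F, (∑ i, v i • x i) *ᵥ p = e *ᵥ v := by
    intro v; rw [hve, sum_mulVec]; simp only [smul_mulVec]
  have hsφ : ∀ v : ι → F, φ ᵥ* (∑ i, v i • x i) = v ᵥ* G := by
    intro v; rw [hvG, vecMul_sum]; simp only [vecMul_smul]
  have hsA : ∀ a v, v ∈ PV F par (xor a α) → ∑ i, v i • x i ∈ A a := by
    intro a v hv
    refine Submodule.sum_mem _ (fun i _ => ?_)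
    by_cases hi : par i = xor a α
    · have := hx i
      rw [hi, Bool.xor_assoc, Bool.xor_self, Bool.xor_false] at this
      exact Submodule.smul_mem _ _ this
    · rw [hv i hi, zero_smul]; exact Submodule.zero_mem _
  have key : ∀ a y, y ∈ A a → (y *ᵥ p) ᵥ* G = φ ᵥ* y := by
    intro a y hy
    have := h.inj2 (Submodule.sub_mem _ hy (hsA a _ (h.pU hy))) (by
      rw [sub_mulVec, hsm, g3 a y hy, sub_self])
    rw [vecMul_sub, hsφ, sub_eq_zero] at this
    exact this.symm
  have Gij : ∀ i j, G i j = φ ᵥ* x i ⬝ᵥ x j *ᵥ p := by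
    intro i j
    rw [← hxe j, dotProduct_mulVec, g4 _ _ (hx i)]; simp [G]
  have hne : ∀ i j, par i ≠ par j → G i j = 0 := by
    intro i j hij
    rw [Gij, h.dd (hx i) (hx j) (by revert hij; cases par i <;> cases par j <;> cases α <;> simp)]
  have hS : ∀ a y, (∃ X ∈ PM F par a, X ∈ SY F par α ∧ e * X = X ∧ y = X * G) → y ∈ A a := by
    rintro a y ⟨X, hX, hXS, hXe, rfl⟩
    have e1 : X * G = ∑ i, ∑ j, X i j • r1 (x i *ᵥ p) (φ ᵥ* x j) := by
      have hXe2 := SY_mulT he hXS hXe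
      conv_lhs => rw [← hXe2, ← hXe, mat_sum X]
      simp only [Finset.sum_mul, Finset.mul_sum, smul_mul_assoc, mul_smul_comm, r1_mul, mul_r1, vecMul_transpose, hxe]
      refine Finset.sum_congr rfl (fun i _ => Finset.sum_congr rfl (fun j _ => ?_))
      rw [key _ _ (hx j)]
    apply half_mem
    have e2 : X * G + X * G = ∑ i, ∑ j, X i j • (r1 (x i *ᵥ p) (φ ᵥ* x j) +
        sg F (xor (par i) α) (xor (par j) α) • r1 (x j *ᵥ p) (φ ᵥ* x i)) := by
      have e3 : X * G = ∑ i, ∑ j, X j i • r1 (x j *ᵥ p) (φ ᵥ* x i) := by rw [e1, Finset.sum_comm]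
      nth_rewrite 2 [e3]
      rw [e1, ← Finset.sum_add_distrib]
      refine Finset.sum_congr rfl (fun i _ => ?_)
      rw [← Finset.sum_add_distrib]
      refine Finset.sum_congr rfl (fun j _ => ?_)
      rw [hXS i j, smul_add, smul_smul, mul_comm (X i j)]
    rw [e2]
    refine Submodule.sum_mem _ (fun i _ => Submodule.sum_mem _ (fun j _ => ?_))
    by_cases hij : xor (par i) (par j) = a
    · refine Submodule.smul_mem _ _ ?_
      have := h.k (hx i) (hx j)
      rwa [show xor (xor (par i) α) (xor (par j) α) = a by
        rw [← hij]; cases par i <;> cases par j <;> cases α <;> rfl] at this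
    · rw [hX i j hij, zero_smul]; exact Submodule.zero_mem _
  refine ⟨e, G, he, ?_, g5, ?_, ?_, ?_, ?_, fun a y => ⟨?_, hS a y⟩⟩
  · intro i j hij
    exact hne i j (by revert hij; cases par i <;> cases par j <;> simp)
  · intro i j
    by_cases hij : par i = par j
    · have hxj := hx j
      rw [← hij] at hxj
      rw [Gij, Gij, h.sy hxj (hx i), hij]
    · rw [hne i j hij, hne j i (Ne.symm hij), mul_zero]
  · ext i j
    have := congrFun (g4 _ _ (hx i)) j
    rw [← hGi, vecMul_vecMul] at this
    simpa using this
  · ext i j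
    have := congrFun (key _ _ (hx i)) j
    rw [← hxe, ← hGi, ← vecMul_transpose, vecMul_vecMul] at this
    simpa using this
  · intro v hv
    let w : Bool → ι → F := fun a i => if par i = xor a α then v i else 0
    have hw : ∀ a, w a ∈ PV F par (xor a α) := by
      intro a i hi; simp [w, hi]
    have hw2 : v = w false + w true := by
      ext i; simp only [w, Pi.add_apply]; cases par i <;> cases α <;> simp
    have hφw := fun a => h.pΨ (hsA a _ (hw a))
    have h0 : ∀ a, φ ᵥ* (∑ i, w a i • x i) = 0 := by
      have hsum : φ ᵥ* (∑ i, w false i • x i) + φ ᵥ* (∑ i, w true i • x i) = 0 := by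
        rw [hsφ, hsφ, ← add_vecMul, ← hw2, hv]
      intro a
      ext j
      have h7 := congrFun hsum j
      have hf := hφw false j
      have ht := hφw true j
      simp only [Pi.add_apply, Pi.zero_apply] at h7 ⊢
      by_cases hj : par j = xor a α
      · cases a
        · rw [ht (by rw [hj]; cases α <;> simp), add_zero] at h7; exact h7
        · rw [hf (by rw [hj]; cases α <;> simp), zero_add] at h7; exact h7
      · exact hφw a j hj
    have h1 := fun a => h.inj1 (hsA a _ (hw a)) (h0 a)
    rw [hw2, mulVec_add, ← hsm, ← hsm, h1, h1, add_zero]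
  · intro hy
    let T : Submodule F (Matrix ι ι F) := (PM F par a ⊓ SY F par α ⊓
      LinearMap.ker (LinearMap.mulLeft F e - LinearMap.id)).map (LinearMap.mulRight F G)
    have hT : A a ≤ T := by
      refine genK h.toSim h.h1 h.hε h.hp h.hφ a _ ?_
      clear hy
      rintro b c y z hy hz rfl
      refine ⟨r1 (y *ᵥ p) (z *ᵥ p) + sg F b c • r1 (z *ᵥ p) (y *ᵥ p), ⟨⟨?_, SY_r1 (h.pU hy) (h.pU hz)⟩, ?_⟩, ?_⟩
      · refine Submodule.add_mem _ ?_ (Submodule.smul_mem _ _ ?_)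
        · have := PM_r1 (h.pU hy) (h.pU hz)
          rwa [show xor (xor b α) (xor c α) = xor b c by cases b <;> cases c <;> cases α <;> rfl] at this
        · have := PM_r1 (h.pU hz) (h.pU hy)
          rwa [show xor (xor c α) (xor b α) = xor b c by cases b <;> cases c <;> cases α <;> rfl] at this
      · simp only [SetLike.mem_coe, LinearMap.mem_ker, LinearMap.sub_apply, LinearMap.mulLeft_apply, LinearMap.id_apply, mul_add,
          mul_smul_comm, mul_r1, g3 _ _ hy, g3 _ _ hz, sub_self]
      · simp only [LinearMap.mulRight_apply, add_mul, smul_mul_assoc, r1_mul, key _ _ hy, key _ _ hz]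
    obtain ⟨X, ⟨⟨h1, h2⟩, h3⟩, h4⟩ := hT hy
    refine ⟨X, h1, h2, ?_, h4.symm⟩
    simpa [sub_eq_zero] using h3
theorem S2 (hA : Sim par A) (hR : ROI (A false)) : (∃ e, TI par A e) ∨ ∃ α e G, TII par A α e G := by
  obtain ⟨p, φ, h1, hε⟩ := hR
  obtain ⟨α, hp, hφ⟩ := ROI.par h1 (hA.hom _ hε)
  have h : RD par A α p φ := ⟨hA, h1, hε, hp, hφ⟩
  by_cases hN : ∀ b u, r1 u φ ∈ A b → φ ⬝ᵥ u = 0 → ∀ x ∈ A b, φ ᵥ* x ⬝ᵥ u = 0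
  · right
    have h : RN par A α p φ := ⟨h, hN⟩
    exact ⟨α, h.outII⟩
  · left
    push Not at hN
    obtain ⟨b, u, hu, hu0, x, hx, hxu⟩ := hN
    exact h.outI (h.caseH hu hu0 hx hxu)

end Csec
section Csec
variable {F : Type*} [Field F] [CharZero F] {ι : Type*} [Fintype ι] [DecidableEq ι]
open Module
variable {par : ι → Bool} {A B : Bool → Submodule F (Matrix ι ι F)}

theorem unitROI [IsAlgClosed F] (hB : Sim par B) (hAB : ∀ a, A a ⊔ B a = PM F par a) {e : Matrix ι ι F}
    (he : e ∈ PM F par false) (hee : e * e = e) (h1 : e ≠ 1) (hl : ∀ a x, x ∈ A a → e * x = x)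
    (hr : ∀ a x, x ∈ A a → x * e = x) : ROI (B false) := by
  have hf : (1 - e) * (1 - e) = 1 - e := by rw [mul_sub, mul_one, sub_mul, one_mul, hee]; simp
  have hf0 : (1 : Matrix ι ι F) - e ∈ PM F par false := Submodule.sub_mem _ PM_one he
  have hle : ∀ a x, x ∈ A a → x * (1 - e) = 0 := fun a x hx => by rw [mul_sub, mul_one, hr a x hx, sub_self]
  have hre : ∀ a x, x ∈ A a → (1 - e) * x = 0 := fun a x hx => by rw [sub_mul, one_mul, hl a x hx, sub_self]
  have hne : (1 : Matrix ι ι F) - e ≠ 0 := sub_ne_zero.2 (Ne.symm h1)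
  generalize (1 : Matrix ι ι F) - e = f at *
  obtain ⟨i, j, hij⟩ : ∃ i j, f i j ≠ 0 := by
    by_contra! hc
    exact hne (by ext i j; exact hc i j)
  have hp : par i = par j := by
    by_contra hh
    exact hij (hf0 i j (by revert hh; cases par i <;> cases par j <;> simp))
  refine S3 hB hAB (α := par j) (p0 := f *ᵥ Pi.single j 1) (φ0 := (f i j)⁻¹ • (Pi.single i 1 ᵥ* f)) ?_ ?_ ?_ ?_ ?_
  · simpa using PM_mulVec hf0 (single_PV (F := F) (par := par) j)
  · refine Submodule.smul_mem _ _ ?_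
    rw [← hp]
    simpa using PM_vecMul hf0 (single_PV (F := F) (par := par) i)
  · rw [smul_dotProduct, dotProduct_mulVec, vecMul_vecMul, hf]
    simp [hij]
  · intro a x hx
    rw [mulVec_mulVec, hle a x hx, zero_mulVec]
  · intro a x hx
    rw [smul_vecMul, vecMul_vecMul, hre a x hx, vecMul_zero, smul_zero]
theorem stepQ {α : Bool} {p φ : ι → F} (hp : p ∈ PV F par α) (hφ : φ ∈ PV F par α) (h1 : φ ⬝ᵥ p = 1)
    {i : ι} (hi : p i ≠ 0) : ∃ Q ∈ PM F par false, ∃ P ∈ PM F par false, P * Q = 1 ∧ Q * P = 1 ∧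
      Q *ᵥ Pi.single i 1 = p ∧ φ ᵥ* Q = Pi.single i 1 ∧
      ∀ j, p j = 0 → φ j = 0 → Q *ᵥ Pi.single j 1 = Pi.single j 1 ∧ Pi.single j 1 ᵥ* Q = Pi.single j 1 := by
  have hiα : par i = α := by by_contra h; exact hi (hp i h)
  set e : ι → F := Pi.single i 1 with he
  have heα : e ∈ PV F par α := by rw [← hiα]; exact single_PV i
  have hee : e ⬝ᵥ (p - e) = p i - 1 := by simp [he]
  have hee2 : e ⬝ᵥ e = 1 := by simp [he]
  set ψ : ι → F := e - (φ + (1 - φ i) • e) with hψ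
  have hψe : ψ ⬝ᵥ e = 0 := by simp [hψ, he]
  have hψα : ψ ∈ PV F par α :=
    Submodule.sub_mem _ heα (Submodule.add_mem _ hφ (Submodule.smul_mem _ _ heα))
  have hPM : ∀ u v, u ∈ PV F par α → v ∈ PV F par α → r1 u v ∈ PM F par false := by
    intro u v hu hv; have := PM_r1 hu hv; rwa [Bool.xor_self] at this
  have a1 : (1 - (p i)⁻¹ • r1 (p - e) e) * (1 + r1 (p - e) e) = 1 := by
    have : (p i)⁻¹ * (p i - 1) = 1 - (p i)⁻¹ := by field_simp
    have h2 : r1 (p - e) e * r1 (p - e) e = (p i - 1) • r1 (p - e) e := by rw [r1_mul_r1, hee]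
    simp only [mul_add, sub_mul, mul_one, one_mul, smul_mul_assoc, h2, smul_smul]
    rw [this, sub_smul, one_smul]; abel
  have a2 : (1 - r1 e ψ) * (1 + r1 e ψ) = 1 := by
    simp only [mul_add, sub_mul, mul_one, one_mul, r1_mul_r1, hψe, zero_smul]; abel
  have hPQ : ((1 - r1 e ψ) * (1 - (p i)⁻¹ • r1 (p - e) e)) * ((1 + r1 (p - e) e) * (1 + r1 e ψ)) = 1 := by
    rw [mul_assoc, ← mul_assoc (1 - (p i)⁻¹ • r1 (p - e) e), a1, one_mul, a2]
  refine ⟨(1 + r1 (p - e) e) * (1 + r1 e ψ), ?_, (1 - r1 e ψ) * (1 - (p i)⁻¹ • r1 (p - e) e), ?_, hPQ,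
    mul_eq_one_comm.1 hPQ, ?_, ?_, ?_⟩
  · exact PM_mul (Submodule.add_mem _ PM_one (hPM _ _ (Submodule.sub_mem _ hp heα) heα))
      (Submodule.add_mem _ PM_one (hPM _ _ heα hψα))
  · exact PM_mul (Submodule.sub_mem _ PM_one (hPM _ _ heα hψα))
      (Submodule.sub_mem _ PM_one (Submodule.smul_mem _ _ (hPM _ _ (Submodule.sub_mem _ hp heα) heα)))
  · rw [← mulVec_mulVec]
    simp only [add_mulVec, one_mulVec, r1_mulVec, hψe, zero_smul, add_zero, hee2, one_smul]; abel
  · have hx : φ ⬝ᵥ e = φ i := by simp [he]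
    have hφ2 : φ ᵥ* (1 + r1 (p - e) e) = φ + (1 - φ i) • e := by
      rw [vecMul_add, vecMul_one, vecMul_r1, dotProduct_sub, h1, hx]
    have hy : (φ + (1 - φ i) • e) ⬝ᵥ e = 1 := by rw [add_dotProduct, smul_dotProduct, hee2, hx]; simp
    rw [← vecMul_vecMul, hφ2, vecMul_add, vecMul_one, vecMul_r1, hy, one_smul, hψ]; abel
  · intro j hpj hφj
    have hji : j ≠ i := by rintro rfl; exact hi hpj
    have z1 : ψ ⬝ᵥ Pi.single j 1 = 0 := by simp [hψ, he, hji, hφj]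
    have z2 : e ⬝ᵥ Pi.single j 1 = 0 := by simp [he, hji]
    have z3 : (Pi.single j 1 : ι → F) ⬝ᵥ (p - e) = 0 := by simp [he, hji, hpj]
    have z4 : (Pi.single j 1 : ι → F) ⬝ᵥ e = 0 := by simp [he, hji]
    constructor
    · rw [← mulVec_mulVec]
      simp only [add_mulVec, one_mulVec, r1_mulVec, z1, z2, zero_smul, add_zero]
    · rw [← vecMul_vecMul]
      simp only [vecMul_add, vecMul_one, vecMul_r1, z3, z4, zero_smul, add_zero]
theorem DIAG (n : ℕ) : ∀ (t : Finset ι) (e : Matrix ι ι F), (tᶜ).card ≤ n → e ∈ PM F par false → e * e = e →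
    (∀ i ∈ t, e *ᵥ Pi.single i 1 = 0 ∧ Pi.single i 1 ᵥ* e = 0) →
    ∃ Q ∈ PM F par false, ∃ P ∈ PM F par false, ∃ s : Finset ι, P * Q = 1 ∧ Q * P = 1 ∧
      P * e * Q = diagonal (fun i => if i ∈ s then (1 : F) else 0) ∧
      ∀ j ∈ t, Q *ᵥ Pi.single j 1 = Pi.single j 1 ∧ Pi.single j 1 ᵥ* P = Pi.single j 1 := by
  induction n with
  | zero =>
    intro t e hn he hee ht
    have h0 : e = 0 := by
      apply mat_ext_single
      intro j
      have : j ∈ t := by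
        by_contra hj
        have : 0 < (tᶜ).card := Finset.card_pos.2 ⟨j, by simpa using hj⟩
        omega
      rw [(ht j this).1, zero_mulVec]
    exact ⟨1, PM_one, 1, PM_one, ∅, by simp, by simp, by simp [h0],
      by intro j _; rw [one_mulVec, vecMul_one]; exact ⟨rfl, rfl⟩⟩
  | succ n ih =>
    intro t e hn he hee ht
    by_cases h0 : e = 0
    · exact ⟨1, PM_one, 1, PM_one, ∅, by simp, by simp, by simp [h0],
      by intro j _; rw [one_mulVec, vecMul_one]; exact ⟨rfl, rfl⟩⟩
    obtain ⟨i, j, hij⟩ : ∃ i j, e i j ≠ 0 := by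
      by_contra! hc
      exact h0 (by ext i j; exact hc i j)
    have hpar : par i = par j := by
      by_contra hh
      exact hij (he i j (by revert hh; cases par i <;> cases par j <;> simp))
    obtain ⟨p, hpd⟩ : ∃ p, p = e *ᵥ Pi.single j 1 := ⟨_, rfl⟩
    obtain ⟨φ, hφd⟩ : ∃ φ, φ = (e i j)⁻¹ • (Pi.single i 1 ᵥ* e) := ⟨_, rfl⟩
    have hp : p ∈ PV F par (par j) := by
      rw [hpd]; simpa using PM_mulVec he (single_PV (F := F) (par := par) j)
    have hφ : φ ∈ PV F par (par j) := by
      rw [hφd]; refine Submodule.smul_mem _ _ ?_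
      rw [← hpar]
      simpa using PM_vecMul he (single_PV (F := F) (par := par) i)
    have h1 : φ ⬝ᵥ p = 1 := by
      rw [hpd, hφd, smul_dotProduct, dotProduct_mulVec, vecMul_vecMul, hee]
      simp [hij]
    have hep : e *ᵥ p = p := by rw [hpd, mulVec_mulVec, hee]
    have hφe : φ ᵥ* e = φ := by rw [hφd, smul_vecMul, vecMul_vecMul, hee]
    have hpi : p i ≠ 0 := by rw [hpd]; simpa using hij
    have hpt : ∀ l ∈ t, p l = 0 := by
      intro l hl
      have := congrFun (ht l hl).2 j
      rw [hpd]; simpa using this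
    have hφt : ∀ l ∈ t, φ l = 0 := by
      intro l hl
      have := congrFun (ht l hl).1 i
      rw [hφd]; simp only [Pi.smul_apply, smul_eq_mul, mul_eq_zero]; right; simpa using this
    obtain ⟨Q, hQ, P, hP, hPQ, hQP, q1, q2, q3⟩ := stepQ hp hφ h1 hpi
    have hit : i ∉ t := fun h => hpi (hpt i h)
    have hPj : ∀ j ∈ t, Pi.single j 1 ᵥ* P = Pi.single j 1 := by
      intro j hj
      have := (q3 j (hpt j hj) (hφt j hj)).2
      conv_lhs => rw [← this]
      rw [vecMul_vecMul, hQP, vecMul_one]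
    have hPi : Pi.single i 1 ᵥ* P = φ := by rw [← q2, vecMul_vecMul, hQP, vecMul_one]
    have hPp : P *ᵥ p = Pi.single i 1 := by rw [← q1, mulVec_mulVec, hPQ, one_mulVec]
    have hid : (e - r1 p φ) * (e - r1 p φ) = e - r1 p φ := by
      simp only [mul_sub, sub_mul, hee, mul_r1, r1_mul, hep, hφe, r1_mul_r1, h1, one_smul]; simp [r1_mulVec, h1]
    have hr : r1 p φ ∈ PM F par false := by have := PM_r1 hp hφ; rwa [Bool.xor_self] at this
    obtain ⟨Q2, hQ2, P2, hP2, s, hPQ2, hQP2, hd, hfix⟩ := ih (insert i t) (P * (e - r1 p φ) * Q)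
      (by
        rw [Finset.compl_insert, Finset.card_erase_of_mem (by simpa using hit)]; omega)
      (PM_mul (PM_mul hP (Submodule.sub_mem _ he hr)) hQ)
      (by
        rw [show P * (e - r1 p φ) * Q * (P * (e - r1 p φ) * Q) = P * (e - r1 p φ) * (Q * P) * (e - r1 p φ) * Q by
          simp only [mul_assoc], hQP, mul_one, mul_assoc P, hid])
      (by
        intro l hl
        rw [← mulVec_mulVec, ← mulVec_mulVec, ← vecMul_vecMul, ← vecMul_vecMul]
        rcases Finset.mem_insert.1 hl with rfl | hl
        · rw [q1, hPi, sub_mulVec, vecMul_sub, hep, hφe, r1_mulVec, vecMul_r1, h1]; simp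
        · rw [(q3 l (hpt l hl) (hφt l hl)).1, hPj l hl, sub_mulVec, vecMul_sub, (ht l hl).1, (ht l hl).2,
            r1_mulVec, vecMul_r1]
          simp [hpt l hl, hφt l hl])
    have hPi2 := (hfix i (Finset.mem_insert_self _ _)).2
    have hQi2 := (hfix i (Finset.mem_insert_self _ _)).1
    have hPi2' : P2 *ᵥ Pi.single i 1 = Pi.single i 1 := by
      conv_lhs => rw [← hQi2]
      rw [mulVec_mulVec, hPQ2, one_mulVec]
    have hQi2' : Pi.single i 1 ᵥ* Q2 = Pi.single i 1 := by
      conv_lhs => rw [← hPi2]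
      rw [vecMul_vecMul, hPQ2, vecMul_one]
    have his : i ∉ s := by
      intro h
      have h7 : Pi.single i 1 ᵥ* (P2 * (P * (e - r1 p φ) * Q) * Q2) = 0 := by
        rw [← vecMul_vecMul, ← vecMul_vecMul, hPi2, ← vecMul_vecMul, ← vecMul_vecMul, hPi, vecMul_sub, hφe, vecMul_r1, h1]
        simp
      rw [hd] at h7
      have := congrFun h7 i
      simp [h] at this
    refine ⟨Q * Q2, PM_mul hQ hQ2, P2 * P, PM_mul hP2 hP, insert i s, ?_, ?_, ?_, ?_⟩
    · rw [mul_assoc, ← mul_assoc P, hPQ, one_mul, hPQ2]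
    · rw [mul_assoc, ← mul_assoc Q2, hQP2, one_mul, hQP]
    · have e1 : P2 * P * e * (Q * Q2) = P2 * (P * (e - r1 p φ) * Q) * Q2 + r1 (P2 *ᵥ (P *ᵥ p)) ((φ ᵥ* Q) ᵥ* Q2) := by
        rw [← r1_mul, ← r1_mul, ← mul_r1, ← mul_r1]; noncomm_ring
      rw [e1, hd, hPp, q2, hPi2', hQi2']
      ext a b
      by_cases hab : a = b
      · subst hab
        by_cases hai : a = i
        · subst hai; simp [r1_apply, his]
        · simp [r1_apply, hai]
      · have : ¬ (a = i ∧ b = i) := by rintro ⟨rfl, rfl⟩; exact hab rfl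
        simp only [Matrix.add_apply, diagonal_apply_ne _ hab, r1_apply, Pi.single_apply, zero_add]
        by_cases hai : a = i
        · subst hai; simp [Ne.symm hab]
        · simp [hai]
    · intro l hl
      rw [← mulVec_mulVec, ← vecMul_vecMul, (hfix l (Finset.mem_insert_of_mem hl)).1,
        (hfix l (Finset.mem_insert_of_mem hl)).2, (q3 l (hpt l hl) (hφt l hl)).1, hPj l hl]
      exact ⟨rfl, rfl⟩

theorem Alg.conj (hA : Alg par A) {P Q : Matrix ι ι F} (hP : P ∈ PM F par false) (hQ : Q ∈ PM F par false)
    (hQP : Q * P = 1) : Alg par (fun a => (A a).map (conjL P Q)) := by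
  constructor
  · rintro a _ ⟨x, hx, rfl⟩
    have := PM_mul (PM_mul hP (hA.hom a hx)) hQ
    simp only [Bool.false_xor, Bool.xor_false] at this; exact this
  · rintro a b _ _ ⟨x, hx, rfl⟩ ⟨y, hy, rfl⟩
    refine ⟨_, hA.mul hx hy, ?_⟩
    have e1 : ∀ x y : Matrix ι ι F, P * x * Q * (P * y * Q) = P * (x * y) * Q := by
      intro x y
      rw [show P * x * Q * (P * y * Q) = P * x * (Q * P) * (y * Q) by simp only [mul_assoc], hQP]
      simp only [mul_one, mul_assoc]
    change P * _ * Q = P * x * Q * (P * y * Q) + sg F a b • (P * y * Q * (P * x * Q))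
    rw [e1, e1, mul_add, add_mul, mul_smul_comm, smul_mul_assoc]

theorem ROI.conj {S : Submodule F (Matrix ι ι F)} {P Q : Matrix ι ι F} (hQP : Q * P = 1)
    (h : ROI (S.map (conjL P Q))) : ROI S := by
  obtain ⟨p, φ, h1, b, hb, hb2⟩ := h
  have hPQ := mul_eq_one_comm.1 hQP
  refine ⟨Q *ᵥ p, φ ᵥ* P, ?_, ?_⟩
  · rw [dotProduct_mulVec, vecMul_vecMul, hPQ, vecMul_one, h1]
  · rw [← r1_mul, ← mul_r1, ← hb2]
    change Q * (P * b * Q) * P ∈ S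
    rw [show Q * (P * b * Q) * P = (Q * P) * b * (Q * P) by simp only [mul_assoc], hQP, one_mul, mul_one]
    exact hb


theorem tr_nil {a : Matrix ι ι F} (h : IsNilpotent a) : trace a = 0 :=
  (Matrix.isNilpotent_trace_of_isNilpotent h).eq_zero

theorem tr_nil2 {a b : Matrix ι ι F} (ha : IsNilpotent a) (hb : IsNilpotent b) (hab : IsNilpotent (a + b)) :
    trace (a * b) = 0 := by
  have sq : ∀ x : Matrix ι ι F, IsNilpotent x → trace (x * x) = 0 := fun x hx =>
    tr_nil ((Commute.refl x).isNilpotent_mul_right hx)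
  have h := sq _ hab
  rw [add_mul, mul_add, mul_add, trace_add, trace_add, trace_add, sq a ha, sq b hb, trace_mul_comm b a] at h
  have : (2 : F) * trace (a * b) = 0 := by linear_combination h
  simpa using this

theorem not_nil_idem {h : Matrix ι ι F} (hh : h * h = h) (h0 : h ≠ 0) : ¬ IsNilpotent h := by
  rintro ⟨n, hn⟩
  cases n with
  | zero => rw [pow_zero] at hn; exact h0 (by rw [← mul_one h, hn, mul_zero])
  | succ n => rw [IsIdempotentElem.pow_succ_eq n hh] at hn; exact h0 hn

theorem roi_rank1 {S : Submodule F (Matrix ι ι F)} {h : Matrix ι ι F} (hS : h ∈ S) (hh : h * h = h) (h0 : h ≠ 0)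
    (hr : h.rank < 2) : ROI S := by
  obtain ⟨i, j, hij⟩ : ∃ i j, h i j ≠ 0 := by
    by_contra! hc
    exact h0 (by ext i j; exact hc i j)
  obtain ⟨p, hpd⟩ : ∃ p, p = h *ᵥ Pi.single j 1 := ⟨_, rfl⟩
  obtain ⟨φ, hφd⟩ : ∃ φ, φ = (h i j)⁻¹ • (Pi.single i 1 ᵥ* h) := ⟨_, rfl⟩
  have h1 : φ ⬝ᵥ p = 1 := by
    rw [hpd, hφd, smul_dotProduct, dotProduct_mulVec, vecMul_vecMul, hh]
    simp [hij]
  have hep : h *ᵥ p = p := by rw [hpd, mulVec_mulVec, hh]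
  have hφe : φ ᵥ* h = φ := by rw [hφd, smul_vecMul, vecMul_vecMul, hh]
  have hid : (h - r1 p φ) * (h - r1 p φ) = h - r1 p φ := by
    simp only [mul_sub, sub_mul, hh, mul_r1, r1_mul, hep, hφe, r1_mul_r1, h1, one_smul]; simp [r1_mulVec, h1]
  have e1 : h.rank = 1 := by
    rcases Nat.lt_or_ge h.rank 1 with h2 | h2
    · exact absurd (rank0 (by omega)) h0
    · omega
  have e2 : (((h - r1 p φ).rank : ℕ) : F) = 0 := by
    rw [← trace_idem hid, trace_sub, trace_idem hh, e1, trace_r1, h1]; simp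
  have e3 := rank0 (Nat.cast_eq_zero.1 e2)
  exact ⟨p, φ, h1, by rw [← sub_eq_zero.1 e3]; exact hS⟩

theorem rank_sub {h k : Matrix ι ι F} (hh : h * h = h) (kk : k * k = k) (hk : h * k = k) (kh : k * h = k)
    (hr : h.rank ≤ k.rank) : k = h := by
  have hid : (h - k) * (h - k) = h - k := by simp only [mul_sub, sub_mul, hh, kk, hk, kh]; abel
  have e2 := trace_idem hid
  rw [trace_sub, trace_idem hh, trace_idem kk] at e2
  have e3 : h.rank = (h - k).rank + k.rank := by
    have : (h.rank : F) = (((h - k).rank + k.rank : ℕ) : F) := by push_cast; linear_combination e2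
    exact_mod_cast this
  have := rank0 (h := h - k) (by omega)
  exact (sub_eq_zero.1 this).symm

theorem ML [IsAlgClosed F] (hB : Sim par B) (hR : ¬ ROI (B false)) {N : Submodule F (Matrix ι ι F)}
    (hNB : N ≤ B false) (hN : ∀ b ∈ B false, ∀ y ∈ N, b * y + y * b ∈ N) {y} (hy : y ∈ N) (hyn : ¬ IsNilpotent y) :
    ∃ h ∈ N, h * h = h ∧ h ≠ 0 ∧ 2 ≤ h.rank ∧ ∀ b ∈ B false, ∃ l : F, h * b * h = l • h := by
  have hJ : JC N := fun x hx y hy => hN x (hNB hx) y hy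
  have hex : ∃ r, ∃ h ∈ N, h * h = h ∧ h ≠ 0 ∧ h.rank = r := by
    obtain ⟨h, a1, a2, a3, -⟩ := spec (fun k => hJ.pow hy k) hyn
    exact ⟨_, h, a1, a3, a2, rfl⟩
  classical
  obtain ⟨h, hh, hhh, h0, hr⟩ := Nat.find_spec hex
  have hmin : ∀ k ∈ N, k * k = k → k ≠ 0 → h.rank ≤ k.rank := by
    intro k k1 k2 k3
    rw [hr]; exact Nat.find_min' hex ⟨k, k1, k2, k3, rfl⟩
  clear hr hy hyn
  have hc : ∀ b ∈ B false, h * b * h ∈ N := by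
    intro b hb
    apply half_mem
    have e1 := hN h (hNB hh) _ (hN b hb h hh)
    have e2 := Submodule.sub_mem _ e1 (hN b hb h hh)
    convert e2 using 1
    have : h * (b * h + h * b) + (b * h + h * b) * h = h * b * h + h * h * b + b * (h * h) + h * b * h := by noncomm_ring
    rw [this, hhh]; abel
  have key : ∀ c ∈ N, h * c = c → c * h = c → ∃ l : F, IsNilpotent (c - l • h) := by
    intro c hc h1 h2
    let W := LinearMap.range (Matrix.mulVecLin h)
    have hW : ∀ x ∈ W, (Matrix.mulVecLin c) x ∈ W := by
      rintro _ ⟨x, rfl⟩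
      exact ⟨c *ᵥ x, by simp [mulVec_mulVec, h1, h2]⟩
    have hnt : Nontrivial W := by
      rw [Submodule.nontrivial_iff_ne_bot]
      intro hb
      exact h0 (rank0 (by rw [Matrix.rank]; change finrank F W = 0; rw [hb, finrank_bot]))
    obtain ⟨l, hl⟩ := Module.End.exists_eigenvalue ((Matrix.mulVecLin c).restrict hW)
    obtain ⟨⟨v, w, rfl⟩, hv⟩ := hl.exists_hasEigenvector
    refine ⟨l, ?_⟩
    have hv0 : h *ᵥ w ≠ 0 := fun h => hv.2 (Subtype.ext h)
    have hv1 : c *ᵥ (h *ᵥ w) = l • (h *ᵥ w) := congrArg Subtype.val hv.apply_eq_smul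
    by_contra hn
    obtain ⟨a, ha⟩ : ∃ a, a = c - l • h := ⟨_, rfl⟩
    rw [← ha] at hn
    have haN : a ∈ N := by rw [ha]; exact Submodule.sub_mem _ hc (Submodule.smul_mem _ _ hh)
    have hav : a *ᵥ (h *ᵥ w) = 0 := by
      rw [ha, sub_mulVec, hv1, smul_mulVec, mulVec_mulVec, hhh, sub_self]
    have hha : h * a = a := by rw [ha, mul_sub, h1, mul_smul_comm, hhh]
    have hah : a * h = a := by rw [ha, sub_mul, h2, smul_mul_assoc, hhh]
    let S : Submodule F (Matrix ι ι F) :=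
      { carrier := {x | x ∈ N ∧ h * x = x ∧ x * h = x ∧ x *ᵥ (h *ᵥ w) = 0}
        zero_mem' := by simp
        add_mem' := by
          rintro x y ⟨x1, x2, x3, x4⟩ ⟨y1, y2, y3, y4⟩
          exact ⟨N.add_mem x1 y1, by rw [mul_add, x2, y2], by rw [add_mul, x3, y3], by rw [add_mulVec, x4, y4, add_zero]⟩
        smul_mem' := by
          rintro t x ⟨x1, x2, x3, x4⟩
          exact ⟨N.smul_mem t x1, by rw [mul_smul_comm, x2], by rw [smul_mul_assoc, x3], by rw [smul_mulVec, x4, smul_zero]⟩ }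
    obtain ⟨k, ⟨k1, k2, k3, k4⟩, k5, k6, -⟩ := spec (S := S) (a := a) (by
      intro n
      refine ⟨hJ.pow haN n, ?_, ?_, ?_⟩
      · rw [pow_succ', ← mul_assoc, hha]
      · rw [pow_succ, mul_assoc, hah]
      · rw [pow_succ, ← mulVec_mulVec, hav, mulVec_zero]) hn
    have := rank_sub hhh k6 k2 k3 (hmin k k1 k6 k5)
    rw [this, mulVec_mulVec, hhh] at k4
    exact hv0 k4
  have hrk : (h.rank : F) ≠ 0 := by
    rw [Nat.cast_ne_zero]; exact fun h2 => h0 (rank0 h2)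
  have key2 : ∀ c ∈ N, h * c = c → c * h = c → trace c = 0 → IsNilpotent c := by
    intro c h1 h2 h3 h4
    obtain ⟨l, hl⟩ := key c h1 h2 h3
    have := tr_nil hl
    rw [trace_sub, h4, trace_smul, trace_idem hhh, zero_sub, neg_eq_zero, smul_eq_mul] at this
    rcases mul_eq_zero.1 this with h5 | h5
    · rwa [h5, zero_smul, sub_zero] at hl
    · exact absurd h5 hrk
  refine ⟨h, hh, hhh, h0, ?_, ?_⟩
  · by_contra hlt
    exact hR (roi_rank1 (hNB hh) hhh h0 (by omega))
  intro b hb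
  have hl : ∀ b : Matrix ι ι F, h * (h * b * h) = h * b * h := fun b => by rw [← mul_assoc, ← mul_assoc, hhh]
  have hr : ∀ b : Matrix ι ι F, (h * b * h) * h = h * b * h := fun b => by rw [mul_assoc, hhh]
  obtain ⟨l, hl1⟩ := key _ (hc b hb) (hl b) (hr b)
  refine ⟨l, ?_⟩
  have haN : h * b * h - l • h ∈ N := Submodule.sub_mem _ (hc b hb) (Submodule.smul_mem _ _ hh)
  have hha : h * (h * b * h - l • h) = h * b * h - l • h := by rw [mul_sub, hl, mul_smul_comm, hhh]
  have hah : (h * b * h - l • h) * h = h * b * h - l • h := by rw [sub_mul, hr, smul_mul_assoc, hhh]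
  rw [← sub_eq_zero]
  generalize h * b * h - l • h = a at *
  refine SS hB ⟨h, hNB hh, not_nil_idem hhh h0⟩ a (hNB haN) ?_
  intro d hd
  obtain ⟨l2, hl2⟩ := key _ (hc d hd) (hl d) (hr d)
  have e1 : trace (a * d) = trace (a * (h * d * h)) := by
    rw [trace_mul_comm a (h * d * h), mul_assoc, hha, mul_assoc h, trace_mul_comm h, mul_assoc, hah, trace_mul_comm]
  have haN2 : h * d * h - l2 • h ∈ N := Submodule.sub_mem _ (hc d hd) (Submodule.smul_mem _ _ hh)
  have hha2 : h * (h * d * h - l2 • h) = h * d * h - l2 • h := by rw [mul_sub, hl, mul_smul_comm, hhh]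
  have hah2 : (h * d * h - l2 • h) * h = h * d * h - l2 • h := by rw [sub_mul, hr, smul_mul_assoc, hhh]
  have e2 : h * d * h = (h * d * h - l2 • h) + l2 • h := by abel
  rw [e1, e2]
  generalize h * d * h - l2 • h = c at *
  rw [mul_add, mul_smul_comm, hah, trace_add, trace_smul, tr_nil hl1, smul_zero, add_zero]
  refine tr_nil2 hl1 hl2 (key2 _ (N.add_mem haN haN2) (by rw [mul_add, hha, hha2]) (by rw [add_mul, hah, hah2]) ?_)
  rw [trace_add, tr_nil hl1, tr_nil hl2, add_zero]

def Dg (F : Type*) [Field F] (par : ι → Bool) (α : Bool) : Matrix ι ι F :=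
  diagonal (fun i => if par i = α then 1 else -1)

theorem Dg_ev {α : Bool} {x : Matrix ι ι F} (hx : x ∈ PM F par false) : Dg F par α * x = x * Dg F par α := by
  ext i j
  simp only [Dg, diagonal_mul, mul_diagonal]
  by_cases h : par i = par j
  · rw [h, mul_comm]
  · rw [hx i j (by revert h; cases par i <;> cases par j <;> simp)]; simp

theorem Dg_od {α : Bool} {x : Matrix ι ι F} (hx : x ∈ PM F par true) : Dg F par α * x = - (x * Dg F par α) := by
  ext i j
  simp only [Dg, diagonal_mul, mul_diagonal, Matrix.neg_apply]
  by_cases h : par i = par j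
  · rw [hx i j (by simp [h])]; simp
  · revert h; cases par i <;> cases par j <;> cases α <;> simp

theorem self_neg {V : Type*} [AddCommGroup V] [Module F V] {x : V} (h : x = -x) : x = 0 := by
  have h2 : (2 : F) • x = 0 := by rw [two_smul]; nth_rw 1 [h]; simp
  simpa using h2

theorem hxh {α : Bool} {h x : Matrix ι ι F} {ε : F} (hε : ε * ε = 1) (h0 : h ∈ PM F par false) (hx : x ∈ PM F par true)
    (hD : Dg F par α * h = ε • h) : h * x * h = 0 := by
  have hD2 : h * Dg F par α = ε • h := by rw [← Dg_ev h0, hD]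
  apply self_neg (F := F)
  have e1 : h = ε • (h * Dg F par α) := by rw [hD2, smul_smul, hε, one_smul]
  calc h * x * h = (ε • (h * Dg F par α)) * x * h := by rw [← e1]
    _ = ε • (h * (Dg F par α * x) * h) := by simp only [smul_mul_assoc, mul_assoc]
    _ = ε • -(h * x * (Dg F par α * h)) := by rw [Dg_od hx]; simp only [mul_neg, neg_mul, mul_assoc]
    _ = -(h * x * h) := by rw [hD, mul_smul_comm, smul_neg, smul_smul, hε, one_smul]
theorem str_nd (hB : Sim par B) {α : Bool} {h} (hh : h ∈ B false) (hhh : h * h = h) (h0 : h ≠ 0)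
    (hD : Dg F par α * h = h) : ∀ a, ∀ x ∈ B a, (∀ y ∈ B a, trace (Dg F par α * (x * y)) = 0) → x = 0 := by
  set D := Dg F par α with hDd
  let I : Bool → Submodule F (Matrix ι ι F) := fun a =>
    { carrier := {x | x ∈ B a ∧ ∀ y ∈ B a, trace (D * (x * y)) = 0}
      zero_mem' := by simp
      add_mem' := by
        rintro x y ⟨x1, x2⟩ ⟨y1, y2⟩
        refine ⟨(B a).add_mem x1 y1, fun z hz => ?_⟩
        rw [add_mul, mul_add, trace_add, x2 z hz, y2 z hz, add_zero]
      smul_mem' := by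
        rintro t x ⟨x1, x2⟩
        refine ⟨(B a).smul_mem t x1, fun z hz => ?_⟩
        rw [smul_mul_assoc, mul_smul_comm, trace_smul, x2 z hz, smul_zero] }
  have key := hB.sim I (fun a x hx => hx.1) (by
    intro a b x y hx hy
    refine ⟨hB.mul hx hy.1, fun w hw => ?_⟩
    have h1 : x * w + sg F a (xor a b) • (w * x) ∈ B b := by
      have := hB.mul hx hw; rwa [← Bool.xor_assoc, Bool.xor_self, Bool.false_xor] at this
    have h2 := hy.2 _ h1
    have h3 : trace (D * (y * (w * x))) = trace (x * D * (y * w)) := by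
      rw [show D * (y * (w * x)) = (D * y * w) * x by simp only [mul_assoc], trace_mul_comm]
      simp only [mul_assoc]
    rw [mul_add, mul_smul_comm, mul_add, mul_smul_comm, trace_add, trace_smul, h3] at h2
    have h4 : (x * D = D * x ∧ a = false) ∨ (x * D = -(D * x) ∧ a = true) := by
      cases a
      · left; exact ⟨(Dg_ev (hB.hom _ hx)).symm, rfl⟩
      · right; rw [hDd, Dg_od (hB.hom _ hx), neg_neg]; exact ⟨rfl, rfl⟩
    rw [add_mul, smul_mul_assoc, mul_add, mul_smul_comm, trace_add, trace_smul]
    have e1 : D * (x * y * w) = D * x * (y * w) := by simp only [mul_assoc]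
    have e2 : D * (y * x * w) = D * (y * (x * w)) := by simp only [mul_assoc]
    rw [e1, e2]
    rcases h4 with ⟨h4, rfl⟩ | ⟨h4, rfl⟩
    · rw [h4] at h2; simp only [sg_fl, one_smul] at h2 ⊢; rw [add_comm]; exact h2
    · rw [h4, neg_mul, trace_neg] at h2
      cases b <;> simp [sg] at h2 ⊢ <;> first | linear_combination h2 | linear_combination -h2)
  rcases key with key | key
  · intro a x hx hy
    have : x ∈ I a := ⟨hx, hy⟩
    rw [key a] at this; simpa using this
  · exfalso
    have : h ∈ I false := by rw [key]; exact hh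
    have := this.2 h hh
    rw [hhh, hD, trace_idem hhh] at this
    exact h0 (rank0 (Nat.cast_eq_zero.1 this))

theorem ND (α : Bool) (ε : F) (hB : Sim par B) : ∃ N : Submodule F (Matrix ι ι F),
    (∀ y, y ∈ N ↔ y ∈ B false ∧ Dg F par α * y = ε • y) ∧ N ≤ B false ∧
      ∀ b ∈ B false, ∀ y ∈ N, b * y + y * b ∈ N := by
  refine ⟨{ carrier := {y | y ∈ B false ∧ Dg F par α * y = ε • y}
            zero_mem' := by simp
            add_mem' := by
              rintro x y ⟨x1, x2⟩ ⟨y1, y2⟩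
              exact ⟨(B false).add_mem x1 y1, by rw [mul_add, x2, y2, smul_add]⟩
            smul_mem' := by
              rintro t x ⟨x1, x2⟩
              exact ⟨(B false).smul_mem t x1, by rw [mul_smul_comm, x2, smul_comm]⟩ }, fun y => Iff.rfl, fun y hy => hy.1, ?_⟩
  rintro b hb y ⟨hy, hy2⟩
  refine ⟨hB.m0 (c := false) hb hy, ?_⟩
  rw [mul_add, ← mul_assoc, Dg_ev (hB.hom _ hb), mul_assoc, hy2, ← mul_assoc, hy2, mul_smul_comm, smul_mul_assoc, smul_add]
theorem get_k [IsAlgClosed F] (hB : Sim par B) (hR : ¬ ROI (B false)) {α : Bool} {h} (hh : h ∈ B false)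
    (hhh : h * h = h) (h0 : h ≠ 0) (hD : Dg F par α * h = h) :
    ∃ k ∈ B false, k * k = k ∧ k ≠ 0 ∧ 2 ≤ k.rank ∧ Dg F par α * k = -k ∧
      ∀ b ∈ B false, ∃ l : F, k * b * k = l • k := by
  have hz : ∀ x ∈ B true, h * x * h = 0 := fun x hx =>
    hxh (ε := 1) (by simp) (hB.hom _ hh) (hB.hom _ hx) (by rw [hD, one_smul])
  have hz2 : ∀ x ∈ B true, ∀ z : Matrix ι ι F, h * (x * (h * z)) = 0 := fun x hx z => by
    rw [show h * (x * (h * z)) = (h * x * h) * z by simp only [mul_assoc], hz x hx, zero_mul]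
  obtain ⟨x0, hx0, hx0n⟩ : ∃ x ∈ B true, h * x + x * h ≠ 0 := by
    by_contra! hc
    have c1 : ∀ x ∈ B true, h * x = 0 := by
      intro x hx
      have := congrArg (h * ·) (hc x hx)
      simp only [mul_add, ← mul_assoc, hhh, mul_zero, hz x hx, add_zero] at this
      exact this
    have c2 : ∀ x ∈ B true, x * h = 0 := by
      intro x hx
      have := hc x hx
      rwa [c1 x hx, zero_add] at this
    let I0 : Submodule F (Matrix ι ι F) :=
      { carrier := {a | a ∈ B false ∧ ∀ x ∈ B true, a * x = 0 ∧ x * a = 0}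
        zero_mem' := by simp
        add_mem' := by
          rintro a b ⟨a1, a2⟩ ⟨b1, b2⟩
          refine ⟨(B false).add_mem a1 b1, fun x hx => ?_⟩
          rw [add_mul, mul_add, (a2 x hx).1, (a2 x hx).2, (b2 x hx).1, (b2 x hx).2]; simp
        smul_mem' := by
          rintro t a ⟨a1, a2⟩
          refine ⟨(B false).smul_mem t a1, fun x hx => ?_⟩
          rw [smul_mul_assoc, mul_smul_comm, (a2 x hx).1, (a2 x hx).2]; simp }
    have key := hB.sim (fun a => if a then ⊥ else I0) (by
      intro a; cases a
      · exact fun x hx => hx.1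
      · simp) (by
      intro a b x y hx hy
      cases b
      · simp only [Bool.false_eq_true, if_false] at hy
        cases a
        · simp only [sg_fl, one_smul, Bool.xor_false, Bool.false_eq_true, if_false]
          refine ⟨hB.m0 (c := false) hx hy.1, fun z hz => ?_⟩
          have h5 := hy.2 _ (hB.m0 (c := true) hx hz)
          have h6 := hy.2 z hz
          simp only [mul_add, add_mul, ← mul_assoc, h6.1, zero_mul, add_zero] at h5
          have h5b := h5.2
          rw [mul_assoc x z, h6.2, mul_zero, zero_add] at h5b
          constructor
          · rw [add_mul, mul_assoc, h6.1, mul_zero, zero_add, h5.1]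
          · rw [mul_add, ← mul_assoc, ← mul_assoc, h5b, h6.2, zero_mul, add_zero]
        · simp [(hy.2 x hx).1, (hy.2 x hx).2]
      · have : y = 0 := by simpa using hy
        rw [this]; simp)
    rcases key with key | key
    · have : h ∈ I0 := ⟨hh, fun x hx => ⟨c1 x hx, c2 x hx⟩⟩
      have k2 := key false
      simp only [Bool.false_eq_true, if_false] at k2
      rw [k2] at this
      exact h0 (by simpa using this)
    · have k2 := key true
      simp only [if_true] at k2
      exact hB.nt k2.symm
  have hT : ∀ x ∈ B true, h * (h * x + x * h) + (h * x + x * h) * h = h * x + x * h := by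
    intro x hx
    have : h * (h * x + x * h) + (h * x + x * h) * h = h * h * x + h * x * h + (h * x * h + x * (h * h)) := by noncomm_ring
    rw [this, hhh, hz x hx]; simp
  have hx1 := hB.m0 (c := true) hh hx0
  have hx2 := hT x0 hx0
  obtain ⟨x, hxd⟩ : ∃ x, x = h * x0 + x0 * h := ⟨_, rfl⟩
  rw [← hxd] at hx1 hx2 hx0n
  obtain ⟨y0, hy0, hxy⟩ : ∃ y ∈ B true, trace (Dg F par α * (x * y)) ≠ 0 := by
    by_contra! hc
    exact hx0n (str_nd hB hh hhh h0 hD true x hx1 hc)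
  have hDh : h * Dg F par α = h := by rw [← Dg_ev (hB.hom _ hh), hD]
  have hy1 := hB.m0 (c := true) hh hy0
  have hy2 := hT y0 hy0
  have hxy2 : trace (Dg F par α * (x * (h * y0 + y0 * h))) ≠ 0 := by
    convert hxy using 1
    conv_rhs => rw [← hx2]
    rw [mul_add, add_mul, mul_add, mul_add, trace_add, trace_add, add_comm]
    congr 1
    · rw [show Dg F par α * (x * (y0 * h)) = (Dg F par α * (x * y0)) * h by simp only [mul_assoc], trace_mul_comm,
        ← mul_assoc, hDh, show Dg F par α * (h * x * y0) = Dg F par α * h * (x * y0) by simp only [mul_assoc], hD]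
    · simp only [mul_assoc]
  generalize h * y0 + y0 * h = y at *
  have exy : ∀ x y, x ∈ B true → h * x + x * h = x → y ∈ B true → h * y + y * h = y → x * y = h * (x * y) * h + x * h * y := by
    intro x y hx e1 hy e2
    have h1 : h * x = h * x * (1 - h) := by rw [mul_sub, hz x hx]; simp
    have h3 : x * y = h * x * y + x * h * y := by nth_rw 1 [← e1]; rw [add_mul]
    have h4 : h * x * y = h * x * (h * y) + h * x * (y * h) := by rw [← mul_add, e2]
    have h5 : h * x * (h * y) = 0 := by rw [← mul_assoc, hz x hx, zero_mul]
    rw [h3, h4, h5, zero_add, mul_add, add_mul]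
    have : h * (x * h * y) * h = 0 := by
      rw [show h * (x * h * y) * h = (h * x * h) * (y * h) by simp only [mul_assoc], hz x hx, zero_mul]
    rw [this, add_zero]
    have h6 : h * (h * x * (y * h)) * h = h * h * x * (y * (h * h)) := by simp only [mul_assoc]
    rw [h6, hhh]
  have q1 : x * h * y - y * h * x ∈ B false := by
    have := hB.m11 hx1 hy1
    have t := hB.t (c := false) hh this
    have e := Submodule.sub_mem _ this t
    convert e using 1
    rw [mul_sub, sub_mul]
    nth_rw 1 [exy x y hx1 hx2 hy1 hy2]
    nth_rw 1 [exy y x hy1 hy2 hx1 hx2]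
    abel
  have hDq : ∀ x y : Matrix ι ι F, x ∈ B true → Dg F par α * (x * h * y) = - (x * h * y) := by
    intro x y hx
    rw [← mul_assoc, ← mul_assoc, Dg_od (hB.hom _ hx), neg_mul, mul_assoc x, hD, neg_mul]
  have q2 : Dg F par α * (x * h * y - y * h * x) = (-1 : F) • (x * h * y - y * h * x) := by
    rw [mul_sub, hDq x y hx1, hDq y x hy1, neg_one_smul]; abel
  have q3 : ¬ IsNilpotent (x * h * y - y * h * x) := by
    intro hn
    have h1 := tr_nil hn
    apply hxy2
    rw [exy x y hx1 hx2 hy1 hy2, mul_add, hDq x y hx1, trace_add, trace_neg, ← mul_assoc, ← mul_assoc, hD]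
    rw [trace_sub] at h1
    have : trace (h * (x * y) * h) = trace (y * h * x) := by
      rw [trace_mul_comm, ← mul_assoc, hhh, ← mul_assoc, trace_mul_comm, ← mul_assoc]
    rw [this]; linear_combination -h1
  obtain ⟨N, hN1, hN2, hN3⟩ := ND α (-1 : F) hB
  obtain ⟨k, a1, a2, a3, a4, a5⟩ := ML hB hR hN2 hN3 ((hN1 _).2 ⟨q1, q2⟩) q3
  exact ⟨k, hN2 a1, a2, a3, a4, by rw [((hN1 _).1 a1).2, neg_one_smul], a5⟩


theorem dimS (hB : Alg par B) (hR : ¬ ROI (B false)) {α : Bool} {e : Matrix ι ι F} (he : e ∈ PM F par false) (hee : e * e = e)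
    {r s : ℕ} (hr : 2 ≤ r) (hs : 2 ≤ s) (t1 : trace (e + e * Dg F par α) = 2 * (r : F)) (t2 : trace (e - e * Dg F par α) = 2 * (s : F))
    (hd : dP par true ≤ 2 * finrank F (B true)) : 4 ≤ finrank F ((B true).map (conjL e e)) := by
  obtain ⟨Q, hQ, P, hP, S, hPQ, hQP, hdg, -⟩ := DIAG (par := par) _ ∅ e le_rfl he hee (by simp)
  have tr : ∀ x : Matrix ι ι F, trace (P * x * Q) = trace x := fun x => by
    rw [trace_mul_comm, ← mul_assoc, hQP, one_mul]
  have tD : P * (e * Dg F par α) * Q = (P * e * Q) * Dg F par α := by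
    rw [mul_assoc, mul_assoc, Dg_ev hQ]; simp only [mul_assoc]
  have cnt : ∀ β, 2 ≤ (S.filter (fun i => par i = β)).card := by
    intro β
    have c1 : ((S.filter (fun i => par i = α)).card : F) = r := by
      rw [← tr, mul_add, add_mul, tD, hdg] at t1
      have : trace (diagonal (fun i => if i ∈ S then (1 : F) else 0) + diagonal (fun i => if i ∈ S then (1 : F) else 0) * Dg F par α)
          = 2 * ((S.filter (fun i => par i = α)).card : F) := by
        rw [Dg, diagonal_mul_diagonal, diagonal_add, trace_diagonal, Finset.card_eq_sum_ones, Finset.sum_filter, Nat.cast_sum, Finset.mul_sum,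
          ← Finset.sum_subset (Finset.subset_univ S) (by intro i _ hi; simp [hi])]
        refine Finset.sum_congr rfl fun i hi => ?_
        by_cases h : par i = α <;> simp [h, hi] <;> norm_num
      rw [this] at t1
      exact mul_left_cancel₀ two_ne_zero t1
    have c2 : ((S.filter (fun i => par i = !α)).card : F) = s := by
      rw [← tr, mul_sub, sub_mul, tD, hdg] at t2
      have : trace (diagonal (fun i => if i ∈ S then (1 : F) else 0) - diagonal (fun i => if i ∈ S then (1 : F) else 0) * Dg F par α)
          = 2 * ((S.filter (fun i => par i = !α)).card : F) := by
        rw [Dg, diagonal_mul_diagonal, diagonal_sub, trace_diagonal, Finset.card_eq_sum_ones, Finset.sum_filter, Nat.cast_sum, Finset.mul_sum,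
          ← Finset.sum_subset (Finset.subset_univ S) (by intro i _ hi; simp [hi])]
        refine Finset.sum_congr rfl fun i hi => ?_
        cases hpi : par i <;> cases α <;> simp [hi, hpi] <;> norm_num
      rw [this] at t2
      exact mul_left_cancel₀ two_ne_zero t2
    have c1 := Nat.cast_injective c1
    have c2 := Nat.cast_injective c2
    rcases Bool.eq_or_eq_not β α with rfl | rfl <;> omega
  have cntS : 4 ≤ S.card := by
    have := Finset.card_filter_add_card_filter_not (s := S) (fun i => par i = true)
    have h1 := cnt true
    have h2 := cnt false
    simp only [Bool.not_eq_true] at this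
    omega
  let Ω : ι → Finset ι := fun i => (sP par true i).filter (fun j => ¬ (i ∈ S ∧ j ∈ S))
  have hΩ : ∑ i, (Ω i).card + 8 ≤ dP par true := by
    have e1 : dP par true = ∑ i, ((sP par true i).filter (fun j => i ∈ S ∧ j ∈ S)).card + ∑ i, (Ω i).card := by
      rw [dP, ← Finset.sum_add_distrib]
      exact Finset.sum_congr rfl fun i _ => (Finset.card_filter_add_card_filter_not _).symm
    have e2 : ∑ i ∈ S, 2 ≤ ∑ i ∈ S, ((sP par true i).filter (fun j => i ∈ S ∧ j ∈ S)).card := by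
      refine Finset.sum_le_sum fun i hi => (cnt (!par i)).trans (Finset.card_le_card ?_)
      intro j hj
      rw [Finset.mem_filter] at hj
      simp only [Finset.mem_filter, mem_sP, hj.2]
      exact ⟨by cases par i <;> rfl, hi, hj.1⟩
    have e3 := Finset.sum_le_sum_of_subset (f := fun i => ((sP par true i).filter (fun j => i ∈ S ∧ j ∈ S)).card) (Finset.subset_univ S)
    simp only [Finset.sum_const, smul_eq_mul] at e2
    omega
  have hk := finrank_map_ker (conjL e e) (B true)
  have hk2 : 2 * finrank F (B true ⊓ LinearMap.ker (conjL e e) : Submodule F _) ≤ ∑ i, (Ω i).card := by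
    by_contra hlt
    push Not at hlt
    apply hR
    apply ROI.conj hQP
    refine E1odd (Alg.conj hB hP hQ hQP) (S := (B true ⊓ LinearMap.ker (conjL e e)).map (conjL P Q)) ?_ Ω ?_ ?_ ?_
    · exact Submodule.map_mono inf_le_left
    · intro i j; simp only [Ω, Finset.mem_filter, mem_sP]
      rw [Bool.xor_comm, and_comm (a := i ∈ S)]; exact id
    · rintro _ ⟨x, ⟨hx1, hx2⟩, rfl⟩ i j hij
      have hodd : P * x * Q ∈ PM F par true := by
        have := PM_mul (PM_mul hP (hB.hom _ hx1)) hQ; simpa using this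
      change (P * x * Q) i j = 0
      by_cases hp : xor (par i) (par j) = true
      · simp only [Ω, Finset.mem_filter, mem_sP, hp, true_and, not_not] at hij
        have hx3 : e * x * e = 0 := hx2
        have : (P * e * Q) * (P * x * Q) * (P * e * Q) = 0 := by
          rw [show (P * e * Q) * (P * x * Q) * (P * e * Q) = P * e * (Q * P) * x * (Q * P) * e * Q by simp only [mul_assoc],
            hQP, mul_one, mul_one, show P * e * x * e * Q = P * (e * x * e) * Q by simp only [mul_assoc], hx3]; simp
        rw [hdg] at this
        have := congrFun (congrFun this i) j
        simpa [diagonal_mul, mul_diagonal, hij.1, hij.2] using this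
      · exact hodd i j hp
    · rw [finrank_map_inj]
      · exact hlt
      · intro x _ h
        have h : P * x * Q = 0 := h
        have : Q * (P * x * Q) * P = 0 := by rw [h]; simp
        rw [show Q * (P * x * Q) * P = (Q * P) * x * (Q * P) by simp only [mul_assoc], hQP] at this
        simpa using this
  omega

theorem S4core [IsAlgClosed F] (hB : Sim par B) (hR : ¬ ROI (B false)) {α : Bool} {h} (hh : h ∈ B false)
    (hhh : h * h = h) (h0 : h ≠ 0) (hD : Dg F par α * h = h) (hr : 2 ≤ h.rank)
    (hl : ∀ b ∈ B false, ∃ l : F, h * b * h = l • h) (hd : dP par true ≤ 2 * finrank F (B true)) : False := by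
  obtain ⟨k, hk, kk, k0, ks, kD, kl⟩ := get_k hB hR hh hhh h0 hD
  have hDh : h * Dg F par α = h := by rw [← Dg_ev (hB.hom _ hh), hD]
  have kDk : k * Dg F par α = -k := by rw [← Dg_ev (hB.hom _ hk), kD]
  have hk0 : h * k = 0 := by
    apply self_neg (F := F)
    nth_rw 1 [← hDh]
    rw [mul_assoc, kD, mul_neg]
  have kh0 : k * h = 0 := by
    apply self_neg (F := F)
    nth_rw 1 [← hD]
    rw [← mul_assoc, kDk, neg_mul]
  have th := trace_idem hhh
  have tk := trace_idem kk
  have hrF : (h.rank : F) ≠ 0 := by rw [Nat.cast_ne_zero]; omega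
  have hee : (h + k) * (h + k) = h + k := by simp only [mul_add, add_mul, hhh, kk, hk0, kh0]; abel
  have heB : h + k ∈ B false := (B false).add_mem hh hk
  have hdim := dimS hB.toAlg hR (hB.hom _ heB) hee hr ks (α := α)
    (by rw [add_mul, hDh, kDk, ← th, trace_add, trace_add, trace_add, trace_neg]; ring)
    (by rw [add_mul, hDh, kDk, ← tk, trace_sub, trace_add, trace_add, trace_neg]; ring) hd
  have hz : ∀ x ∈ B true, h * x * h = 0 := fun x hx =>
    hxh (ε := 1) (by simp) (hB.hom _ hh) (hB.hom _ hx) (by rw [hD, one_smul])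
  have kz : ∀ x ∈ B true, k * x * k = 0 := fun x hx =>
    hxh (ε := -1) (by simp) (hB.hom _ hk) (hB.hom _ hx) (by rw [kD, neg_one_smul])
  set S := (B true).map (conjL (h + k) (h + k)) with hS
  have hSB : ∀ x ∈ S, x ∈ B true ∧ x = h * x * k + k * x * h := by
    rintro _ ⟨x, hx, rfl⟩
    change (h + k) * x * (h + k) ∈ B true ∧ (h + k) * x * (h + k) = h * ((h + k) * x * (h + k)) * k + k * ((h + k) * x * (h + k)) * h
    refine ⟨hB.t (c := true) heB hx, ?_⟩
    have e1 : h * ((h + k) * x * (h + k)) * k = h * x * k := by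
      rw [show h * ((h + k) * x * (h + k)) * k = (h * h + h * k) * x * (h * k + k * k) by noncomm_ring, hhh, hk0, kk]; simp
    have e2 : k * ((h + k) * x * (h + k)) * h = k * x * h := by
      rw [show k * ((h + k) * x * (h + k)) * h = (k * h + k * k) * x * (h * h + k * h) by noncomm_ring, hhh, kh0, kk]; simp
    rw [e1, e2, show (h + k) * x * (h + k) = h * x * h + k * x * k + (h * x * k + k * x * h) by noncomm_ring, hz x hx, kz x hx]; simp
  have s1 : ∀ x ∈ S, h * x = x * k := by
    intro x hx
    have := (hSB x hx).2
    rw [this, mul_add, add_mul, ← mul_assoc, ← mul_assoc, hhh, ← mul_assoc, ← mul_assoc, hk0, mul_assoc (h * x), kk, mul_assoc (k * x), hk0]; simp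
  have s2 : ∀ x ∈ S, x * h = k * x := by
    intro x hx
    have := (hSB x hx).2
    rw [this, mul_add, add_mul, ← mul_assoc, ← mul_assoc, kh0, ← mul_assoc, ← mul_assoc, kk, mul_assoc (h * x), kh0, mul_assoc (k * x), hhh]; simp
  have s3 : ∀ x ∈ S, x = h * x + k * x := by
    intro x hx
    nth_rw 1 [(hSB x hx).2]
    rw [s1 x hx, mul_assoc, kk, mul_assoc k, s2 x hx, ← mul_assoc, kk]
  have br : ∀ x ∈ S, ∀ y ∈ S, ∃ l m : F, x * y - y * x = l • h + m • k ∧ l * (h.rank : F) + m * (k.rank : F) = 0 ∧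
      trace (Dg F par α * (x * y)) = l * (h.rank : F) := by
    intro x hx y hy
    have hc := hB.m11 (hSB x hx).1 (hSB y hy).1
    obtain ⟨l, hl⟩ := hl _ hc
    obtain ⟨m, hm⟩ := kl _ hc
    have c1 : ∀ x ∈ S, ∀ y ∈ S, x * y = h * (x * y) * h + k * (x * y) * k := by
      intro x hx y hy
      have e1 : h * (x * y) * h = h * (x * y) := by
        rw [mul_assoc, mul_assoc, s2 y hy, ← mul_assoc x, ← s1 x hx, ← mul_assoc, ← mul_assoc, hhh]; simp only [mul_assoc]
      have e2 : k * (x * y) * k = k * (x * y) := by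
        rw [mul_assoc, mul_assoc, ← s1 y hy, ← mul_assoc x, s2 x hx, ← mul_assoc, ← mul_assoc, kk]; simp only [mul_assoc]
      rw [e1, e2, ← mul_assoc, ← mul_assoc, ← add_mul, ← s3 x hx]
    have e0 : x * y - y * x = l • h + m • k := by
      rw [← hl, ← hm]
      nth_rw 1 [c1 x hx y hy]
      nth_rw 1 [c1 y hy x hx]
      simp only [mul_sub, sub_mul]; abel
    have e1 : l * (h.rank : F) + m * (k.rank : F) = 0 := by
      have := congrArg trace e0
      rw [trace_sub, trace_mul_comm y x, sub_self, trace_add, trace_smul, trace_smul, th, tk] at this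
      exact this.symm
    refine ⟨l, m, e0, e1, ?_⟩
    have := congrArg (fun z => trace (Dg F par α * z)) e0
    simp only [mul_sub, mul_add, mul_smul_comm, hD, kD, trace_sub, trace_add, trace_smul, trace_neg, th, tk] at this
    have e2 : trace (Dg F par α * (y * x)) = - trace (Dg F par α * (x * y)) := by
      rw [← mul_assoc, trace_mul_comm, ← mul_assoc]
      have : x * Dg F par α = - (Dg F par α * x) := by rw [Dg_od (hB.hom _ (hSB x hx).1), neg_neg]
      rw [this, neg_mul, trace_neg, mul_assoc]
    rw [e2] at this
    have e3 : (2 : F) * trace (Dg F par α * (x * y)) = 2 * (l * (h.rank : F)) := by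
      simp only [smul_eq_mul] at this
      linear_combination this - e1
    exact mul_left_cancel₀ two_ne_zero e3
  obtain ⟨x, hx, hx0⟩ : ∃ x ∈ S, x ≠ 0 := by
    apply Submodule.exists_mem_ne_zero_of_ne_bot
    intro hb; rw [hb, finrank_bot] at hdim; omega
  obtain ⟨y, hy, hxy⟩ : ∃ y ∈ S, trace (Dg F par α * (x * y)) ≠ 0 := by
    by_contra! hc
    apply hx0
    refine str_nd hB hh hhh h0 hD true x (hSB x hx).1 fun y hy => ?_
    have := hc _ ⟨y, hy, rfl⟩
    change trace (Dg F par α * (x * ((h + k) * y * (h + k)))) = 0 at this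
    rw [show Dg F par α * (x * ((h + k) * y * (h + k))) = (Dg F par α * (x * (h + k) * y)) * (h + k) by simp only [mul_assoc],
      trace_mul_comm, ← mul_assoc, ← Dg_ev (hB.hom _ heB), mul_add x, s2 x hx, ← s1 x hx, add_comm (k * x), ← s3 x hx,
      mul_assoc, ← mul_assoc (h + k), add_mul h, ← s3 x hx] at this
    exact this
  let f : Matrix ι ι F →ₗ[F] F × F :=
    { toFun := fun w => (trace (Dg F par α * (w * x)), trace (Dg F par α * (w * y)))
      map_add' := by intro a b; simp [mul_add, add_mul]
      map_smul' := by intro a b; simp }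
  have hker : S ⊓ LinearMap.ker f ≠ ⊥ := by
    intro hb
    have h1 := finrank_map_ker f S
    rw [hb, finrank_bot] at h1
    have h2 := Submodule.finrank_le (S.map f)
    rw [finrank_prod, finrank_self] at h2
    omega
  obtain ⟨w, ⟨hw, hw2⟩, hw0⟩ := Submodule.exists_mem_ne_zero_of_ne_bot hker
  have hw2 : (trace (Dg F par α * (w * x)), trace (Dg F par α * (w * y))) = ((0 : F), (0 : F)) := hw2
  obtain ⟨hwx, hwy⟩ := Prod.mk.inj hw2
  have hkF : (k.rank : F) ≠ 0 := by rw [Nat.cast_ne_zero]; omega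
  have com : ∀ x ∈ S, trace (Dg F par α * (w * x)) = 0 → w * x = x * w := by
    intro x hx h1
    obtain ⟨l, m, a1, a2, a3⟩ := br w hw x hx
    rw [h1] at a3
    have l0 : l = 0 := by
      rcases mul_eq_zero.1 a3.symm with h | h
      · exact h
      · exact absurd h hrF
    rw [l0, zero_mul, zero_add] at a2
    have m0 : m = 0 := by
      rcases mul_eq_zero.1 a2 with h | h
      · exact h
      · exact absurd h hkF
    rw [l0, m0, zero_smul, zero_smul, add_zero] at a1
    exact sub_eq_zero.1 a1
  have cx := com x hx hwx
  have cy := com y hy hwy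
  obtain ⟨l, m, a1, a2, a3⟩ := br x hx y hy
  have cc : w * (x * y - y * x) = (x * y - y * x) * w := by
    rw [mul_sub, sub_mul, ← mul_assoc, cx, mul_assoc, cy, ← mul_assoc w y, cy, mul_assoc y w, cx]; simp only [mul_assoc]
  rw [a1, mul_add, add_mul, mul_smul_comm, mul_smul_comm, smul_mul_assoc, smul_mul_assoc, s2 w hw, ← s1 w hw] at cc
  have z1 : (l - m) • (k * w) = 0 := by
    have := congrArg (k * ·) cc
    simp only [mul_add, mul_smul_comm, ← mul_assoc, kk, kh0, zero_mul, smul_zero, add_zero, zero_add] at this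
    rw [sub_smul, this, sub_self]
  have z2 : (l - m) • (h * w) = 0 := by
    have := congrArg (h * ·) cc
    simp only [mul_add, mul_smul_comm, ← mul_assoc, hhh, hk0, zero_mul, smul_zero, add_zero, zero_add] at this
    rw [sub_smul, this, sub_self]
  have z3 : (l - m) • w = 0 := by
    rw [s3 w hw, smul_add, z1, z2, add_zero]
  have lm : l - m = 0 := by
    rcases smul_eq_zero.1 z3 with h | h
    · exact h
    · exact absurd h hw0
  have : l * ((h.rank + k.rank : ℕ) : F) = 0 := by push_cast; linear_combination a2 + (k.rank : F) * lm
  rcases mul_eq_zero.1 this with h | h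
  · rw [h, zero_mul] at a3; exact hxy a3
  · rw [Nat.cast_eq_zero] at h; omega


theorem PM_of_Dg {α : Bool} {x : Matrix ι ι F} (h : Dg F par α * x = x * Dg F par α) : x ∈ PM F par false := by
  intro i j hij
  have := congrFun (congrFun h i) j
  simp only [Dg, diagonal_mul, mul_diagonal] at this
  apply self_neg (F := F)
  revert this hij
  cases par i <;> cases par j <;> cases α <;> simp <;> intro h <;> first | exact h | exact h.symm

theorem SY_ev {α : Bool} {x : Matrix ι ι F} (hx : x ∈ PM F par false) : x ∈ SY F par α ↔ xᵀ = Dg F par α * x := by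
  have : ∀ i j, (sg F (xor (par i) α) (xor (par j) α) * x i j = (Dg F par α * x) i j) := by
    intro i j
    simp only [Dg, diagonal_mul]
    by_cases h : par i = par j
    · rw [h]; cases par j <;> cases α <;> simp [sg]
    · rw [hx i j (by revert h; cases par i <;> cases par j <;> simp)]; simp
  constructor
  · intro h; ext i j; rw [transpose_apply, h i j, this]
  · intro h i j; rw [this, ← h, transpose_apply]

theorem Dg_sq (α : Bool) : Dg F par α * Dg F par α = 1 := by
  rw [Dg, diagonal_mul_diagonal, ← diagonal_one]; congr 1; ext i; split_ifs <;> simp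

theorem inv_sy {α : Bool} {G H : Matrix ι ι F} (hG : G ∈ PM F par false) (hS : G ∈ SY F par α) (hHG : H * G = 1) :
    H ∈ PM F par false ∧ H ∈ SY F par α := by
  have hGH := mul_eq_one_comm.1 hHG
  have h1 : H ∈ PM F par false := by
    apply PM_of_Dg (α := α)
    calc Dg F par α * H = H * G * (Dg F par α * H) := by rw [hHG, one_mul]
      _ = H * (G * Dg F par α) * H := by simp only [mul_assoc]
      _ = H * (Dg F par α * G) * H := by rw [Dg_ev hG]
      _ = H * Dg F par α * (G * H) := by simp only [mul_assoc]
      _ = _ := by rw [hGH, mul_one]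
  refine ⟨h1, (SY_ev h1).2 ?_⟩
  have h2 : Hᵀ * Gᵀ = 1 := by rw [← transpose_mul, hGH, transpose_one]
  rw [(SY_ev hG).1 hS] at h2
  calc Hᵀ = Hᵀ * (Dg F par α * G) * (H * Dg F par α) := by
        rw [show Hᵀ * (Dg F par α * G) * (H * Dg F par α) = Hᵀ * Dg F par α * (G * H) * Dg F par α by simp only [mul_assoc], hGH,
          mul_one, mul_assoc, Dg_sq, mul_one]
    _ = _ := by rw [h2, one_mul, Dg_ev h1]

theorem TII.inv {α : Bool} {G : Matrix ι ι F} (hA : TII par A α 1 G) :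
    ∃ H ∈ PM F par false, H ∈ SY F par α ∧ H * G = 1 ∧ G * H = 1 := by
  have hu : IsUnit G := by
    rw [← Matrix.vecMul_injective_iff_isUnit]
    intro v w hvw
    have := hA.inj (v - w) (by rw [sub_vecMul]; exact sub_eq_zero.2 hvw)
    rw [one_mulVec] at this
    exact sub_eq_zero.1 this
  obtain ⟨u, hu⟩ := hu
  have h1 : (↑u⁻¹ : Matrix ι ι F) * G = 1 := by rw [← hu]; simp
  have h2 := inv_sy hA.hG hA.GS h1
  exact ⟨_, h2.1, h2.2, h1, mul_eq_one_comm.1 h1⟩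

theorem TII.mem1 {α : Bool} {G : Matrix ι ι F} (hA : TII par A α 1 G) {a x} :
    x ∈ A a ↔ ∃ X ∈ PM F par a, X ∈ SY F par α ∧ x = X * G := by
  rw [hA.mem]; simp

theorem maskdim (T : ι → Finset ι) (S : Submodule F (Matrix ι ι F))
    (hS : ∀ x ∈ S, (∀ i, ∀ j ∈ T i, x i j = 0) → x = 0) : finrank F S ≤ ∑ i, (T i).card := by
  let f : Matrix ι ι F →ₗ[F] ((Σ i, T i) → F) :=
    { toFun := fun x k => x k.1 k.2
      map_add' := fun _ _ => rfl
      map_smul' := fun _ _ => rfl }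
  rw [← finrank_map_inj f S]
  · have := Submodule.finrank_le (S.map f)
    rw [finrank_fintype_fun_eq_card, Fintype.card_sigma] at this
    simpa using this
  · intro x hx hf
    exact hS x hx fun i j hj => congrFun hf (⟨i, j, hj⟩ : Σ i, T i)
def nP (par : ι → Bool) (β : Bool) : ℕ := (Finset.univ.filter (fun i => par i = β)).card

theorem sum_blk (α : Bool) (c d : ℕ) :
    ∑ i, (if par i = α then c else d) = nP par α * c + nP par (!α) * d := by
  rw [Finset.sum_ite, Finset.sum_const, Finset.sum_const, nP, nP, smul_eq_mul, smul_eq_mul]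
  congr 3; ext i; cases par i <;> cases α <;> simp

theorem dP_eq (α : Bool) : dP par false = nP par α * nP par α + nP par (!α) * nP par (!α) := by
  rw [dP, ← sum_blk α]
  refine Finset.sum_congr rfl fun i _ => ?_
  by_cases h : par i = α
  · rw [if_pos h, nP]; congr 1; ext j; rw [mem_sP, h]; cases hj : par j <;> cases α <;> simp [hj]
  · rw [if_neg h, nP]; congr 1; ext j; rw [mem_sP]; revert h; cases hi : par i <;> cases hj : par j <;> cases α <;> simp [hj]

theorem dimSY1 (α : Bool) : 2 * finrank F (PM F par true ⊓ SY F par α : Submodule F _) ≤ dP par true := by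
  have h1 : ∀ β, finrank F (PM F par true ⊓ SY F par α : Submodule F _) ≤ ∑ i, (if par i = β then sP par true i else ∅).card := by
    intro β
    refine maskdim _ _ ?_
    rintro x ⟨hx, hy⟩ h0
    have h2 : ∀ i j, par i = β → x i j = 0 := by
      intro i j hi
      by_cases hp : xor (par i) (par j) = true
      · exact h0 i j (by rw [if_pos hi, mem_sP]; exact hp)
      · exact hx i j hp
    ext i j
    by_cases hi : par i = β
    · exact h2 i j hi
    · by_cases hj : par j = β
      · have := hy j i; rw [this, h2 j i hj]; simp
      · exact hx i j (by revert hi hj; cases par i <;> cases par j <;> cases β <;> simp)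
  have e : dP par true = ∑ i, (if par i = true then sP par true i else ∅).card + ∑ i, (if par i = false then sP par true i else ∅).card := by
    rw [dP, ← Finset.sum_add_distrib]
    refine Finset.sum_congr rfl fun i _ => ?_
    cases par i <;> simp
  have := h1 true; have := h1 false
  omega

theorem dimSY0 (α : Bool) :
    2 * finrank F (PM F par false ⊓ SY F par α : Submodule F _) + nP par (!α) ≤ dP par false + nP par α := by
  let r := Fintype.equivFin ι
  let T1 : ι → Finset ι := fun i => (sP par false i).filter (fun j => r i < r j ∨ (i = j ∧ par i = α))
  let T2 : ι → Finset ι := fun i => (sP par false i).filter (fun j => r j < r i ∨ (i = j ∧ par i = α))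
  have hdiag : ∀ x ∈ SY F par α, ∀ i, par i ≠ α → x i i = 0 := by
    intro x hx i hi
    apply self_neg (F := F)
    have := hx i i
    revert hi this; cases par i <;> cases α <;> simp [sg] <;> exact fun h => h
  have h1 : finrank F (PM F par false ⊓ SY F par α : Submodule F _) ≤ ∑ i, (T1 i).card := by
    refine maskdim _ _ ?_
    rintro x ⟨hx, hy⟩ h0
    have h2 : ∀ i j, r i < r j → x i j = 0 := by
      intro i j hij
      by_cases hp : xor (par i) (par j) = false
      · exact h0 i j (by simp only [T1, Finset.mem_filter, mem_sP]; exact ⟨hp, Or.inl hij⟩)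
      · exact hx i j hp
    ext i j
    rcases lt_trichotomy (r i) (r j) with h | h | h
    · exact h2 i j h
    · have := r.injective h; subst this
      by_cases hi : par i = α
      · exact h0 i i (by simp only [T1, Finset.mem_filter, mem_sP]; simp [hi])
      · exact hdiag x hy i hi
    · rw [hy j i, h2 j i h]; simp
  have h1b : finrank F (PM F par false ⊓ SY F par α : Submodule F _) ≤ ∑ i, (T2 i).card := by
    refine maskdim _ _ ?_
    rintro x ⟨hx, hy⟩ h0
    have h2 : ∀ i j, r j < r i → x i j = 0 := by
      intro i j hij
      by_cases hp : xor (par i) (par j) = false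
      · exact h0 i j (by simp only [T2, Finset.mem_filter, mem_sP]; exact ⟨hp, Or.inl hij⟩)
      · exact hx i j hp
    ext i j
    rcases lt_trichotomy (r i) (r j) with h | h | h
    · rw [hy j i, h2 j i h]; simp
    · have := r.injective h; subst this
      by_cases hi : par i = α
      · exact h0 i i (by simp only [T2, Finset.mem_filter, mem_sP]; simp [hi])
      · exact hdiag x hy i hi
    · exact h2 i j h
  have h3 : ∀ i, (T1 i).card + (T2 i).card + (if par i = α then 0 else 1) = (sP par false i).card + (if par i = α then 1 else 0) := by
    intro i
    rw [← Finset.card_union_add_card_inter]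
    have hi : i ∈ sP par false i := by rw [mem_sP]; simp
    by_cases h : par i = α
    · have u : T1 i ∪ T2 i = sP par false i := by
        ext j; simp only [T1, T2, Finset.mem_union, Finset.mem_filter, ← and_or_left]
        refine ⟨fun h => h.1, fun hj => ⟨hj, ?_⟩⟩
        rcases lt_trichotomy (r i) (r j) with h1 | h1 | h1
        · exact Or.inl (Or.inl h1)
        · exact Or.inl (Or.inr ⟨r.injective h1, h⟩)
        · exact Or.inr (Or.inl h1)
      have v : T1 i ∩ T2 i = {i} := by
        ext j; simp only [T1, T2, Finset.mem_inter, Finset.mem_filter, Finset.mem_singleton]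
        constructor
        · rintro ⟨⟨-, a | a⟩, -, b | b⟩
          · exact absurd (a.trans b) (lt_irrefl _)
          · exact b.1.symm
          · exact a.1.symm
          · exact a.1.symm
        · rintro rfl; exact ⟨⟨hi, Or.inr ⟨rfl, h⟩⟩, hi, Or.inr ⟨rfl, h⟩⟩
      rw [u, v, if_pos h, if_pos h]; simp
    · have u : T1 i ∪ T2 i = (sP par false i).erase i := by
        ext j; simp only [T1, T2, Finset.mem_union, Finset.mem_filter, ← and_or_left, Finset.mem_erase, h, and_false, or_false]
        constructor
        · rintro ⟨h1, h2⟩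
          refine ⟨?_, h1⟩
          rintro rfl; simp at h2
        · rintro ⟨h1, h2⟩
          exact ⟨h2, lt_or_gt_of_ne (fun h => h1 (r.injective h).symm)⟩
      have v : T1 i ∩ T2 i = ∅ := by
        ext j; simp only [T1, T2, Finset.mem_inter, Finset.mem_filter, h, and_false, or_false, Finset.notMem_empty, iff_false]
        rintro ⟨⟨-, a⟩, -, b⟩
        exact absurd (a.trans b) (lt_irrefl _)
      rw [u, v, if_neg h, if_neg h, Finset.card_erase_of_mem hi]
      have := Finset.card_pos.2 ⟨i, hi⟩
      simp; omega
  have h4 := Finset.sum_congr (s₁ := Finset.univ) rfl (fun i _ => h3 i)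
  rw [Finset.sum_add_distrib, Finset.sum_add_distrib, Finset.sum_add_distrib, sum_blk, sum_blk] at h4
  unfold dP
  omega

theorem dimA {α : Bool} {G : Matrix ι ι F} (hA : TII par A α 1 G) (a : Bool) :
    finrank F (A a) ≤ finrank F (PM F par a ⊓ SY F par α : Submodule F _) := by
  have : A a ≤ (PM F par a ⊓ SY F par α).map (conjL 1 G) := by
    intro x hx
    obtain ⟨X, h1, h2, h3⟩ := hA.mem1.1 hx
    exact ⟨X, ⟨h1, h2⟩, by rw [h3]; change 1 * X * G = _; rw [one_mul]⟩
  exact (Submodule.finrank_mono this).trans (Submodule.finrank_map_le _ _)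


theorem sep {β : Bool} {v : ι → F} (hv : v ∈ PV F par β) (h0 : v ≠ 0) : ∃ ψ ∈ PV F par β, ψ ⬝ᵥ v = 1 := by
  obtain ⟨i, hi⟩ : ∃ i, v i ≠ 0 := by by_contra! h; exact h0 (funext h)
  have hp : par i = β := by by_contra h; exact hi (hv i h)
  refine ⟨(v i)⁻¹ • Pi.single i 1, Submodule.smul_mem _ _ (hp ▸ single_PV i), ?_⟩
  rw [smul_dotProduct, single_dotProduct, one_mul, smul_eq_mul, inv_mul_cancel₀ hi]

theorem Dg_pos {α : Bool} {v : ι → F} (hv : v ∈ PV F par α) : Dg F par α *ᵥ v = v := by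
  ext i; rw [Dg, mulVec_diagonal]
  by_cases h : par i = α
  · simp [h]
  · rw [hv i h]; simp

theorem Dg_neg {α : Bool} {v : ι → F} (hv : v ∈ PV F par (!α)) : Dg F par α *ᵥ v = -v := by
  ext i; rw [Dg, mulVec_diagonal]
  by_cases h : par i = α
  · rw [Pi.neg_apply, hv i (by rw [h]; cases α <;> simp)]; simp
  · simp [h]

theorem sy_sym {α : Bool} {X : Matrix ι ι F} {u v : ι → F} (hX : X ∈ PM F par false) (hS : X ∈ SY F par α) (hv : v ∈ PV F par α) :
    u ⬝ᵥ X *ᵥ v = v ⬝ᵥ X *ᵥ u := by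
  have h2 : X *ᵥ v ∈ PV F par α := by simpa using PM_mulVec hX hv
  have := (SY_ev hX).1 hS
  rw [← dotProduct_transpose_mulVec (x := u) (y := v), this, ← mulVec_mulVec, Dg_pos h2]

theorem sy_alt {α : Bool} {X : Matrix ι ι F} {u v : ι → F} (hX : X ∈ PM F par false) (hS : X ∈ SY F par α) (hv : v ∈ PV F par (!α)) :
    u ⬝ᵥ X *ᵥ v = - (v ⬝ᵥ X *ᵥ u) := by
  have h2 : X *ᵥ v ∈ PV F par (!α) := by simpa using PM_mulVec hX hv
  have := (SY_ev hX).1 hS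
  rw [← dotProduct_transpose_mulVec (x := u) (y := v), this, ← mulVec_mulVec, Dg_neg h2, dotProduct_neg, neg_neg]

theorem S4 [IsAlgClosed F] {α : Bool} {G : Matrix ι ι F} (hA : TII par A α 1 G) (hB : Sim par B)
    (hAB : ∀ a, A a ⊔ B a = PM F par a) (hm : 1 ≤ nP par (!α)) : ROI (B false) := by
  by_contra hR
  obtain ⟨H, hH, hHS, HG, GH⟩ := hA.inv
  have hs : ∀ a, dP par a + finrank F (A a ⊓ B a : Submodule F _) = finrank F (A a) + finrank F (B a) := by
    intro a
    rw [← Submodule.finrank_sup_add_finrank_inf_eq, hAB, finrank_PM]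
  have s0 := hs false
  have s1 := hs true
  have a0 := dimA hA false
  have a1 := dimA hA true
  have d0 := dimSY0 (F := F) (par := par) α
  have d1 := dimSY1 (F := F) (par := par) α
  have hE1 : ¬ (dP par false < 2 * finrank F (B false)) := fun h => hR (E1 hB.jc (hB.hom _) h)
  rcases lt_or_ge (nP par α) (nP par (!α)) with h | hle
  · omega
  rcases hle.eq_or_lt with heq | hlt
  · have h1B : (1 : Matrix ι ι F) ∈ B false := by
      by_contra h; exact hR (E2 hB.jc (hB.hom _) (by omega) h)
    have h1A : (1 : Matrix ι ι F) ∈ A false := hA.mem1.2 ⟨H, hH, hHS, HG.symm⟩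
    have : finrank F (A false ⊓ B false : Submodule F _) ≠ 0 := by
      intro h0
      rw [Submodule.finrank_eq_zero] at h0
      have h7 : (1 : Matrix ι ι F) ∈ A false ⊓ B false := ⟨h1A, h1B⟩
      rw [h0, Submodule.mem_bot] at h7
      have : Nonempty ι := by
        by_contra hn
        rw [not_nonempty_iff] at hn
        simp [nP] at hm
      exact one_ne_zero h7
    omega
  obtain ⟨i0, hi0⟩ : ∃ i, par i = !α := by
    obtain ⟨i, hi⟩ := Finset.card_pos.1 (Nat.lt_of_lt_of_le Nat.zero_lt_one hm)
    exact ⟨i, by simpa using hi⟩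
  have hnn : ∃ b ∈ B false, ¬ IsNilpotent b := by
    by_contra! hnil
    obtain ⟨v, hv, hv0, hk⟩ := engel _ (B false) le_rfl hB.jc hnil ⊥ (PV F par (!α))
      (by
        rw [bot_lt_iff_ne_bot]; intro hb
        have : (Pi.single i0 1 : ι → F) ∈ PV F par (!α) := hi0 ▸ single_PV i0
        rw [hb, Submodule.mem_bot] at this
        simpa using congrFun this i0)
      (by intro r hr v hv; rw [Submodule.mem_bot] at hv ⊢; rw [hv, mulVec_zero])
      (by intro r hr v hv; simpa using PM_mulVec (hB.hom _ hr) hv)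
    rw [Submodule.mem_bot] at hv0
    have hGv : G *ᵥ v ∈ PV F par (!α) := by simpa using PM_mulVec hA.hG hv
    have hGv0 : G *ᵥ v ≠ 0 := by
      intro h; apply hv0
      rw [← one_mulVec v, ← HG, ← mulVec_mulVec, h, mulVec_zero]
    obtain ⟨ψ, hψ, hψv⟩ := sep hv hv0
    obtain ⟨w, hw, hwG⟩ := sep hGv hGv0
    have hM : r1 w ψ ∈ A false ⊔ B false := by rw [hAB]; simpa using PM_r1 hw hψ
    obtain ⟨a, ha, b, hb, hab⟩ := Submodule.mem_sup.1 hM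
    obtain ⟨X, hX, hXS, rfl⟩ := hA.mem1.1 ha
    have e1 : (r1 w ψ) *ᵥ v = w := by rw [r1_mulVec, hψv, one_smul]
    have e2 : b *ᵥ v = 0 := by simpa using hk b hb
    rw [← hab, add_mulVec, e2, add_zero, ← mulVec_mulVec] at e1
    have := self_neg (F := F) (sy_alt (u := G *ᵥ v) hX hXS hGv)
    rw [e1, dotProduct_comm, hwG] at this
    exact one_ne_zero this
  obtain ⟨N, hN, hNB, hNi⟩ := ND α (1 : F) hB
  have hNn : ∃ y ∈ N, y ≠ 0 := by
    by_contra! hN0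
    have := maskdim (fun i => if par i = α then ∅ else Finset.univ.filter (fun j => par j = !α)) (B false) (by
      intro x hx h0
      refine hN0 x ((hN x).2 ⟨hx, ?_⟩)
      ext i j
      rw [one_smul, Dg, diagonal_mul]
      by_cases hi : par i = α
      · simp [hi]
      · have : x i j = 0 := by
          by_cases hj : par j = !α
          · exact h0 i j (by simp [hi, hj])
          · exact hB.hom _ hx i j (by revert hi hj; cases par i <;> cases par j <;> cases α <;> simp)
        rw [this]; simp)
    have e : ∑ i, (if par i = α then (∅ : Finset ι) else Finset.univ.filter (fun j => par j = !α)).card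
        = ∑ i, (if par i = α then 0 else nP par (!α)) := by
      refine Finset.sum_congr rfl fun i _ => ?_
      split_ifs <;> simp [nP]
    rw [e, sum_blk] at this
    have e2 := dP_eq (par := par) α
    nlinarith
  obtain ⟨r, hr, hr0⟩ := hNn
  have hNnil : ∃ y ∈ N, ¬ IsNilpotent y := by
    by_contra! hnil
    refine hr0 (SS hB hnn r (hNB hr) fun b hb => ?_)
    have := tr_nil (hnil _ (hNi b hb r hr))
    rw [trace_add, trace_mul_comm b r] at this
    exact half_mem (S := (⊥ : Submodule F F)) (by simpa using this)
  obtain ⟨y, hy, hyn⟩ := hNnil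
  obtain ⟨h, hh, hhh, h0, hrk, hl⟩ := ML hB hR hNB hNi hy hyn
  have := (hN h).1 hh
  exact S4core hB hR this.1 hhh h0 (by rw [this.2, one_smul]) hrk hl (by omega)


theorem kill (hAB : ∀ a, A a ⊔ B a = PM F par a) {a : Bool} {g : Matrix ι ι F} (hg : g ∈ PM F par a)
    (h1 : ∀ x ∈ A a, trace (g * x) = 0) (h2 : ∀ x ∈ B a, trace (g * x) = 0) : g = 0 := by
  ext i j
  by_cases h : xor (par i) (par j) = a
  · have hM : r1 (Pi.single j 1 : ι → F) (Pi.single i 1) ∈ A a ⊔ B a := by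
      rw [hAB, ← h, Bool.xor_comm]; exact PM_r1 (single_PV j) (single_PV i)
    obtain ⟨x, hx, y, hy, hxy⟩ := Submodule.mem_sup.1 hM
    have e : trace (g * r1 (Pi.single j 1 : ι → F) (Pi.single i 1)) = 0 := by
      rw [← hxy, mul_add, trace_add, h1 x hx, h2 y hy, add_zero]
    rw [trace_mul_comm, trace_r1_mul] at e
    simpa using e
  · exact hg i j h

theorem cls_unit (h : (∃ e, TI par A e) ∨ ∃ α e G, TII par A α e G) :
    ∃ e ∈ PM F par false, e * e = e ∧ (∀ a x, x ∈ A a → e * x = x) ∧ (∀ a x, x ∈ A a → x * e = x) ∧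
      (e = 1 → (∀ a, A a = PM F par a) ∨ ∃ α G, TII par A α 1 G) := by
  rcases h with ⟨e, h1, h2, h3⟩ | ⟨α, e, G, h⟩
  · refine ⟨e, h1, h2, fun a x hx => ((h3 a x).1 hx).2.1, fun a x hx => ((h3 a x).1 hx).2.2, ?_⟩
    rintro rfl
    left; intro a; ext x; rw [h3]; simp
  · refine ⟨e, h.he, h.ee, ?_, ?_, ?_⟩
    · intro a x hx
      obtain ⟨X, _, _, h4, rfl⟩ := (h.mem a x).1 hx
      rw [← mul_assoc, h4]
    · intro a x hx
      obtain ⟨X, _, _, h4, rfl⟩ := (h.mem a x).1 hx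
      rw [mul_assoc, h.Ge]
    · rintro rfl
      exact Or.inr ⟨α, G, h⟩

theorem idem_col {e : Matrix ι ι F} (he : e ∈ PM F par false) (hee : e * e = e) (h1 : e ≠ 1) :
    ∃ β, ∃ v ∈ PV F par β, v ≠ 0 ∧ e *ᵥ v = 0 := by
  by_contra! h
  apply h1
  apply mat_ext_single
  intro j
  by_contra hj
  refine h (par j) (e *ᵥ Pi.single j 1 - Pi.single j 1) ?_ ?_ ?_
  · exact Submodule.sub_mem _ (by simpa using PM_mulVec he (single_PV j)) (single_PV j)
  · intro h0; rw [one_mulVec] at hj; exact hj (sub_eq_zero.1 h0)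
  · rw [mulVec_sub, mulVec_mulVec, hee, sub_self]

theorem two_units (hAB : ∀ a, A a ⊔ B a = PM F par a) {e f : Matrix ι ι F} (he : e ∈ PM F par false) (hee : e * e = e)
    (hA : ∀ a x, x ∈ A a → x * e = x) (hf : f ∈ PM F par false) (hff : f * f = f) (hB : ∀ a x, x ∈ B a → f * x = x) :
    e = 1 ∨ f = 1 := by
  by_contra! hc
  obtain ⟨β, v, hv, v0, ev⟩ := idem_col he hee hc.1
  obtain ⟨γ, w, hw, w0, fw⟩ := idem_col (e := fᵀ) (PM_transpose hf) (by rw [← transpose_mul, hff])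
    (by intro h; apply hc.2; rw [← transpose_transpose f, h, transpose_one])
  rw [mulVec_transpose] at fw
  have := kill hAB (PM_r1 hv hw) (fun x hx => by
    rw [trace_r1_mul, ← hA _ x hx, ← mulVec_mulVec, ev, mulVec_zero, dotProduct_zero]) (fun x hx => by
    rw [trace_r1_mul, ← hB _ x hx, ← mulVec_mulVec, dotProduct_mulVec, fw, zero_dotProduct])
  rcases r1_eq_zero this with h | h
  · exact v0 h
  · exact w0 h

theorem G_inj {α : Bool} {G : Matrix ι ι F} (hB : TII par B α 1 G) {v : ι → F} (h : G *ᵥ v = 0) : v = 0 := by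
  obtain ⟨H, _, _, HG, _⟩ := hB.inv
  rw [← one_mulVec v, ← HG, ← mulVec_mulVec, h, mulVec_zero]

theorem S5a [IsAlgClosed F] {α : Bool} {G : Matrix ι ι F} (hB : TII par B α 1 G)
    (hA : (∃ e, TI par A e) ∨ ∃ β e G', TII par A β e G') (hAB : ∀ a, A a ⊔ B a = PM F par a)
    (hAp : ¬ ∀ a, A a = PM F par a) (hm : ∃ i, par i = !α) (hnt : A true ≠ ⊥) :
    ∃ p ∈ PV F par α, ∃ φ ∈ PV F par α, φ ⬝ᵥ p = 1 ∧ TI par A (1 - r1 p φ) := by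
  obtain ⟨H, hH, hHS, HG, GH⟩ := hB.inv
  rcases hA with ⟨e, he, hee, hA⟩ | ⟨β, e, K, hA⟩
  · have h1 : e ≠ 1 := by
      rintro rfl
      apply hAp; intro a; ext x; rw [hA]; simp
    have hxe : ∀ x ∈ A false, ∀ v, e *ᵥ v = 0 → x *ᵥ v = 0 := by
      intro x hx v hv
      rw [← ((hA _ _).1 hx).2.2, ← mulVec_mulVec, hv, mulVec_zero]
    have ka : ∀ v ∈ PV F par (!α), e *ᵥ v = 0 → v = 0 := by
      intro v hv ev
      have hGv : G *ᵥ v ∈ PV F par (!α) := by simpa using PM_mulVec hB.hG hv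
      have := kill (a := false) hAB (by simpa using PM_r1 hv hGv) (fun x hx => by
        rw [trace_r1_mul, hxe x hx v ev, dotProduct_zero]) (fun x hx => by
        obtain ⟨X, hX, hXS, rfl⟩ := hB.mem1.1 hx
        rw [trace_r1_mul, ← mulVec_mulVec]
        exact self_neg (F := F) (sy_alt hX hXS hGv))
      rcases r1_eq_zero this with h | h
      · exact h
      · exact G_inj hB h
    have kb : ∀ v ∈ PV F par α, ∀ w ∈ PV F par α, e *ᵥ v = 0 → e *ᵥ w = 0 → w ≠ 0 → ∃ c : F, v = c • w := by
      intro v hv w hw ev ew w0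
      have hGv : G *ᵥ v ∈ PV F par α := by simpa using PM_mulVec hB.hG hv
      have hGw : G *ᵥ w ∈ PV F par α := by simpa using PM_mulVec hB.hG hw
      have := kill (a := false) (g := r1 v (G *ᵥ w) - r1 w (G *ᵥ v)) hAB
        (Submodule.sub_mem _ (by simpa using PM_r1 hv hGw) (by simpa using PM_r1 hw hGv)) (fun x hx => by
        rw [sub_mul, trace_sub, trace_r1_mul, trace_r1_mul, hxe x hx v ev, hxe x hx w ew]; simp) (fun x hx => by
        obtain ⟨X, hX, hXS, rfl⟩ := hB.mem1.1 hx
        rw [sub_mul, trace_sub, trace_r1_mul, trace_r1_mul, ← mulVec_mulVec, ← mulVec_mulVec, sy_sym hX hXS hGv, sub_self])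
      obtain ⟨ψ, hψ, hψ1⟩ := sep hGw (fun h => w0 (G_inj hB h))
      have e2 := congrArg (fun M => M *ᵥ ψ) (sub_eq_zero.1 this)
      simp only [r1_mulVec] at e2
      rw [dotProduct_comm, hψ1, one_smul] at e2
      exact ⟨_, e2⟩
    have hcol : ∀ j, (1 - e) *ᵥ Pi.single j 1 ∈ PV F par (par j) ∧ e *ᵥ ((1 - e) *ᵥ Pi.single j 1) = 0 := by
      intro j
      refine ⟨by simpa using PM_mulVec (Submodule.sub_mem _ PM_one he) (single_PV j), ?_⟩
      rw [mulVec_mulVec, mul_sub, mul_one, hee, sub_self, zero_mulVec]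
    obtain ⟨β, p, hp, p0, ep⟩ := idem_col he hee h1
    have hβ : β = α := by
      by_contra h
      have : β = !α := by revert h; cases β <;> cases α <;> simp
      subst this
      exact p0 (ka p hp ep)
    subst hβ
    have hc : ∀ j, ∃ c : F, (1 - e) *ᵥ Pi.single j 1 = c • p ∧ (par j ≠ β → c = 0) := by
      intro j
      by_cases hj : par j = β
      · obtain ⟨c, hc⟩ := kb _ (hj ▸ (hcol j).1) p hp (hcol j).2 ep p0
        exact ⟨c, hc, fun h => absurd hj h⟩
      · refine ⟨0, ?_, fun _ => rfl⟩
        rw [zero_smul]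
        exact ka _ ((show par j = !β by revert hj; cases par j <;> cases β <;> simp) ▸ (hcol j).1) (hcol j).2
    choose φ hφ using hc
    have hf : 1 - e = r1 p φ := by
      apply mat_ext_single
      intro j
      rw [(hφ j).1, r1_mulVec]; simp
    have hφp : φ ⬝ᵥ p = 1 := by
      have : (1 - e) *ᵥ p = p := by rw [sub_mulVec, one_mulVec, ep, sub_zero]
      rw [hf, r1_mulVec] at this
      have h2 : (φ ⬝ᵥ p - 1) • p = 0 := by rw [sub_smul, this, one_smul, sub_self]
      exact sub_eq_zero.1 ((smul_eq_zero.1 h2).resolve_right p0)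
    refine ⟨p, hp, φ, fun j hj => (hφ j).2 hj, hφp, ?_⟩
    rw [← hf, sub_sub_cancel]
    exact ⟨he, hee, hA⟩
  · exfalso
    by_cases hβ : β = α
    · subst hβ
      obtain ⟨i0, hi0⟩ := hm
      let V := PV F par (!β)
      have hinv : ∀ v ∈ V, (H * K).mulVecLin v ∈ V := fun v hv => by
        simpa using PM_mulVec (PM_mul hH hA.hG) hv
      let T : V →ₗ[F] V := (H * K).mulVecLin.restrict hinv
      have : Nontrivial V := by
        refine ⟨⟨⟨Pi.single i0 1, show _ ∈ PV F par (!β) from hi0 ▸ single_PV i0⟩, 0, fun h => ?_⟩⟩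
        have := congrFun (congrArg Subtype.val h) i0
        simp at this
      obtain ⟨c, hc⟩ := Module.End.exists_eigenvalue T
      obtain ⟨⟨v, hv⟩, hv1⟩ := hc.exists_hasEigenvector
      have e1 : (H * K) *ᵥ v = c • v := congrArg Subtype.val (hv1.apply_eq_smul)
      have v0 : v ≠ 0 := fun h => hv1.2 (Subtype.ext h)
      have e2 : K *ᵥ v = c • (G *ᵥ v) := by
        rw [← mulVec_smul, ← e1, mulVec_mulVec, ← mul_assoc, GH, one_mul]
      have hGv : G *ᵥ v ∈ PV F par (!β) := by simpa using PM_mulVec hB.hG hv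
      have := kill (a := false) hAB (by simpa using PM_r1 hv hGv) (fun x hx => by
        obtain ⟨X, hX, hXS, _, rfl⟩ := (hA.mem _ _).1 hx
        rw [trace_r1_mul, ← mulVec_mulVec, e2, mulVec_smul, dotProduct_smul]
        rw [self_neg (F := F) (sy_alt (u := G *ᵥ v) hX hXS hGv), smul_zero]) (fun x hx => by
        obtain ⟨X, hX, hXS, rfl⟩ := hB.mem1.1 hx
        rw [trace_r1_mul, ← mulVec_mulVec]
        exact self_neg (F := F) (sy_alt hX hXS hGv))
      rcases r1_eq_zero this with h | h
      · exact v0 h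
      · exact v0 (G_inj hB h)
    · have hD : Dg F par β = - Dg F par α := by
        ext i j
        rw [Matrix.neg_apply, Dg, Dg, diagonal_apply, diagonal_apply]
        by_cases h1 : i = j
        · revert hβ; cases par i <;> cases α <;> cases β <;> simp [h1]
        · simp [h1]
      have tK := (SY_ev hA.hG).1 hA.GS
      have tH := (SY_ev hH).1 hHS
      rw [hD] at tK
      have cK := Dg_ev (α := α) hA.hG
      have cH := Dg_ev (α := α) hH
      have dd := Dg_sq (F := F) (par := par) α
      have := kill (a := false) (g := H * K) hAB (by simpa using PM_mul hH hA.hG) (fun x hx => by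
        obtain ⟨X, hX, hXS, _, rfl⟩ := (hA.mem _ _).1 hx
        have tX := (SY_ev hX).1 hXS
        rw [hD] at tX
        apply self_neg (F := F)
        have e : (H * K * (X * K))ᵀ = -(K * X * K * H) := by
          simp only [transpose_mul, tK, tH, tX]
          generalize Dg F par α = D at *
          calc -D * K * (-D * X) * (-D * K * (D * H)) = -(D * K * (D * X) * (D * K * (D * H))) := by simp only [neg_mul, mul_neg, neg_neg]
            _ = -((K * D) * (D * X) * ((K * D) * (D * H))) := by rw [cK]
            _ = -(K * (D * D) * X * (K * (D * D) * H)) := by simp only [mul_assoc]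
            _ = _ := by rw [dd]; simp only [mul_one, mul_assoc]
        conv_lhs => rw [← trace_transpose, e, trace_neg, mul_assoc K X, mul_assoc K, trace_mul_comm, mul_assoc (X * K), trace_mul_comm (X * K)]) (fun x hx => by
        obtain ⟨X, hX, hXS, rfl⟩ := hB.mem1.1 hx
        have tX := (SY_ev hX).1 hXS
        apply self_neg (F := F)
        have e0 : trace (H * K * (X * G)) = trace (K * X) := by
          rw [← mul_assoc, trace_mul_comm, ← mul_assoc, ← mul_assoc, GH, one_mul]
        rw [e0]
        conv_lhs => rw [← trace_transpose, transpose_mul, tK, tX]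
        rw [Dg_ev hX, neg_mul, mul_neg, trace_neg, mul_assoc, ← mul_assoc (Dg F par α), dd, one_mul, trace_mul_comm])
      have hK : K = 0 := by rw [← one_mul K, ← GH, mul_assoc, this, mul_zero]
      apply hnt
      rw [eq_bot_iff]
      intro x hx
      obtain ⟨X, _, _, _, rfl⟩ := (hA.mem _ _).1 hx
      rw [hK, mul_zero]; simp

theorem getR [IsAlgClosed F] (hA : Sim par A) (hB : Sim par B) (hAB : ∀ a, A a ⊔ B a = PM F par a)
    (hAp : ¬ ∀ a, A a = PM F par a) (hm : ∀ β, 1 ≤ nP par β) (hR : ROI (A false)) : ROI (B false) := by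
  obtain ⟨e, he, hee, h1, h2, h3⟩ := cls_unit (S2 hA hR)
  by_cases h : e = 1
  · obtain ⟨α, G, hT⟩ := (h3 h).resolve_left hAp
    exact S4 hT hB hAB (hm _)
  · exact unitROI hB hAB he hee h h1 h2

theorem main_str [IsAlgClosed F] (hA : Sim par A) (hB : Sim par B) (hAB : ∀ a, A a ⊔ B a = PM F par a)
    (hAp : ¬ ∀ a, A a = PM F par a) (hBp : ¬ ∀ a, B a = PM F par a) (hm : ∀ β, 1 ≤ nP par β) :
    ∃ α G, ∃ p ∈ PV F par α, ∃ φ ∈ PV F par α, φ ⬝ᵥ p = 1 ∧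
      ((TII par A α 1 G ∧ TI par B (1 - r1 p φ)) ∨ (TII par B α 1 G ∧ TI par A (1 - r1 p φ))) := by
  have hi : ∀ β, ∃ i, par i = β := fun β => by
    obtain ⟨i, hi⟩ := Finset.card_pos.1 (Nat.lt_of_lt_of_le Nat.zero_lt_one (hm β))
    exact ⟨i, by simpa using hi⟩
  have hBA : ∀ a, B a ⊔ A a = PM F par a := fun a => by rw [sup_comm, hAB]
  have hne : Nonempty ι := ⟨(hi true).choose⟩
  have hR : ROI (A false) ∧ ROI (B false) := by
    rcases S1 hA.jc hB.jc (hAB false) hne with h | h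
    · exact ⟨h, getR hA hB hAB hAp hm h⟩
    · exact ⟨getR hB hA hBA hBp hm h, h⟩
  have cA := S2 hA hR.1
  have cB := S2 hB hR.2
  obtain ⟨e, he, hee, h1, h2, h3⟩ := cls_unit cA
  obtain ⟨f, hf, hff, k1, k2, k3⟩ := cls_unit cB
  rcases two_units hAB he hee h2 hf hff k1 with h | h
  · obtain ⟨α, G, hT⟩ := (h3 h).resolve_left hAp
    obtain ⟨p, hp, φ, hφ, h1, h2⟩ := S5a hT cB hBA hBp (hi _) hB.nt
    exact ⟨α, G, p, hp, φ, hφ, h1, Or.inl ⟨hT, h2⟩⟩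
  · obtain ⟨α, G, hT⟩ := (k3 h).resolve_left hBp
    obtain ⟨p, hp, φ, hφ, h1, h2⟩ := S5a hT cA hAB hAp (hi _) hA.nt
    exact ⟨α, G, p, hp, φ, hφ, h1, Or.inr ⟨hT, h2⟩⟩

end Csec
section Nsec
variable {F : Type*} [Field F] [CharZero F] {κ : Type*} [Fintype κ] [DecidableEq κ]
open Module

theorem S_sq (q : ℕ) : SMat F q * SMat F q = -1 := by
  ext i j
  rw [mul_apply, Matrix.neg_apply, Matrix.one_apply]
  have hi := i.2
  rcases lt_or_ge (i : ℕ) q with h | h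
  · rw [Finset.sum_eq_single (⟨i + q, by omega⟩ : Fin (2 * q))]
    · by_cases hij : i = j
      · subst hij; simp [SMat]; intro h2; omega
      · have : (i : ℕ) ≠ j := fun h => hij (Fin.ext h)
        simp only [SMat, of_apply, hij, if_false]
        have h2 := j.2
        rw [if_neg (c := (j : ℕ) = i + q + q) (by omega), if_neg (c := (i : ℕ) + q = j + q) (by omega)]; simp
    · intro k _ hk
      have : (k : ℕ) ≠ i + q := fun h => hk (Fin.ext h)
      simp only [SMat, of_apply]
      rw [if_neg this, if_neg (by omega), zero_mul]
    · simp
  · rw [Finset.sum_eq_single (⟨i - q, by omega⟩ : Fin (2 * q))]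
    · by_cases hij : i = j
      · subst hij
        simp only [SMat, of_apply]
        rw [if_neg (by omega), if_pos (by omega), if_pos (by omega)]; simp
      · have : (i : ℕ) ≠ j := fun h => hij (Fin.ext h)
        simp only [SMat, of_apply, hij, if_false]
        have h2 := j.2
        rw [if_neg (c := (j : ℕ) = i - q + q) (by omega), if_neg (c := (i : ℕ) - q = j + q) (by omega)]; simp
    · intro k _ hk
      have : (k : ℕ) ≠ i - q := fun h => hk (Fin.ext h)
      simp only [SMat, of_apply]
      have h2 := k.2
      rw [if_neg (by omega), if_neg (by omega), zero_mul]
    · simp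

theorem S_tr (q : ℕ) : (SMat F q)ᵀ = - SMat F q := by
  ext i j
  have := i.2; have := j.2
  simp only [SMat, of_apply, transpose_apply, Matrix.neg_apply]
  split_ifs <;> first | omega | simp

theorem alt_nf {G : Matrix κ κ F} (hG : Gᵀ = -G) (hinj : ∀ v, G *ᵥ v = 0 → v = 0) :
    ∃ q, ∃ R : Matrix κ (Fin (2 * q)) F, Rᵀ * G * R = - SMat F q ∧ Fintype.card κ = 2 * q := by
  classical
  have om : ∀ x y, x ⬝ᵥ G *ᵥ y = - (y ⬝ᵥ G *ᵥ x) := by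
    intro x y
    rw [← dotProduct_transpose_mulVec, hG, neg_mulVec, dotProduct_neg]
  have om0 : ∀ x, x ⬝ᵥ G *ᵥ x = 0 := fun x => self_neg (F := F) (om x x)
  let P : ℕ → Prop := fun q => ∃ u w : Fin q → κ → F, (∀ i j, u i ⬝ᵥ G *ᵥ w j = if i = j then 1 else 0) ∧
    (∀ i j, u i ⬝ᵥ G *ᵥ u j = 0) ∧ ∀ i j, w i ⬝ᵥ G *ᵥ w j = 0
  have hP : ∀ q, P q → q ≤ Fintype.card κ := by
    rintro q ⟨u, w, h1, -, -⟩
    have : LinearIndependent F u := by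
      rw [Fintype.linearIndependent_iff]
      intro g hg j
      have := congrArg (fun v => v ⬝ᵥ G *ᵥ w j) hg
      simpa [sum_dotProduct, h1] using this
    simpa using this.fintype_card_le_finrank
  have h0 : P 0 := ⟨Fin.elim0, Fin.elim0, fun i => i.elim0, fun i => i.elim0, fun i => i.elim0⟩
  obtain ⟨q, ⟨u, w, h1, h2, h3⟩, hq⟩ : ∃ q, P q ∧ ¬ P (q + 1) := by
    by_contra! h
    have : ∀ n, P n := fun n => Nat.rec h0 (fun k hk => h k hk) n
    have := hP _ (this (Fintype.card κ + 1))
    omega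
  have h1' : ∀ i j, w i ⬝ᵥ G *ᵥ u j = if i = j then -1 else 0 := by
    intro i j; rw [om, h1]; by_cases h : i = j
    · simp [h]
    · simp [h, Ne.symm h]
  have hpr : ∀ v, ∃ c d : Fin q → F, (∀ j, (v - (∑ i, c i • u i + ∑ i, d i • w i)) ⬝ᵥ G *ᵥ u j = 0) ∧
      (∀ j, (v - (∑ i, c i • u i + ∑ i, d i • w i)) ⬝ᵥ G *ᵥ w j = 0) := by
    intro v
    refine ⟨fun i => v ⬝ᵥ G *ᵥ w i, fun i => -(v ⬝ᵥ G *ᵥ u i), fun j => ?_, fun j => ?_⟩ <;>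
    simp [sub_dotProduct, add_dotProduct, sum_dotProduct, h1, h2, h3, h1']
  have hsp : ∀ v, ∃ c d : Fin q → F, v = ∑ i, c i • u i + ∑ i, d i • w i := by
    intro v
    obtain ⟨c, d, k1, k2⟩ := hpr v
    refine ⟨c, d, ?_⟩
    by_contra hne
    apply hq
    obtain ⟨x, hx⟩ : ∃ x, x = v - (∑ i, c i • u i + ∑ i, d i • w i) := ⟨_, rfl⟩
    rw [← hx] at k1 k2
    have x0 : G *ᵥ x ≠ 0 := fun h => hne (sub_eq_zero.1 (hx.symm.trans (hinj x h)))
    obtain ⟨i, hi⟩ : ∃ i, (G *ᵥ x) i ≠ 0 := by by_contra! h; exact x0 (funext h)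
    obtain ⟨y, hy⟩ : ∃ y, x ⬝ᵥ G *ᵥ y = 1 := by
      refine ⟨(-((G *ᵥ x) i)⁻¹) • Pi.single i 1, ?_⟩
      rw [om, smul_dotProduct, single_dotProduct, one_mul, smul_eq_mul, neg_mul, neg_neg, inv_mul_cancel₀ hi]
    obtain ⟨c', d', l1, l2⟩ := hpr y
    obtain ⟨z, hz⟩ : ∃ z, z = y - (∑ i, c' i • u i + ∑ i, d' i • w i) := ⟨_, rfl⟩
    rw [← hz] at l1 l2
    have hxz : x ⬝ᵥ G *ᵥ z = 1 := by
      rw [hz, mulVec_sub, dotProduct_sub, hy, om x (_ + _), add_dotProduct, sum_dotProduct, sum_dotProduct]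
      simp only [smul_dotProduct]
      have a1 : ∀ i, u i ⬝ᵥ G *ᵥ x = 0 := fun i => by rw [om, k1, neg_zero]
      have a2 : ∀ i, w i ⬝ᵥ G *ᵥ x = 0 := fun i => by rw [om, k2, neg_zero]
      simp [a1, a2]
    refine ⟨Fin.cons x u, Fin.cons z w, ?_, ?_, ?_⟩ <;> intro i j <;> refine Fin.cases ?_ (fun i => ?_) i <;>
      refine Fin.cases ?_ (fun j => ?_) j <;> simp only [Fin.cons_zero, Fin.cons_succ]
    · simp [hxz]
    · rw [k2, if_neg (Fin.succ_ne_zero j).symm]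
    · rw [om, l1, if_neg (Fin.succ_ne_zero i), neg_zero]
    · rw [h1]; simp
    · exact om0 _
    · exact k1 _
    · rw [om, k1, neg_zero]
    · exact h2 _ _
    · exact om0 _
    · exact l2 _
    · rw [om, l2, neg_zero]
    · exact h3 _ _
  let cl : Fin (2 * q) → κ → F := fun k => if h : (k : ℕ) < q then w ⟨k, h⟩ else u ⟨k - q, by omega⟩
  let R : Matrix κ (Fin (2 * q)) F := Matrix.of fun a k => cl k a
  have hR : Rᵀ * G * R = - SMat F q := by
    ext i j
    have e : (Rᵀ * G * R) i j = cl i ⬝ᵥ G *ᵥ cl j := by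
      rw [Matrix.mul_assoc, mul_apply]
      rfl
    rw [e, Matrix.neg_apply]
    have := i.2; have := j.2
    simp only [cl, SMat, of_apply]
    split_ifs <;> simp only [h1, h2, h3, h1', Fin.mk.injEq] <;> first | omega | skip
    all_goals first | (rw [if_pos (by omega)]; try simp) | (rw [if_neg (by omega)]; try simp) | simp
  refine ⟨q, R, hR, ?_⟩
  have hLR : (SMat F q * Rᵀ * G) * R = 1 := by
    rw [Matrix.mul_assoc, Matrix.mul_assoc, ← Matrix.mul_assoc Rᵀ, hR, mul_neg, S_sq, neg_neg]
  have hRs : ∀ v, ∃ c, v = R *ᵥ c := by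
    intro v
    obtain ⟨c, d, rfl⟩ := hsp v
    have hcl : ∀ k, R *ᵥ Pi.single k 1 = cl k := by intro k; rw [mulVec_single_one]; rfl
    refine ⟨∑ i : Fin q, c i • Pi.single (⟨i + q, by omega⟩ : Fin (2 * q)) 1 + ∑ i : Fin q, d i • Pi.single (⟨i, by omega⟩ : Fin (2 * q)) 1, ?_⟩
    rw [mulVec_add, mulVec_sum, mulVec_sum]
    simp only [mulVec_smul, hcl]
    simp [cl]
  have hRL : R * (SMat F q * Rᵀ * G) = 1 := by
    apply Matrix.toLin'.injective
    apply LinearMap.ext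
    intro v
    obtain ⟨c, rfl⟩ := hRs v
    rw [toLin'_apply, toLin'_apply, mulVec_mulVec, Matrix.mul_assoc, hLR, Matrix.mul_one, one_mulVec]
  have := Matrix.square_of_invertible _ _ hRL hLR
  simpa using this

theorem sym_nf [IsAlgClosed F] {p : ℕ} {G : Matrix (Fin p) (Fin p) F} (hG : Gᵀ = G) (hinj : ∀ v, G *ᵥ v = 0 → v = 0) :
    ∃ R : Matrix (Fin p) (Fin p) F, Rᵀ * G * R = 1 := by
  have hi : Invertible (2 : F) := invertibleOfNonzero two_ne_zero
  have hs : LinearMap.IsSymm (Matrix.toBilin' G) := ⟨fun x y => by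
    change Matrix.toBilin' G x y = Matrix.toBilin' G y x
    rw [Matrix.toBilin'_apply', Matrix.toBilin'_apply', ← dotProduct_transpose_mulVec, hG]⟩
  obtain ⟨v0, hv⟩ := LinearMap.BilinForm.exists_orthogonal_basis hs
  have hp : finrank F (Fin p → F) = p := by simp
  obtain ⟨v, ho⟩ : ∃ v : Basis (Fin p) F (Fin p → F), ∀ i j, i ≠ j → v i ⬝ᵥ G *ᵥ v j = 0 := by
    refine ⟨v0.reindex (finCongr hp), fun i j hij => ?_⟩
    have := hv (i := (finCongr hp).symm i) (j := (finCongr hp).symm j) (by simpa using hij)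
    rw [Basis.reindex_apply, Basis.reindex_apply, ← Matrix.toBilin'_apply']
    exact this
  have hd : ∀ j, v j ⬝ᵥ G *ᵥ v j ≠ 0 := by
    intro j h0
    apply v.ne_zero j
    apply hinj
    have : ∀ x, x ⬝ᵥ G *ᵥ v j = 0 := by
      intro x
      rw [← v.sum_repr x, sum_dotProduct]
      refine Finset.sum_eq_zero fun i _ => ?_
      rw [smul_dotProduct]
      by_cases h : i = j
      · rw [h, h0, smul_zero]
      · rw [ho i j h, smul_zero]
    ext i
    simpa using this (Pi.single i 1)
  choose s hs using fun j => IsAlgClosed.exists_eq_mul_self (v j ⬝ᵥ G *ᵥ v j)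
  have hs0 : ∀ j, s j ≠ 0 := fun j h => hd j (by rw [hs, h, zero_mul])
  refine ⟨Matrix.of fun a j => ((s j)⁻¹ • v j) a, ?_⟩
  ext i j
  have e : ((Matrix.of fun a j => ((s j)⁻¹ • v j) a : Matrix (Fin p) (Fin p) F)ᵀ * G * (Matrix.of fun a j => ((s j)⁻¹ • v j) a : Matrix (Fin p) (Fin p) F)) i j
      = ((s i)⁻¹ • v i) ⬝ᵥ G *ᵥ ((s j)⁻¹ • v j) := by
    rw [Matrix.mul_assoc, mul_apply]
    rfl
  rw [e, smul_dotProduct, mulVec_smul, dotProduct_smul, Matrix.one_apply]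
  by_cases h : i = j
  · subst h
    rw [hs, if_pos rfl, smul_eq_mul, smul_eq_mul]; have := hs0 i; field_simp
  · rw [ho i j h, if_neg h]; simp

end Nsec
section Isec
variable {F : Type*} [Field F] [CharZero F]
open Module
def PC {ι κ : Type*} (s : Bool) (par : ι → Bool) (par' : κ → Bool) (M : Matrix ι κ F) : Prop :=
  ∀ i j, par i ≠ xor s (par' j) → M i j = 0

theorem PC.mul {ι κ τ : Type*} [Fintype κ] {s t : Bool} {p1 : ι → Bool} {p2 : κ → Bool} {p3 : τ → Bool}
    {M : Matrix ι κ F} {N : Matrix κ τ F} (hM : PC s p1 p2 M) (hN : PC t p2 p3 N) : PC (xor s t) p1 p3 (M * N) := by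
  intro i j hij
  rw [mul_apply]
  refine Finset.sum_eq_zero fun k _ => ?_
  by_cases h : p1 i = xor s (p2 k)
  · rw [hN k j (fun h2 => hij (by rw [h, h2, Bool.xor_assoc])), mul_zero]
  · rw [hM i k h, zero_mul]

theorem PC.tr {ι κ : Type*} {s : Bool} {p1 : ι → Bool} {p2 : κ → Bool} {M : Matrix ι κ F} (hM : PC s p1 p2 M) :
    PC s p2 p1 Mᵀ := by
  intro i j h
  exact hM j i (by revert h; cases p1 j <;> cases p2 i <;> cases s <;> simp)

theorem PC_ev {ι : Type*} [Fintype ι] [DecidableEq ι] {par : ι → Bool} {M : Matrix ι ι F} (h : M ∈ PM F par false) : PC false par par M := by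
  intro i j hij
  exact h i j (by revert hij; cases par i <;> cases par j <;> simp)

theorem SY_conj {ι κ : Type*} [Fintype ι] [DecidableEq ι] [Fintype κ] [DecidableEq κ] {s α : Bool} {par : ι → Bool} {par' : κ → Bool}
    {L : Matrix κ ι F} (hL : PC s par' par L) {X : Matrix ι ι F} (hX : X ∈ SY F par α) : L * X * Lᵀ ∈ SY F par' (xor s α) := by
  intro i j
  have e : ∀ a b, (L * X * Lᵀ) a b = ∑ k, ∑ l, L a k * X k l * L b l := by
    intro a b
    rw [mul_apply, Finset.sum_comm]
    refine Finset.sum_congr rfl fun l _ => ?_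
    rw [mul_apply, Finset.sum_mul]; rfl
  rw [e, e, Finset.sum_comm, Finset.mul_sum]
  refine Finset.sum_congr rfl fun k _ => ?_
  rw [Finset.mul_sum]
  refine Finset.sum_congr rfl fun l _ => ?_
  by_cases h1 : par' i = xor s (par k)
  · by_cases h2 : par' j = xor s (par l)
    · rw [hX k l, h1, h2, show xor (xor s (par k)) (xor s α) = xor (par k) α by cases s <;> cases par k <;> cases α <;> rfl,
        show xor (xor s (par l)) (xor s α) = xor (par l) α by cases s <;> cases par l <;> cases α <;> rfl]; ring
    · rw [hL j l h2]; ring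
  · rw [hL i k h1]; ring

theorem odd_conj {n m n' m' : ℕ} {s : Bool} {L : Matrix (Fin n' ⊕ Fin m') (Fin n ⊕ Fin m) F} {R : Matrix (Fin n ⊕ Fin m) (Fin n' ⊕ Fin m') F}
    (hL : PC s pty pty L) (hR : PC s pty pty R) (x : MJ F n m) : oddPart F (L * x * R) = L * oddPart F x * R := by
  have e : ∀ (x : MJ F n m) a b, (L * x * R) a b = ∑ k, ∑ l, L a k * x k l * R l b := by
    intro x a b
    rw [mul_apply, Finset.sum_comm]
    refine Finset.sum_congr rfl fun l _ => ?_
    rw [mul_apply, Finset.sum_mul]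
  ext i j
  rw [oddPart, of_apply, e, e]
  have h : ∀ k l, L i k * oddPart F x k l * R l j = if pty i = pty j then 0 else L i k * x k l * R l j := by
    intro k l
    by_cases h1 : pty i = xor s (pty k)
    · by_cases h2 : pty l = xor s (pty j)
      · simp only [oddPart, of_apply]
        have : pty k = pty l ↔ pty i = pty j := by
          rw [h1, h2]; cases s <;> cases pty k <;> cases pty j <;> simp
        simp only [this]; split_ifs <;> simp
      · rw [hR l j h2]; simp
    · rw [hL i k h1]; simp
  simp only [h]
  split_ifs <;> simp

theorem PM_pty {n m : ℕ} : evenSub F n m = PM F pty false ∧ oddSub F n m = PM F pty true := by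
  constructor <;> ext x <;> refine forall_congr' fun i => forall_congr' fun j => ?_ <;>
    cases pty i <;> cases pty j <;> simp

theorem odd_mem {n m : ℕ} (x : MJ F n m) : oddPart F x ∈ PM F pty true ∧ x - oddPart F x ∈ PM F pty false ∧
    (x ∈ PM F pty false ↔ oddPart F x = 0) ∧ (x ∈ PM F pty true ↔ oddPart F x = x) := by
  have key : ∀ i j, oddPart F x i j = if pty i = pty j then 0 else x i j := fun i j => rfl
  refine ⟨?_, ?_, ⟨?_, ?_⟩, ⟨?_, ?_⟩⟩
  · intro i j h; rw [key, if_pos]; revert h; cases pty i <;> cases pty j <;> simp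
  · intro i j h; rw [Matrix.sub_apply, key, if_neg, sub_self]; revert h; cases pty i <;> cases pty j <;> simp
  · intro h; ext i j; rw [key]; split_ifs with h1
    · rfl
    · exact h i j (by revert h1; cases pty i <;> cases pty j <;> simp)
  · intro h i j hij
    have := congrFun (congrFun h i) j
    rw [key, if_neg] at this
    · exact this
    · revert hij; cases pty i <;> cases pty j <;> simp
  · intro h; ext i j; rw [key]; split_ifs with h1
    · exact (h i j (by rw [h1]; simp)).symm
    · rfl
  · intro h i j hij
    rw [← h, key, if_pos]; revert hij; cases pty i <;> cases pty j <;> simp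

theorem iso_of {n m n' m' : ℕ} {s : Bool} {L : Matrix (Fin n' ⊕ Fin m') (Fin n ⊕ Fin m) F} {R : Matrix (Fin n ⊕ Fin m) (Fin n' ⊕ Fin m') F}
    (hL : PC s pty pty L) (hR : PC s pty pty R) (hLR : L * R = 1) {A : Submodule F (MJ F n m)} {B : Submodule F (MJ F n' m')}
    (hA1 : ∀ x ∈ A, R * L * x = x) (hA2 : ∀ x ∈ A, x * (R * L) = x) (hAB : ∀ x ∈ A, L * x * R ∈ B) (hBA : ∀ y ∈ B, R * y * L ∈ A) :
    SuperIso F A B := by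
  have i1 : ∀ x ∈ A, R * (L * x * R) * L = x := by
    intro x hx
    conv_rhs => rw [← hA2 x hx, ← hA1 x hx]
    simp only [Matrix.mul_assoc]
  have i2 : ∀ y : MJ F n' m', L * (R * y * L) * R = y := by
    intro y
    calc L * (R * y * L) * R = (L * R) * y * (L * R) := by simp only [Matrix.mul_assoc]
      _ = y := by rw [hLR, Matrix.one_mul, Matrix.mul_one]
  have o1 : ∀ x ∈ A, oddPart F x * (R * L) = oddPart F x := by
    intro x hx
    have h1 : PC false (pty (n := n) (m := m)) (pty (n := n) (m := m)) (1 : MJ F n m) := PC_ev PM_one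
    have h2 : PC false (pty (n := n) (m := m)) (pty (n := n) (m := m)) (R * L) := by simpa using hR.mul hL
    have := odd_conj h1 h2 x
    rw [Matrix.one_mul, Matrix.one_mul, hA2 x hx] at this
    exact this.symm
  let e : A ≃ₗ[F] B :=
    { toFun := fun x => ⟨L * (x : MJ F n m) * R, hAB x x.2⟩
      map_add' := fun x y => Subtype.ext (by simp [Matrix.mul_add, Matrix.add_mul])
      map_smul' := fun c x => Subtype.ext (by simp)
      invFun := fun y => ⟨R * (y : MJ F n' m') * L, hBA y y.2⟩
      left_inv := fun x => Subtype.ext (i1 x x.2)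
      right_inv := fun y => Subtype.ext (i2 y) }
  have he : ∀ x : A, (e x : MJ F n' m') = L * (x : MJ F n m) * R := fun x => rfl
  have oinj : ∀ x ∈ A, L * oddPart F x * R = 0 → oddPart F x = 0 := by
    intro x hx h
    rw [← odd_conj hL hR] at h
    have := odd_conj hR hL (L * x * R)
    rw [i1 x hx, h] at this
    simpa using this
  refine ⟨e, fun x => ?_, fun x => ?_, ?_⟩
  · rw [PM_pty.1, PM_pty.1, (odd_mem _).2.2.1, (odd_mem _).2.2.1, he, odd_conj hL hR]
    exact ⟨fun h => by rw [h]; simp, oinj x x.2⟩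
  · rw [PM_pty.2, PM_pty.2, (odd_mem _).2.2.2, (odd_mem _).2.2.2, he, odd_conj hL hR]
    refine ⟨fun h => by rw [h], fun h => ?_⟩
    have h2 := odd_conj hR hL (L * (x : MJ F n m) * R)
    rw [i1 x x.2, odd_conj hL hR, h, i1 x x.2] at h2
    exact h2
  · intro x y z hz
    rw [he, he, he, ← hz, jmul, jmul, odd_conj hL hR, odd_conj hL hR]
    have a1 : ∀ u v : MJ F n m, u * (R * L) = u → (L * u * R) * (L * v * R) = L * (u * v) * R := by
      intro u v hu
      calc (L * u * R) * (L * v * R) = L * (u * (R * L)) * v * R := by simp only [Matrix.mul_assoc]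
        _ = _ := by rw [hu]; simp only [Matrix.mul_assoc]
    rw [a1 _ _ (hA2 x x.2), a1 _ _ (hA2 y y.2), a1 _ _ (o1 y y.2)]
    simp only [Matrix.mul_add, Matrix.add_mul, Matrix.mul_sub, Matrix.sub_mul, Matrix.mul_smul, Matrix.smul_mul]

end Isec
section Jsec
variable {F : Type*} [Field F] [CharZero F]

theorem sy_blk {n m : ℕ} {a : Matrix (Fin n) (Fin n) F} {b : Matrix (Fin n) (Fin m) F} {c : Matrix (Fin m) (Fin n) F}
    {d : Matrix (Fin m) (Fin m) F} : fromBlocks a b c d ∈ SY F pty false ↔ aᵀ = a ∧ c = bᵀ ∧ dᵀ = -d := by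
  constructor
  · intro h
    refine ⟨?_, ?_, ?_⟩ <;> ext i j
    · simpa [pty] using h (Sum.inl i) (Sum.inl j)
    · simpa [pty] using h (Sum.inl j) (Sum.inr i)
    · simpa [pty] using h (Sum.inr i) (Sum.inr j)
  · rintro ⟨h1, h2, h3⟩ (i | i) (j | j)
    · simpa [pty] using congrFun (congrFun h1 i) j
    · simpa [pty] using congrFun (congrFun h2 j) i
    · simpa [pty] using (congrFun (congrFun h2 i) j).symm
    · simpa [pty] using congrFun (congrFun h3 i) j

def G0 (F : Type*) [Field F] (p q : ℕ) : MJ F p (2 * q) := fromBlocks 1 0 0 (- SMat F q)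
def G0i (F : Type*) [Field F] (p q : ℕ) : MJ F p (2 * q) := fromBlocks 1 0 0 (SMat F q)

theorem G00 (p q : ℕ) : G0 F p q * G0i F p q = 1 ∧ G0i F p q * G0 F p q = 1 := by
  constructor <;> simp [G0, G0i, fromBlocks_multiply, S_sq]

theorem osp_iff {p q : ℕ} (y : MJ F p (2 * q)) : y ∈ ospSub F p q ↔ y * G0i F p q ∈ SY F pty false := by
  have hs := S_sq (F := F) q
  have ht := S_tr (F := F) q
  conv_rhs => rw [← fromBlocks_toBlocks y, G0i, fromBlocks_multiply]
  simp only [Matrix.mul_one, Matrix.mul_zero, add_zero, zero_add]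
  rw [sy_blk]
  show (_ ∧ _ ∧ _) ↔ _
  set S := SMat F q
  generalize y.toBlocks₁₁ = a, y.toBlocks₁₂ = b, y.toBlocks₂₁ = c, y.toBlocks₂₂ = d
  refine and_congr_right fun _ => and_congr ?_ ?_
  · rw [transpose_mul, ht, Matrix.neg_mul]
    constructor
    · intro h; rw [← h, ← Matrix.mul_assoc, hs]; simp
    · intro h; rw [h, Matrix.mul_neg, ← Matrix.mul_assoc, hs]; simp
  · rw [transpose_mul, ht, Matrix.neg_mul, neg_inj]
    constructor
    · intro h
      calc S * dᵀ = - (S * dᵀ * (S * S)) := by rw [hs]; simp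
        _ = - (S * (dᵀ * S) * S) := by simp only [Matrix.mul_assoc]
        _ = - ((S * S) * d * S) := by rw [h]; simp only [Matrix.mul_assoc]
        _ = d * S := by rw [hs]; simp
    · intro h
      calc dᵀ * S = - ((S * S) * dᵀ * S) := by rw [hs]; simp
        _ = - (S * (S * dᵀ) * S) := by simp only [Matrix.mul_assoc]
        _ = - (S * d * (S * S)) := by rw [h]; simp only [Matrix.mul_assoc]
        _ = S * d := by rw [hs]; simp

theorem nf [IsAlgClosed F] {p m : ℕ} {G : MJ F p m} (h0 : G ∈ PM F pty false) (h1 : G ∈ SY F pty false)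
    (hinj : ∀ v, G *ᵥ v = 0 → v = 0) : ∃ q, m = 2 * q ∧ ∃ R : Matrix (Fin p ⊕ Fin m) (Fin p ⊕ Fin (2 * q)) F,
      PC false pty pty R ∧ Rᵀ * G * R = G0 F p q := by
  have hb : G.toBlocks₁₂ = 0 := by ext i j; exact h0 (Sum.inl i) (Sum.inr j) (by simp [pty])
  have hc : G.toBlocks₂₁ = 0 := by ext i j; exact h0 (Sum.inr i) (Sum.inl j) (by simp [pty])
  have hG : G = fromBlocks G.toBlocks₁₁ 0 0 G.toBlocks₂₂ := by
    conv_lhs => rw [← fromBlocks_toBlocks G, hb, hc]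
  generalize G.toBlocks₁₁ = a, G.toBlocks₂₂ = d at hG
  subst hG
  obtain ⟨ha, _, hd⟩ := sy_blk.1 h1
  obtain ⟨R1, hR1⟩ := sym_nf ha (fun v hv => by
    have := hinj (Sum.elim v 0) (by rw [fromBlocks_mulVec]; ext (i | i) <;> simp [hv])
    ext i; exact congrFun this (Sum.inl i))
  obtain ⟨q, R2, hR2, hq⟩ := alt_nf hd (fun v hv => by
    have := hinj (Sum.elim 0 v) (by rw [fromBlocks_mulVec]; ext (i | i) <;> simp [hv])
    ext i; exact congrFun this (Sum.inr i))
  refine ⟨q, by simpa using hq, fromBlocks R1 0 0 R2, ?_, ?_⟩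
  · rintro (i | i) (j | j) h <;> first | rfl | exact absurd rfl h
  · rw [fromBlocks_transpose, fromBlocks_multiply, fromBlocks_multiply, G0]
    simp [hR1, hR2]
def gr {n m : ℕ} (A : Submodule F (MJ F n m)) (a : Bool) : Submodule F (MJ F n m) := A ⊓ PM F pty a

theorem gr_dec {n m : ℕ} {A : Submodule F (MJ F n m)} (hA : IsGraded F A) {x : MJ F n m} :
    x ∈ A ↔ oddPart F x ∈ gr A true ∧ x - oddPart F x ∈ gr A false := by
  constructor
  · intro hx
    rw [hA] at hx
    obtain ⟨y, hy, z, hz, rfl⟩ := Submodule.mem_sup.1 hx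
    rw [PM_pty.1] at hy
    rw [PM_pty.2] at hz
    have h1 := (odd_mem y).2.2.1.1 hy.2
    have h2 := (odd_mem z).2.2.2.1 hz.2
    have h3 : oddPart F (y + z) = z := by
      have : oddPart F (y + z) = oddPart F y + oddPart F z := by
        ext i j; simp only [oddPart, of_apply, Matrix.add_apply]; split_ifs <;> simp
      rw [this, h1, h2, zero_add]
    rw [h3]
    exact ⟨hz, by rw [add_sub_cancel_right]; exact hy⟩
  · rintro ⟨h1, h2⟩
    have := A.add_mem h1.1 h2.1
    simpa using this

theorem mem_TI {n m : ℕ} {A : Submodule F (MJ F n m)} (hA : IsGraded F A) {e : MJ F n m} (h : TI pty (gr A) e) (x : MJ F n m) :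
    x ∈ A ↔ e * x = x ∧ x * e = x := by
  obtain ⟨he, _, hm⟩ := h
  have ho := odd_mem x
  have p1 : PC false (pty (n := n) (m := m)) (pty (n := n) (m := m)) (1 : MJ F n m) := PC_ev PM_one
  have l := odd_conj (PC_ev he) p1 x
  have r := odd_conj p1 (PC_ev he) x
  simp only [Matrix.mul_one, Matrix.one_mul] at l r
  rw [gr_dec hA, hm, hm]
  constructor
  · rintro ⟨⟨_, h1, h2⟩, _, h3, h4⟩
    rw [Matrix.mul_sub, h1] at h3
    rw [Matrix.sub_mul, h2] at h4
    exact ⟨sub_left_injective h3, sub_left_injective h4⟩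
  · rintro ⟨h1, h2⟩
    rw [h1] at l
    rw [h2] at r
    exact ⟨⟨ho.1, l.symm, r.symm⟩, ho.2.1, by rw [Matrix.mul_sub, h1, ← l], by rw [Matrix.sub_mul, h2, ← r]⟩

theorem mem_TII {n m : ℕ} {A : Submodule F (MJ F n m)} (hA : IsGraded F A) {α : Bool} {G : MJ F n m}
    (h : TII pty (gr A) α 1 G) (x : MJ F n m) : x ∈ A ↔ ∃ X ∈ SY F pty α, x = X * G := by
  rw [gr_dec hA, h.mem1, h.mem1]
  constructor
  · rintro ⟨⟨X, _, h1, h2⟩, ⟨Y, _, h3, h4⟩⟩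
    refine ⟨X + Y, add_mem h1 h3, ?_⟩
    rw [Matrix.add_mul, ← h2, ← h4]; abel
  · rintro ⟨X, hX, rfl⟩
    have p1 : PC false (pty (n := n) (m := m)) (pty (n := n) (m := m)) (1 : MJ F n m) := PC_ev PM_one
    have r := odd_conj p1 (PC_ev h.hG) X
    simp only [Matrix.mul_one, Matrix.one_mul] at r
    have hs : oddPart F X ∈ SY F pty α := by
      intro i j
      simp only [oddPart, of_apply]
      rw [hX i j]
      by_cases hij : pty i = pty j
      · rw [if_pos hij, if_pos hij.symm, mul_zero]
      · rw [if_neg hij, if_neg (Ne.symm hij)]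
    exact ⟨⟨_, (odd_mem X).1, hs, r⟩, ⟨_, (odd_mem X).2.1, sub_mem hX hs, by rw [r, Matrix.sub_mul]⟩⟩

theorem isoTII [IsAlgClosed F] {n m p m' : ℕ} {A : Submodule F (MJ F n m)} (hA : IsGraded F A) {α : Bool} {G : MJ F n m}
    (h : TII pty (gr A) α 1 G) (σ : Fin p ⊕ Fin m' ≃ Fin n ⊕ Fin m) (hσ : ∀ j, pty (σ j) = xor α (pty j)) :
    ∃ q, m' = 2 * q ∧ SuperIso F A (ospSub F p q) := by
  have hxx : ∀ a b c : Bool, xor (xor a b) (xor a c) = xor b c := by decide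
  have hxx2 : ∀ a b : Bool, xor (xor a b) a = b := by decide
  obtain ⟨q, hq, R', hR', hRG⟩ := nf (G := G.submatrix σ σ)
    (by intro i j hij; exact h.hG _ _ (by rw [hσ, hσ, hxx]; exact hij))
    (by intro i j; have := h.GS (σ i) (σ j); rw [hσ, hσ, hxx2, hxx2] at this; simpa using this)
    (by
      intro v hv
      have : G *ᵥ (v ∘ σ.symm) = 0 := by
        rw [submatrix_mulVec_equiv] at hv
        ext i
        simpa using congrFun hv (σ.symm i)
      have := G_inj h this
      ext i; simpa using congrFun this (σ i))
  subst hq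
  refine ⟨q, rfl, ?_⟩
  set R : Matrix (Fin n ⊕ Fin m) (Fin p ⊕ Fin (2 * q)) F := R'.submatrix σ.symm id with hRdef
  have hRG2 : Rᵀ * G * R = G0 F p q := by
    rw [← hRG, hRdef]
    ext i j
    simp only [mul_apply, transpose_apply, submatrix_apply, id]
    rw [← σ.sum_comp]
    refine Finset.sum_congr rfl fun k _ => ?_
    rw [← σ.sum_comp]; simp
  have hR : PC α pty pty R := by
    intro i j hij
    refine hR' _ _ fun h2 => hij ?_
    have := hσ (σ.symm i)
    rw [Equiv.apply_symm_apply, h2] at this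
    simpa using this
  have hG0 : PC false (pty (n := p) (m := 2 * q)) pty (G0i F p q) := by
    rintro (i | i) (j | j) h <;> simp_all [pty, G0i]
  have hL : PC α pty pty (G0i F p q * Rᵀ * G) := by simpa using (hG0.mul hR.tr).mul (PC_ev h.hG)
  have hLR : G0i F p q * Rᵀ * G * R = 1 := by
    calc _ = G0i F p q * (Rᵀ * G * R) := by simp only [Matrix.mul_assoc]
      _ = 1 := by rw [hRG2, (G00 p q).2]
  have hRL : R * (G0i F p q * Rᵀ * G) = 1 :=
    (Matrix.mul_eq_one_comm_of_card_eq _ _ _ (Fintype.card_congr σ)).1 hLR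
  have e1 : R * G0i F p q * Rᵀ * G = 1 := by rw [← hRL]; simp only [Matrix.mul_assoc]
  have e2 : G * (R * G0i F p q * Rᵀ) = 1 := _root_.mul_eq_one_comm.1 e1
  refine iso_of hL hR hLR (fun x _ => by rw [hRL, Matrix.one_mul]) (fun x _ => by rw [hRL, Matrix.mul_one]) ?_ ?_
  · intro x hx
    obtain ⟨X, hX, rfl⟩ := (mem_TII hA h x).1 hx
    have h3 := SY_conj hL hX
    rw [Bool.xor_self] at h3
    rw [osp_iff]
    generalize G0i F p q * Rᵀ * G = L at *
    convert h3 using 1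
    have h4 : Rᵀ * Lᵀ = 1 := by rw [← transpose_mul, hLR, transpose_one]
    calc L * (X * G) * R * G0i F p q = L * (X * G) * R * G0i F p q * (Rᵀ * Lᵀ) := by rw [h4, Matrix.mul_one]
      _ = L * X * (G * (R * G0i F p q * Rᵀ)) * Lᵀ := by simp only [Matrix.mul_assoc]
      _ = L * X * Lᵀ := by rw [e2, Matrix.mul_one]
  · intro y hy
    rw [osp_iff] at hy
    have := SY_conj hR hy
    rw [Bool.xor_false] at this
    rw [mem_TII hA h]
    refine ⟨_, this, ?_⟩
    simp only [Matrix.mul_assoc]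
end Jsec
section Ksec
variable {F : Type*} [Field F] [CharZero F]

theorem isoTI_gen {n m n' m' : ℕ} {A : Submodule F (MJ F n m)} (hA : IsGraded F A) {α s : Bool} {p φ : Fin n ⊕ Fin m → F}
    (hp : p ∈ PV F pty α) (hφ : φ ∈ PV F pty α) (h1 : φ ⬝ᵥ p = 1) (h : TI pty (gr A) (1 - r1 p φ)) {i} (hi : p i ≠ 0)
    (k : Fin n' ⊕ Fin m' → Fin n ⊕ Fin m) (hk : ∀ j, pty (k j) = xor s (pty j)) (hinj : Function.Injective k)
    (hsum : ∀ f : Fin n ⊕ Fin m → F, ∑ j, f j = f i + ∑ j, f (k j)) :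
    SuperIso F A (⊤ : Submodule F (MJ F n' m')) := by
  obtain ⟨Q, hQ, P, hP, PQ, QP, Qi, φQ, _⟩ := stepQ hp hφ h1 hi
  have hL : PC s pty pty (P.submatrix k id) := by
    intro a b hab
    refine PC_ev hP _ _ fun h2 => hab ?_
    rw [hk, Bool.false_xor] at h2
    have h3 : xor s (pty a) = pty b := h2
    rw [← h3]; simp
  have hR : PC s pty pty (Q.submatrix id k) := by
    intro a b hab
    refine PC_ev hQ _ _ fun h2 => hab ?_
    rw [hk, Bool.false_xor] at h2
    exact h2
  have hLR : P.submatrix k id * Q.submatrix id k = 1 := by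
    rw [← submatrix_mul P Q k id k Function.bijective_id, PQ, submatrix_one k hinj]
  have e1 : ∀ a, Q a i = p a := fun a => by rw [← Qi]; simp
  have e2 : ∀ b, P i b = φ b := fun b => by
    have : φ = Pi.single i 1 ᵥ* P := by rw [← φQ, vecMul_vecMul, QP, vecMul_one]
    rw [this]; simp
  have hRL : Q.submatrix id k * P.submatrix k id = 1 - r1 p φ := by
    ext a b
    have := hsum (fun j => Q a j * P j b)
    rw [← mul_apply, QP, e1, e2] at this
    rw [Matrix.sub_apply, this, r1_apply, add_sub_cancel_left, mul_apply]; rfl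
  refine iso_of hL hR hLR (fun x hx => ?_) (fun x hx => ?_) (fun _ _ => trivial) (fun y _ => ?_)
  · rw [hRL]; exact ((mem_TI hA h x).1 hx).1
  · rw [hRL]; exact ((mem_TI hA h x).1 hx).2
  · rw [mem_TI hA h, ← hRL]
    generalize P.submatrix k id = L at *
    generalize Q.submatrix id k = R at *
    constructor
    · calc R * L * (R * y * L) = R * (L * R) * y * L := by simp only [Matrix.mul_assoc]
        _ = _ := by rw [hLR, Matrix.mul_one]
    · calc R * y * L * (R * L) = R * y * ((L * R) * L) := by simp only [Matrix.mul_assoc]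
        _ = _ := by rw [hLR, Matrix.one_mul]

theorem isoTI {n m : ℕ} {A : Submodule F (MJ F n m)} (hA : IsGraded F A) {α : Bool} {p φ : Fin n ⊕ Fin m → F}
    (hp : p ∈ PV F pty α) (hφ : φ ∈ PV F pty α) (h1 : φ ⬝ᵥ p = 1) (h : TI pty (gr A) (1 - r1 p φ)) :
    (α = false → SuperIso F A (⊤ : Submodule F (MJ F (n - 1) m))) ∧
    (α = true → SuperIso F A (⊤ : Submodule F (MJ F (m - 1) n))) := by
  obtain ⟨i, hi⟩ : ∃ i, p i ≠ 0 := by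
    by_contra! hc
    rw [show p = 0 from funext hc, dotProduct_zero] at h1
    exact zero_ne_one h1
  have hiα : pty i = α := by by_contra hh; exact hi (hp i hh)
  constructor
  · rintro rfl
    obtain i | i := i
    · obtain ⟨n0, rfl⟩ : ∃ n0, n = n0 + 1 := ⟨n - 1, by have := i.2; omega⟩
      refine isoTI_gen (s := false) hA hp hφ h1 h hi (Sum.map i.succAbove id) ?_ ?_ ?_
      · rintro (j | j) <;> simp [pty]
      · exact Sum.map_injective.2 ⟨Fin.succAbove_right_injective, Function.injective_id⟩
      · intro f
        rw [Fintype.sum_sum_type, Fintype.sum_sum_type, Fin.sum_univ_succAbove _ i, add_assoc]; rfl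
    · simp [pty] at hiα
  · rintro rfl
    obtain i | i := i
    · simp [pty] at hiα
    · obtain ⟨m0, rfl⟩ : ∃ m0, m = m0 + 1 := ⟨m - 1, by have := i.2; omega⟩
      refine isoTI_gen (s := true) hA hp hφ h1 h hi (Sum.elim (fun j => Sum.inr (i.succAbove j)) (fun j => Sum.inl j)) ?_ ?_ ?_
      · rintro (j | j) <;> simp [pty]
      · rintro (j | j) (l | l) hjl <;> simp_all
      · intro f
        rw [Fintype.sum_sum_type, Fintype.sum_sum_type, Fin.sum_univ_succAbove (fun j => f (Sum.inr j)) i]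
        rw [add_comm, add_assoc]; rfl

theorem j2 {n m : ℕ} {a b : Bool} {x y : MJ F n m} (hx : x ∈ PM F pty a) (hy : y ∈ PM F pty b) :
    jmul x y = (2 : F)⁻¹ • (x * y + sg F a b • (y * x)) := by
  rw [jmul]
  cases a
  · rw [(odd_mem x).2.2.1.1 hx]; simp
  · cases b
    · rw [(odd_mem y).2.2.1.1 hy]; simp [sg]
    · rw [(odd_mem x).2.2.2.1 hx, (odd_mem y).2.2.2.1 hy]
      have : y * x = (2 : F)⁻¹ • (y * x + y * x) := by rw [← two_smul F (y * x), smul_smul]; simp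
      conv_lhs => rw [this]
      rw [sg_tt, ← smul_sub, this]
      simp only [← this]
      congr 1; rw [neg_smul, one_smul]; abel

theorem jmul_add_left {n m : ℕ} (x x' y : MJ F n m) : jmul (x + x') y = jmul x y + jmul x' y := by
  have : oddPart F (x + x') = oddPart F x + oddPart F x' := by
    ext i j; simp only [oddPart, of_apply, Matrix.add_apply]; split_ifs <;> simp
  simp only [jmul, this, Matrix.add_mul, Matrix.mul_add, smul_add]; abel

theorem jmul_add_right {n m : ℕ} (x y y' : MJ F n m) : jmul x (y + y') = jmul x y + jmul x y' := by
  have : oddPart F (y + y') = oddPart F y + oddPart F y' := by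
    ext i j; simp only [oddPart, of_apply, Matrix.add_apply]; split_ifs <;> simp
  simp only [jmul, this, Matrix.add_mul, Matrix.mul_add, smul_add]; abel

theorem PM_disj {n m : ℕ} {x : MJ F n m} (h : x ∈ PM F pty true) (h2 : x ∈ PM F pty false) : x = 0 := by
  rw [← (odd_mem x).2.2.2.1 h, (odd_mem x).2.2.1.1 h2]

theorem toSim {n m : ℕ} {A : Submodule F (MJ F n m)} (hA : IsSubalg F A) (ht : Nontriv F A) (hs : IsSimple F A) :
    Sim pty (gr A) := by
  have hcl : ∀ {S : Submodule F (MJ F n m)} {x : MJ F n m}, (2 : F)⁻¹ • x ∈ S ↔ x ∈ S := fun {S x} =>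
    S.smul_mem_iff (inv_ne_zero two_ne_zero)
  have hPM : ∀ {a b : Bool} {x y : MJ F n m}, x ∈ PM F pty a → y ∈ PM F pty b → x * y + sg F a b • (y * x) ∈ PM F pty (xor a b) := by
    intro a b x y hx hy
    refine add_mem (PM_mul hx hy) (Submodule.smul_mem _ _ ?_)
    rw [Bool.xor_comm]; exact PM_mul hy hx
  have dec : ∀ x ∈ A, ∃ y ∈ gr A true, ∃ z ∈ gr A false, x = y + z := fun x hx =>
    ⟨_, ((gr_dec hA.1).1 hx).1, _, ((gr_dec hA.1).1 hx).2, by simp⟩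
  refine ⟨⟨fun a => inf_le_right, ?_⟩, ?_, ?_, ?_⟩
  · intro a b x y hx hy
    refine ⟨?_, hPM hx.2 hy.2⟩
    have := hA.2 x hx.1 y hy.1
    rw [j2 hx.2 hy.2] at this
    exact hcl.1 this
  · intro I hI hid
    have hII : ∀ a b x y, x ∈ gr A a → y ∈ I b → jmul x y ∈ I false ⊔ I true := by
      intro a b x y hx hy
      rw [j2 hx.2 (hI b hy).2, hcl]
      have := hid a b x y hx hy
      revert this; generalize xor a b = c; intro this
      cases c
      · exact Submodule.mem_sup_left this
      · exact Submodule.mem_sup_right this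
    have hle : ∀ a, I a ≤ I false ⊔ I true := by intro a; cases a; exacts [le_sup_left, le_sup_right]
    have back : ∀ a x, x ∈ I false ⊔ I true → x ∈ PM F pty a → x ∈ I a := by
      intro a x hx hxa
      obtain ⟨u, hu, v, hv, rfl⟩ := Submodule.mem_sup.1 hx
      have hu2 := (hI _ hu).2
      have hv2 := (hI _ hv).2
      cases a
      · have : v ∈ PM F pty false := by simpa using sub_mem hxa hu2
        rw [PM_disj hv2 this, add_zero]; exact hu
      · have : u ∈ PM F pty true := by simpa using sub_mem hxa hv2
        rw [PM_disj this hu2, zero_add]; exact hv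
    have := hs.2 (I false ⊔ I true) (sup_le ((hI false).trans inf_le_left) ((hI true).trans inf_le_left)) ?_ ?_
    · rcases this with h | h
      · left; intro a; exact le_bot_iff.1 (h ▸ hle a)
      · right; intro a
        refine le_antisymm (hI a) fun x hx => back a x (h ▸ hx.1) hx.2
    · refine le_antisymm (sup_le ?_ ?_) (sup_le inf_le_left inf_le_left)
      · refine le_trans (le_inf le_sup_left ?_) le_sup_left
        rw [PM_pty.1]; exact (hI false).trans inf_le_right
      · refine le_trans (le_inf le_sup_right ?_) le_sup_right
        rw [PM_pty.2]; exact (hI true).trans inf_le_right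
    · intro x hx y hy
      obtain ⟨x1, hx1, x0, hx0, rfl⟩ := dec x hx
      obtain ⟨u, hu, v, hv, rfl⟩ := Submodule.mem_sup.1 hy
      rw [jmul_add_left, jmul_add_right, jmul_add_right]
      exact add_mem (add_mem (hII _ _ _ _ hx1 hu) (hII _ _ _ _ hx1 hv)) (add_mem (hII _ _ _ _ hx0 hu) (hII _ _ _ _ hx0 hv))
  · have := ht; rw [Nontriv, NontrivG, PM_pty.2] at this; exact this
  · obtain ⟨x, hx, y, hy, hxy⟩ := hs.1
    by_contra! hc
    apply hxy
    obtain ⟨x1, hx1, x0, hx0, rfl⟩ := dec x hx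
    obtain ⟨y1, hy1, y0, hy0, rfl⟩ := dec y hy
    rw [jmul_add_left, jmul_add_right, jmul_add_right, j2 hx1.2 hy1.2, j2 hx1.2 hy0.2, j2 hx0.2 hy1.2, j2 hx0.2 hy0.2,
      hc _ _ _ _ hx1 hy1, hc _ _ _ _ hx1 hy0, hc _ _ _ _ hx0 hy1, hc _ _ _ _ hx0 hy0]
    simp

theorem gr_top {n m : ℕ} {A : Submodule F (MJ F n m)} (hA : IsGraded F A) (h : A ≠ ⊤) : ¬ ∀ a, gr A a = PM F pty a := by
  intro hc
  apply h
  refine eq_top_iff.2 fun x _ => ?_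
  rw [gr_dec hA, hc, hc]
  exact ⟨(odd_mem x).1, (odd_mem x).2.1⟩

theorem gr_sum {n m : ℕ} {A B : Submodule F (MJ F n m)} (hA : IsGraded F A) (hB : IsGraded F B) (h : A ⊔ B = ⊤) (a : Bool) :
    gr A a ⊔ gr B a = PM F pty a := by
  refine le_antisymm (sup_le inf_le_right inf_le_right) fun x hx => ?_
  obtain ⟨u, hu, v, hv, rfl⟩ := Submodule.mem_sup.1 (show x ∈ A ⊔ B by rw [h]; trivial)
  obtain ⟨u1, u0⟩ := (gr_dec hA).1 hu
  obtain ⟨v1, v0⟩ := (gr_dec hB).1 hv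
  have ho : oddPart F (u + v) = oddPart F u + oddPart F v := by
    ext i j; simp only [oddPart, of_apply, Matrix.add_apply]; split_ifs <;> simp
  cases a
  · have := (odd_mem _).2.2.1.1 hx
    have e : u + v = (u - oddPart F u) + (v - oddPart F v) := by
      rw [ho] at this
      calc u + v = u + v - (oddPart F u + oddPart F v) := by rw [this, sub_zero]
        _ = _ := by abel
    rw [e]; exact Submodule.add_mem_sup u0 v0
  · have := (odd_mem _).2.2.2.1 hx
    rw [← this, ho]; exact Submodule.add_mem_sup u1 v1

end Ksec

variable (F : Type*) [Field F]

/-- if `M_{n,m}(F)^{(+)} = A + B` (`n, m ≥ 2`) for proper nontrivial simple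
subsuperalgebras `A`, `B`, then (possibly after interchanging `A` and `B`) either `m` is
even, `A ≅ osp(n, m/2)` and `B ≅ M_{n−1,m}(F)^{(+)}`, or `n` is even,
`A ≅ osp(m, n/2)` and `B ≅ M_{m−1,n}(F)^{(+)}`. -/
theorem simple_decompositions_of_Mnm
    (F : Type*) [Field F] [IsAlgClosed F] [CharZero F]
    (n m : ℕ) (hn : 2 ≤ n) (hm : 2 ≤ m)
    (A B : Submodule F (MJ F n m))
    (hA : IsSubalg F A) (hB : IsSubalg F B)
    (hAp : A ≠ ⊤) (hBp : B ≠ ⊤)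
    (hAt : Nontriv F A) (hBt : Nontriv F B)
    (hAs : IsSimple F A) (hBs : IsSimple F B)
    (hsum : A ⊔ B = ⊤) :
    (∃ q : ℕ, m = 2 * q ∧
      ((SuperIso F A (ospSub F n q) ∧
          SuperIso F B (⊤ : Submodule F (MJ F (n - 1) m))) ∨
       (SuperIso F B (ospSub F n q) ∧
          SuperIso F A (⊤ : Submodule F (MJ F (n - 1) m))))) ∨
    (∃ q : ℕ, n = 2 * q ∧
      ((SuperIso F A (ospSub F m q) ∧
          SuperIso F B (⊤ : Submodule F (MJ F (m - 1) n))) ∨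
       (SuperIso F B (ospSub F m q) ∧
          SuperIso F A (⊤ : Submodule F (MJ F (m - 1) n))))) := by
  obtain ⟨α, G, p, hp, φ, hφ, h1, h⟩ := main_str (toSim hA hAt hAs) (toSim hB hBt hBs) (gr_sum hA.1 hB.1 hsum)
    (gr_top hA.1 hAp) (gr_top hB.1 hBp) (by
      intro β
      refine Finset.card_pos.2 ?_
      cases β
      · exact ⟨Sum.inl ⟨0, by omega⟩, Finset.mem_filter.2 ⟨Finset.mem_univ _, rfl⟩⟩
      · exact ⟨Sum.inr ⟨0, by omega⟩, Finset.mem_filter.2 ⟨Finset.mem_univ _, rfl⟩⟩)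
  cases α
  · left
    have hσ : ∀ j : Fin n ⊕ Fin m, pty ((Equiv.refl _) j) = xor false (pty j) := fun j => by simp
    rcases h with ⟨h2, h3⟩ | ⟨h2, h3⟩
    · obtain ⟨q, hq, hi⟩ := isoTII hA.1 h2 (Equiv.refl _) hσ
      exact ⟨q, hq, Or.inl ⟨hi, (isoTI hB.1 hp hφ h1 h3).1 rfl⟩⟩
    · obtain ⟨q, hq, hi⟩ := isoTII hB.1 h2 (Equiv.refl _) hσ
      exact ⟨q, hq, Or.inr ⟨hi, (isoTI hA.1 hp hφ h1 h3).1 rfl⟩⟩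
  · right
    have hσ : ∀ j : Fin m ⊕ Fin n, pty ((Equiv.sumComm _ _) j) = xor true (pty j) := by
      rintro (j | j) <;> simp [pty]
    rcases h with ⟨h2, h3⟩ | ⟨h2, h3⟩
    · obtain ⟨q, hq, hi⟩ := isoTII hA.1 h2 (Equiv.sumComm _ _) hσ
      exact ⟨q, hq, Or.inl ⟨hi, (isoTI hB.1 hp hφ h1 h3).2 rfl⟩⟩
    · obtain ⟨q, hq, hi⟩ := isoTII hB.1 h2 (Equiv.sumComm _ _) hσ
      exact ⟨q, hq, Or.inr ⟨hi, (isoTI hA.1 hp hφ h1 h3).2 rfl⟩⟩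

end SJ
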